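/- For every p ∈ (1,∞) there exists a constant C_p < ∞ such that the Riesz transform 𝓡 = ∇𝓛^{−1/2}, i.e. the operator 𝓡f(x) = Σ_{y∈T} (K(x,y) − K(𝔭(x),y)) f(y) μ(y) defined for all finitely supported f : T → ℂ, satisfies ‖𝓡f‖_{L^p(μ)} ≤ C_p ‖f‖_{L^p(μ)}; hence 𝓡 extends to a bounded operator on L^p(μ). -/

import Mathlib

open MeasureTheory ENNReal Set Function
open scoped NNReal ENNReal Classical

noncomputable section

/-- A homogeneous tree of degree `q+1` with a distinguished end (mythical ancestor),
encoded through its graph distance `dist`, horocyclic level function `level`,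
and predecessor map `pred`. -/
structure FlowTree (q : ℕ) where
  V : Type
  countableV : Countable V
  dist : V → V → ℕ
  level : V → ℤ
  pred : V → V
  dist_self : ∀ x, dist x x = 0
  eq_of_dist_eq_zero : ∀ x y, dist x y = 0 → x = y
  dist_comm : ∀ x y, dist x y = dist y x
  dist_triangle : ∀ x y z, dist x z ≤ dist x y + dist y z
  level_pred : ∀ x, level (pred x) = level x + 1
  succ_finite : ∀ x, Set.Finite {y | pred y = x}
  succ_card : ∀ x, Nat.card {y // pred y = x} = q
  dist_le : ∀ (x y : V) (n m : ℕ), pred^[n] x = pred^[m] y → dist x y ≤ n + m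
  dist_spec : ∀ x y, ∃ n m : ℕ, pred^[n] x = pred^[m] y ∧ n + m = dist x y

namespace FlowTree

variable {q : ℕ} (S : FlowTree q)

/-- The canonical flow measure weight `μ(x) = q^{ℓ(x)}`, as an extended nonnegative real. -/
def w (x : S.V) : ℝ≥0∞ := (q : ℝ≥0∞) ^ ((S.level x : ℤ) : ℝ)

/-- The canonical flow measure weight `μ(x) = q^{ℓ(x)}`, as a real number. -/
def wR (x : S.V) : ℝ := (q : ℝ) ^ (S.level x)

/-- The canonical flow measure of a set `E ⊆ T`. -/
def muS (E : Set S.V) : ℝ≥0∞ := ∑' x : E, S.w x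

/-- The `L^p(μ)` (quasi)norm, `p ∈ [1,∞]`. -/
def lpNorm (p : ℝ≥0∞) {E : Type*} [NNNorm E] (f : S.V → E) : ℝ≥0∞ :=
  if p = ∞ then ⨆ x, (‖f x‖₊ : ℝ≥0∞)
  else (∑' x, (‖f x‖₊ : ℝ≥0∞) ^ p.toReal * S.w x) ^ (1 / p.toReal)

/-- The weak `L^{1,∞}(μ)` quasinorm `sup_{λ>0} λ · μ({|f| > λ})`. -/
def wkNorm {E : Type*} [NNNorm E] (f : S.V → E) : ℝ≥0∞ :=
  ⨆ t : ℝ≥0, (t : ℝ≥0∞) * S.muS {x | t < ‖f x‖₊}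

/-- `Σf(x) = f(𝔭(x))`. -/
def sig (f : S.V → ℂ) : S.V → ℂ := fun x => f (S.pred x)

/-- `Σ*f(x) = (1/q) Σ_{y ∈ succ(x)} f(y)`. -/
def sigStar (f : S.V → ℂ) : S.V → ℂ :=
  fun x => (q : ℂ)⁻¹ * ∑' y : {y | S.pred y = x}, f y.1

/-- The flow gradient `∇ = id − Σ`. -/
def grad (f : S.V → ℂ) : S.V → ℂ := fun x => f x - f (S.pred x)

/-- `∇* = id − Σ*`. -/
def gradStar (f : S.V → ℂ) : S.V → ℂ := fun x => f x - S.sigStar f x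

/-- The modulus of the gradient `Df(x) = Σ_{y ∼ x} |f(x) − f(y)|`. -/
def Dmod (f : S.V → ℂ) : S.V → ℝ :=
  fun x => ∑' y : {y | S.dist x y = 1}, ‖f x - f y.1‖

/-- `Σ̃_n = Σ^n` for `n ≥ 0` and `(Σ*)^{−n}` for `n < 0`. -/
def sigTilde (n : ℤ) (f : S.V → ℂ) : S.V → ℂ :=
  if 0 ≤ n then (S.sig)^[n.toNat] f else (S.sigStar)^[(-n).toNat] f

/-- `Σ*` acting on real-valued functions. -/
def sigStarR (f : S.V → ℝ) : S.V → ℝ :=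
  fun x => (q : ℝ)⁻¹ * ∑' y : {y | S.pred y = x}, f y.1

/-- The flow Laplacian `𝓛 = id − (Σ + Σ*)/2`, acting pointwise on real functions. -/
def lapR (f : S.V → ℝ) : S.V → ℝ :=
  fun x => f x - (f (S.pred x) + S.sigStarR f x) / 2

/-- `δ_y/μ(y)`, the normalized delta at `y`. -/
def deltaMu (y : S.V) : S.V → ℝ := fun z => if z = y then (S.wR y)⁻¹ else 0

/-- The heat kernel `H_t(x,y)` of the flow Laplacian, i.e. `(e^{−t𝓛} (δ_y/μ(y)))(x)`
computed via the exponential power series of the bounded operator `𝓛`. -/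
def Hker (t : ℝ) (x y : S.V) : ℝ :=
  ∑' n : ℕ, ((-t) ^ n / (n.factorial : ℝ)) * ((S.lapR)^[n] (S.deltaMu y)) x

/-- The integral kernel `K(x,y)` of `𝓛^{−1/2}`, by subordination. -/
def Kker (x y : S.V) : ℝ :=
  (Real.sqrt Real.pi)⁻¹ * ∫ t in Set.Ioi (0 : ℝ), S.Hker t x y * t ^ (-(1 : ℝ)/2)

/-- The Riesz transform `𝓡 = ∇𝓛^{−1/2}`, defined on finitely supported functions. -/
def riesz (f : S.V → ℂ) : S.V → ℂ :=
  fun x => ∑' y, ((S.Kker x y - S.Kker (S.pred x) y : ℝ) : ℂ) * f y * (S.wR y : ℂ)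

/-- The integral operator with almost-radial kernel `q^{−ℓ(x)/2} G(d(x,y)) q^{−ℓ(y)/2}`. -/
def kernelOp (G : ℕ → ℂ) (f : S.V → ℂ) : S.V → ℂ :=
  fun x => ∑' y, (((q : ℝ) ^ (-((S.level x : ℤ) : ℝ)/2) * (q : ℝ) ^ (-((S.level y : ℤ) : ℝ)/2) : ℝ) : ℂ)
    * G (S.dist x y) * f y * (S.wR y : ℂ)

/-- The ε-horizontal gradient `∇_ε f(x) = (1/q) Σ_{y ∈ succ(x)} ε(y) f(y)`. -/
def hgrad (ε f : S.V → ℂ) : S.V → ℂ :=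
  fun x => (q : ℂ)⁻¹ * ∑' y : {y | S.pred y = x}, ε y.1 * f y.1

/-- The adjoint ε-horizontal gradient `∇_ε* f(x) = conj(ε(x)) f(𝔭(x))`. -/
def hgradStar (ε f : S.V → ℂ) : S.V → ℂ :=
  fun x => (starRingEnd ℂ) (ε x) * f (S.pred x)

/-- `‖ε‖_∞`. -/
def epsSup (ε : S.V → ℂ) : ℝ≥0∞ := ⨆ x, (‖ε x‖₊ : ℝ≥0∞)

/-- The `L²(μ)` inner product. -/
def inner2 (f g : S.V → ℂ) : ℂ := ∑' x, f x * (starRingEnd ℂ) (g x) * (S.wR x : ℂ)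

/-- `y ≤ x` iff `d(x,y) = ℓ(x) − ℓ(y)`. -/
def le' (y x : S.V) : Prop := (S.dist x y : ℤ) = S.level x - S.level y

/-- Admissible trapezoids of `(T,μ)`. -/
def IsAdmissibleTrapezoid (F : Set S.V) : Prop :=
  (∃ x, F = {x}) ∨
  ∃ (x₀ : S.V) (h1 h2 : ℕ), 0 < h1 ∧ 2 * h1 ≤ h2 ∧ h2 ≤ 12 * h1 ∧
    F = {x | S.le' x x₀ ∧ S.level x₀ - (h2 : ℤ) < S.level x ∧ S.level x ≤ S.level x₀ - (h1 : ℤ)}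

/-- `(1,∞)`-atoms of `(T,μ)`. -/
def IsOneInftyAtom (a : S.V → ℂ) : Prop :=
  ∃ F : Set S.V, S.IsAdmissibleTrapezoid F ∧ Function.support a ⊆ F ∧
    (∑' x, a x * (S.wR x : ℂ)) = 0 ∧ ∀ x, (‖a x‖₊ : ℝ≥0∞) ≤ (S.muS F)⁻¹

end FlowTree

namespace ZRiesz

/-- The discrete Laplacian on `ℤ`. -/
def deltaZ (F : ℤ → ℝ) : ℤ → ℝ := fun n => F n - (F (n + 1) + F (n - 1)) / 2

/-- The heat kernel `h_t^ℤ = e^{−tΔ_ℤ} δ_0` on `ℤ`, via the exponential power series. -/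
def heatZ (t : ℝ) (n : ℤ) : ℝ :=
  ∑' k : ℕ, ((-t) ^ k / (k.factorial : ℝ)) *
    (deltaZ^[k] (fun m => if m = 0 then (1 : ℝ) else 0)) n

/-- Kernel of the Riesz transform on `ℤ`: `k_ℤ(n) = π^{−1/2} ∫₀^∞ (∇_ℤ h_t^ℤ)(n) t^{−1/2} dt`. -/
def kZ (n : ℤ) : ℝ :=
  (Real.sqrt Real.pi)⁻¹ * ∫ t in Set.Ioi (0 : ℝ), (heatZ t n - heatZ t (n + 1)) * t ^ (-(1 : ℝ)/2)

/-- Kernel of the skew-symmetric part: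
`k̃_ℤ(n) = π^{−1/2} ∫₀^∞ (∇̃_ℤ h_t^ℤ)(n) t^{−1/2} dt`. -/
def ktZ (n : ℤ) : ℝ :=
  (Real.sqrt Real.pi)⁻¹ *
    ∫ t in Set.Ioi (0 : ℝ), (heatZ t (n - 1) - heatZ t (n + 1)) * t ^ (-(1 : ℝ)/2)

/-- The closed formula `k̃_ℤ(m) = (2√2/π) m/(m² − 1/4)`. -/
def ktZc (m : ℤ) : ℝ := (2 * Real.sqrt 2 / Real.pi) * (m : ℝ) / ((m : ℝ) ^ 2 - 1/4)

/-- `G(n) = Σ_{k≥0} q^{−(n+2k)/2} k̃_ℤ(n+2k+1)` (subordination kernel version). -/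
def Gint (q : ℕ) (n : ℕ) : ℝ :=
  ∑' k : ℕ, (q : ℝ) ^ (-(((n : ℝ)) + 2 * (k : ℝ))/2) * ktZ ((n : ℤ) + 2 * (k : ℤ) + 1)

/-- `G(n) = Σ_{k≥0} q^{−(n+2k)/2} k̃_ℤ(n+2k+1)` (closed formula version). -/
def Gc (q : ℕ) (n : ℕ) : ℝ :=
  ∑' k : ℕ, (q : ℝ) ^ (-(((n : ℝ)) + 2 * (k : ℝ))/2) * ktZc ((n : ℤ) + 2 * (k : ℤ) + 1)

/-- The `ℓ^p(ℤ)` norm. -/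
def zlpNorm (p : ℝ≥0∞) (F : ℤ → ℂ) : ℝ≥0∞ :=
  if p = ∞ then ⨆ n, (‖F n‖₊ : ℝ≥0∞)
  else (∑' n : ℤ, (‖F n‖₊ : ℝ≥0∞) ^ p.toReal) ^ (1 / p.toReal)

/-- The `ℓ^{1,∞}(ℕ)` quasinorm. -/
def natWk (F : ℕ → ℂ) : ℝ≥0∞ :=
  ⨆ t : ℝ≥0, (t : ℝ≥0∞) * ∑' (_ : {n : ℕ | t < ‖F n‖₊}), (1 : ℝ≥0∞)

end ZRiesz

/-- The punctured boundary `Ω = ∂T \ {ω_*}` of the tree, together with the measure `ν`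
with `ν(Ω_x) = q^{ℓ(x)}`.  `vert ω n` is the vertex `ω_n` of level `n` on the geodesic
`[ω, ω_*]`. -/
structure FlowTreeBoundary {q : ℕ} (S : FlowTree q) where
  Ω : Type
  mΩ : MeasurableSpace Ω
  ν : @MeasureTheory.Measure Ω mΩ
  vert : Ω → ℤ → S.V
  level_vert : ∀ ω n, S.level (vert ω n) = n
  pred_vert : ∀ ω n, S.pred (vert ω n) = vert ω (n + 1)
  vert_surj : ∀ x : S.V, ∃ ω, vert ω (S.level x) = x
  vert_inj : ∀ ω ω', (∀ n, vert ω n = vert ω' n) → ω = ω'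
  meas_cone : ∀ x : S.V, @MeasurableSet Ω mΩ {ω | vert ω (S.level x) = x}
  nu_cone : ∀ x : S.V, ν {ω | vert ω (S.level x) = x} = (q : ℝ≥0∞) ^ ((S.level x : ℤ) : ℝ)

attribute [instance] FlowTreeBoundary.mΩ

namespace FlowTreeBoundary

variable {q : ℕ} {S : FlowTree q} (B : FlowTreeBoundary S)

/-- The product measure `ν × #` on `Ω × ℤ`. -/
def pm : MeasureTheory.Measure (B.Ω × ℤ) := B.ν.prod MeasureTheory.Measure.count

/-- `Ω_x = {ω : x ∈ [ω, ω_*]}`. -/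
def cone (x : S.V) : Set B.Ω := {ω | B.vert ω (S.level x) = x}

/-- The lifting operator `Φf(ω,n) = f(ω_n)`. -/
def lift (f : S.V → ℂ) : B.Ω × ℤ → ℂ := fun p => f (B.vert p.1 p.2)

/-- The lifting operator on `ℝ≥0∞`-valued functions. -/
def liftNN (f : S.V → ℝ≥0∞) : B.Ω × ℤ → ℝ≥0∞ := fun p => f (B.vert p.1 p.2)

/-- The adjoint `Φ*g(x) = ν(Ω_x)^{−1} ∫_{Ω_x} g(ω, ℓ(x)) dν(ω)`. -/
def liftStar (g : B.Ω × ℤ → ℂ) : S.V → ℂ :=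
  fun x => ((B.ν (B.cone x)).toReal)⁻¹ * ∫ ω in B.cone x, g (ω, S.level x) ∂B.ν

/-- The adjoint `Φ*` on `ℝ≥0∞`-valued functions. -/
def liftStarNN (g : B.Ω × ℤ → ℝ≥0∞) : S.V → ℝ≥0∞ :=
  fun x => (B.ν (B.cone x))⁻¹ * ∫⁻ ω in B.cone x, g (ω, S.level x) ∂B.ν

end FlowTreeBoundary

/-- The weak `L^{1,∞}(μ)` quasinorm with respect to a measure. -/
def wkMeas {α : Type*} [MeasurableSpace α] (μ : MeasureTheory.Measure α) (g : α → ℂ) : ℝ≥0∞ :=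
  ⨆ t : ℝ≥0, (t : ℝ≥0∞) * μ {a | t < ‖g a‖₊}

/-- The weak `L^{1,∞}(μ)` quasinorm for `ℝ≥0∞`-valued functions. -/
def wkMeasNN {α : Type*} [MeasurableSpace α] (μ : MeasureTheory.Measure α) (g : α → ℝ≥0∞) :
    ℝ≥0∞ :=
  ⨆ t : ℝ≥0, (t : ℝ≥0∞) * μ {a | (t : ℝ≥0∞) < g a}

end

namespace FlowTree

variable {q : ℕ} (S : FlowTree q)

theorem level_iterate (k : ℕ) (x : S.V) : S.level (S.pred^[k] x) = S.level x + k := by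
  induction k with
  | zero => simp
  | succ k ih => rw [iterate_succ_apply', S.level_pred, ih]; push_cast; ring

theorem wR_pos (hq : 0 < q) (x : S.V) : 0 < S.wR x :=
  zpow_pos (by exact_mod_cast hq) _

theorem wR_iterate (hq : 0 < q) (k : ℕ) (x : S.V) :
    S.wR (S.pred^[k] x) = (q : ℝ) ^ k * S.wR x := by
  have : (q : ℝ) ≠ 0 := by exact_mod_cast hq.ne'
  rw [wR, wR, level_iterate, zpow_add₀ this, zpow_natCast, mul_comm]

theorem desc_finite (z : S.V) (k : ℕ) : {y | S.pred^[k] y = z}.Finite := by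
  induction k generalizing z with
  | zero => simp
  | succ k ih =>
    have : {y | S.pred^[k + 1] y = z} = ⋃ u ∈ {u | S.pred u = z}, {y | S.pred^[k] y = u} := by
      ext y
      simp [iterate_succ_apply']
    rw [this]
    exact (S.succ_finite z).biUnion fun u _ => ih u

/-- The `k`-th generation descendants of `z`. -/
noncomputable def desc (z : S.V) (k : ℕ) : Finset S.V := (S.desc_finite z k).toFinset

@[simp]
theorem mem_desc {z y : S.V} {k : ℕ} : y ∈ S.desc z k ↔ S.pred^[k] y = z := by
  simp [desc]

theorem card_desc_one (z : S.V) : (S.desc z 1).card = q := by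
  refine Eq.trans ?_ (S.succ_card z)
  rw [desc, ← Nat.card_eq_card_finite_toFinset]
  rfl

theorem card_desc (z : S.V) (k : ℕ) : (S.desc z k).card = q ^ k := by
  induction k with
  | zero => rw [Finset.card_eq_one.2 ⟨z, by ext; simp⟩, pow_zero]
  | succ k ih =>
    have hmaps : ∀ y ∈ S.desc z (k + 1), S.pred y ∈ S.desc z k := by
      intro y hy
      rw [mem_desc] at hy ⊢
      rwa [iterate_succ_apply] at hy
    rw [Finset.card_eq_sum_card_fiberwise hmaps, pow_succ, ← ih, ← smul_eq_mul,
      ← Finset.sum_const]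
    apply Finset.sum_congr rfl
    intro u hu
    refine Eq.trans ?_ (S.card_desc_one u)
    congr 1
    ext y
    simp only [Finset.mem_filter, mem_desc, iterate_succ_apply, iterate_zero, id]
    rw [mem_desc] at hu
    constructor
    · exact fun h => h.2
    · intro h; exact ⟨by rw [h]; exact hu, h⟩

theorem level_of_mem_desc {z y : S.V} {k : ℕ} (h : y ∈ S.desc z k) : S.level y = S.level z - k := by
  rw [mem_desc] at h
  rw [← h, level_iterate]; ring

theorem wR_of_mem_desc (hq : 0 < q) {z y : S.V} {k : ℕ} (h : y ∈ S.desc z k) :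
    S.wR z = (q : ℝ) ^ k * S.wR y := by
  rw [mem_desc] at h
  rw [← h, S.wR_iterate hq]

theorem sum_desc_wR (hq : 0 < q) (z : S.V) (k : ℕ) : ∑ y ∈ S.desc z k, S.wR y = S.wR z := by
  have hq' : (q : ℝ) ≠ 0 := by exact_mod_cast hq.ne'
  have : ∀ y ∈ S.desc z k, S.wR y = ((q : ℝ) ^ k)⁻¹ * S.wR z := by
    intro y hy
    rw [S.wR_of_mem_desc hq hy]; field_simp
  rw [Finset.sum_congr rfl this, Finset.sum_const, card_desc, nsmul_eq_mul]
  push_cast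
  field_simp

theorem exists_iterate_eq (x y : S.V) : ∃ n m : ℕ, S.pred^[n] x = S.pred^[m] y :=
  let ⟨n, m, h, _⟩ := S.dist_spec x y
  ⟨n, m, h⟩

/-- Indicator that the `m`-th ancestor of `x` is the `n`-th ancestor of `y`. -/
noncomputable def E (m n : ℕ) (x y : S.V) : ℝ := if S.pred^[m] x = S.pred^[n] y then 1 else 0

theorem E_nonneg (m n : ℕ) (x y : S.V) : 0 ≤ S.E m n x y := by
  unfold E; split_ifs <;> norm_num

theorem E_le_one (m n : ℕ) (x y : S.V) : S.E m n x y ≤ 1 := by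
  unfold E; split_ifs <;> norm_num

theorem E_symm (m n : ℕ) (x y : S.V) : S.E m n x y = S.E n m y x := by
  simp only [E, eq_comm]

theorem level_of_E_ne {m n : ℕ} {x y : S.V} (h : S.E m n x y ≠ 0) :
    S.level x + m = S.level y + n := by
  have : S.pred^[m] x = S.pred^[n] y := by
    by_contra h'
    exact h (if_neg h')
  rw [← level_iterate, this, level_iterate]

theorem E_mul_wR (hq : 0 < q) (m n : ℕ) (x y : S.V) :
    S.E m n x y * ((q : ℝ) ^ m * S.wR x) = S.E m n x y * ((q : ℝ) ^ n * S.wR y) := by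
  unfold E
  split_ifs with h
  · rw [← S.wR_iterate hq, ← S.wR_iterate hq, h]
  · simp

/-- The symmetric weight attached to the pair `(m, n)`. -/
theorem E_weight (hq : 0 < q) (m n : ℕ) (x y : S.V) :
    S.wR x * (S.E m n x y * ((q : ℝ) ^ n)⁻¹) = S.wR y * (S.E m n x y * ((q : ℝ) ^ m)⁻¹) := by
  have hq' : (q : ℝ) ≠ 0 := by exact_mod_cast hq.ne'
  have := S.E_mul_wR hq m n x y
  field_simp
  linarith

theorem sum_E_left_le (m n : ℕ) (y : S.V) (F : Finset S.V) :
    ∑ x ∈ F, S.E m n x y ≤ (q : ℝ) ^ m := by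
  have : ∑ x ∈ F, S.E m n x y = (F.filter (fun x => S.pred^[m] x = S.pred^[n] y)).card := by
    simp only [E]
    rw [Finset.sum_boole]
  rw [this, ← Nat.cast_pow, ← S.card_desc (S.pred^[n] y) m]
  norm_cast
  apply Finset.card_le_card
  intro x hx
  rw [mem_desc]
  exact (Finset.mem_filter.1 hx).2

theorem summable_E (hq : 2 ≤ q) (x y : S.V) :
    Summable fun ab : ℕ × ℕ => S.E ab.1 ab.2 x y * ((q : ℝ) ^ ab.2)⁻¹ := by
  have hq' : (2 : ℝ) ≤ q := by exact_mod_cast hq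
  have hg : Summable fun b : ℕ => ((2 : ℝ)⁻¹) ^ b :=
    summable_geometric_of_lt_one (by norm_num) (by norm_num)
  refine summable_of_sum_le (c := ∑' b : ℕ, ((2 : ℝ)⁻¹) ^ b)
    (fun ab => mul_nonneg (S.E_nonneg _ _ _ _) (by positivity)) fun s => ?_
  calc ∑ ab ∈ s, S.E ab.1 ab.2 x y * ((q : ℝ) ^ ab.2)⁻¹
      = ∑ ab ∈ s with S.E ab.1 ab.2 x y ≠ 0, S.E ab.1 ab.2 x y * ((q : ℝ) ^ ab.2)⁻¹ := by
        rw [Finset.sum_filter]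
        apply Finset.sum_congr rfl
        intro ab _
        split_ifs with h
        · rfl
        · simp only [not_not] at h
          rw [h, zero_mul]
    _ ≤ ∑ ab ∈ s with S.E ab.1 ab.2 x y ≠ 0, ((2 : ℝ)⁻¹) ^ ab.2 := by
        apply Finset.sum_le_sum
        intro ab _
        rw [inv_pow]
        calc _ ≤ 1 * ((q : ℝ) ^ ab.2)⁻¹ := by gcongr; exact S.E_le_one _ _ _ _
          _ ≤ _ := by rw [one_mul]; gcongr
    _ = ∑ b ∈ (s.filter fun ab => S.E ab.1 ab.2 x y ≠ 0).image Prod.snd, ((2 : ℝ)⁻¹) ^ b := by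
        rw [Finset.sum_image]
        rintro ⟨a, b⟩ h ⟨a', b'⟩ h' (rfl : b = b')
        have h1 := S.level_of_E_ne (Finset.mem_filter.1 h).2
        have h2 := S.level_of_E_ne (Finset.mem_filter.1 h').2
        simp only at h1 h2
        have : a = a' := by omega
        rw [this]
    _ ≤ _ := hg.sum_le_tsum _ fun _ _ => by positivity

theorem summable_mul_E (hq : 2 ≤ q) (x y : S.V) {d : ℕ × ℕ → ℝ} {B : ℝ} (hd : ∀ ab, |d ab| ≤ B) :
    Summable fun ab : ℕ × ℕ => d ab * (S.E ab.1 ab.2 x y * ((q : ℝ) ^ ab.2)⁻¹) := by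
  refine Summable.of_norm_bounded ((S.summable_E hq x y).mul_left B) fun ab => ?_
  rw [norm_mul, Real.norm_eq_abs, Real.norm_eq_abs,
    abs_of_nonneg (mul_nonneg (S.E_nonneg _ _ _ _) (by positivity) :
      0 ≤ S.E ab.1 ab.2 x y * ((q : ℝ) ^ ab.2)⁻¹)]
  exact mul_le_mul_of_nonneg_right (hd ab) (mul_nonneg (S.E_nonneg _ _ _ _) (by positivity))

end FlowTree

namespace ZRiesz

/-- The coefficients `∫₀¹ rⁿ w₀(r) dr` of the expansion of `𝓛^{-1/2}`. -/
noncomputable def kap (n : ℕ) : ℝ :=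
  Real.sqrt 2 / Real.pi * (1 / ((n : ℝ) + 1 / 2) + 1 / ((n : ℝ) + 3 / 2))

/-- The Taylor coefficients of `(1 - z)^{-1/2}`. -/
noncomputable def bet (n : ℕ) : ℝ := (n.centralBinom : ℝ) / 4 ^ n

/-- The subordination density on `(0,1)`. -/
noncomputable def dens (r : ℝ) : ℝ := Real.sqrt 2 / Real.pi * ((1 + r) / Real.sqrt r)

theorem sqrt_two_div_pi_le : Real.sqrt 2 / Real.pi ≤ 1 / 2 := by
  rw [div_le_iff₀ Real.pi_pos, Real.sqrt_le_left (by positivity)]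
  nlinarith [Real.pi_gt_three]

theorem kap_pos (n : ℕ) : 0 < kap n := by unfold kap; positivity

theorem kap_sub_succ (n : ℕ) : kap n - kap (n + 1) =
    Real.sqrt 2 / Real.pi * (2 / (((n : ℝ) + 1 / 2) * ((n : ℝ) + 5 / 2))) := by
  unfold kap
  rw [← mul_sub]
  congr 1
  push_cast
  have h1 : (n : ℝ) + 1 / 2 ≠ 0 := by positivity
  have h2 : (n : ℝ) + 3 / 2 ≠ 0 := by positivity
  have h3 : (n : ℝ) + 5 / 2 ≠ 0 := by positivity
  rw [show (n : ℝ) + 1 + 1 / 2 = n + 3 / 2 by ring, show (n : ℝ) + 1 + 3 / 2 = n + 5 / 2 by ring]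
  rw [add_sub_add_comm, sub_eq_add_neg (1 / ((n : ℝ) + 3 / 2)), add_comm]
  rw [show 1 / ((n : ℝ) + 3 / 2) + -(1 / (n + 5 / 2)) + (1 / (n + 1 / 2) - 1 / (n + 3 / 2))
    = 1 / (n + 1 / 2) - 1 / (n + 5 / 2) by ring]
  rw [div_sub_div _ _ h1 h3]
  congr 1
  ring

theorem kap_antitone : Antitone kap := by
  apply antitone_nat_of_succ_le
  intro n
  have := kap_sub_succ n
  have h : 0 ≤ Real.sqrt 2 / Real.pi * (2 / (((n : ℝ) + 1 / 2) * ((n : ℝ) + 5 / 2))) := by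
    positivity
  linarith

theorem kap_diff_antitone : Antitone fun n => kap n - kap (n + 1) := by
  intro a b hab
  simp only [kap_sub_succ]
  gcongr

theorem kap_le (n : ℕ) : kap n ≤ 2 / ((n : ℝ) + 1) := by
  unfold kap
  have h1 : (0 : ℝ) < (n : ℝ) + 1 / 2 := by positivity
  have h2 : (0 : ℝ) < (n : ℝ) + 3 / 2 := by positivity
  have hn : (0 : ℝ) ≤ n := Nat.cast_nonneg n
  calc _ ≤ 1 / 2 * (1 / ((n : ℝ) + 1 / 2) + 1 / ((n : ℝ) + 3 / 2)) := by
        exact mul_le_mul_of_nonneg_right sqrt_two_div_pi_le (by positivity)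
    _ ≤ _ := by
        rw [div_add_div _ _ h1.ne' h2.ne', div_mul_div_comm, div_le_div_iff₀ (by positivity)
          (by positivity)]
        nlinarith

theorem kap_le_two (n : ℕ) : kap n ≤ 2 := by
  refine (kap_le n).trans ?_
  rw [div_le_iff₀ (by positivity)]
  have hn : (0 : ℝ) ≤ n := Nat.cast_nonneg n
  linarith

theorem kap_tendsto : Filter.Tendsto kap Filter.atTop (nhds 0) := by
  refine squeeze_zero (fun n => (kap_pos n).le) kap_le ?_
  have := (tendsto_one_div_add_atTop_nhds_zero_nat (𝕜 := ℝ)).const_mul 2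
  simpa only [mul_one_div, mul_zero] using this

theorem bet_nonneg (n : ℕ) : 0 ≤ bet n := by unfold bet; positivity

theorem bet_zero : bet 0 = 1 := by simp [bet]

theorem bet_succ (n : ℕ) : ((n : ℝ) + 1) * bet (n + 1) = ((n : ℝ) + 1 / 2) * bet n := by
  have h := Nat.succ_mul_centralBinom_succ n
  have h' : ((n : ℝ) + 1) * ((n + 1).centralBinom : ℝ) = 2 * (2 * n + 1) * (n.centralBinom : ℝ) := by
    exact_mod_cast h
  unfold bet
  rw [← mul_div_assoc, h', pow_succ]
  field_simp
  ring

theorem gamma_half (n : ℕ) :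
    Real.Gamma ((n : ℝ) + 1 / 2) = Real.sqrt Real.pi * (n.factorial : ℝ) * bet n := by
  induction n with
  | zero => rw [Nat.cast_zero, zero_add, Real.Gamma_one_half_eq]; simp [bet_zero]
  | succ n ih =>
    have h := bet_succ n
    have : ((n + 1 : ℕ) : ℝ) + 1 / 2 = ((n : ℝ) + 1 / 2) + 1 := by push_cast; ring
    rw [this, Real.Gamma_add_one (by positivity), ih, Nat.factorial_succ]
    push_cast
    linear_combination (-Real.sqrt Real.pi * (n.factorial : ℝ)) * h

theorem dens_nonneg {r : ℝ} (hr : 0 ≤ r) : 0 ≤ dens r := by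
  unfold dens; positivity

theorem dens_mul_pow (n : ℕ) {r : ℝ} (hr : 0 < r) : dens r * r ^ n =
    Real.sqrt 2 / Real.pi * (r ^ ((n : ℝ) - 1 / 2) + r ^ ((n : ℝ) + 1 / 2)) := by
  unfold dens
  rw [sub_eq_add_neg, Real.rpow_add hr, Real.rpow_add hr, Real.rpow_natCast, Real.rpow_neg hr.le,
    ← Real.sqrt_eq_rpow]
  have h1 := Real.sqrt_pos.2 hr
  have h2 := Real.mul_self_sqrt hr.le
  have h3 : (1 + r) / √r = (√r)⁻¹ + √r := by
    field_simp
    rw [sq, h2]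
  rw [h3]
  ring

theorem dens_pow_integral (n : ℕ) : IntegrableOn (fun r => dens r * r ^ n) (Ioo 0 1) ∧
    ∫ r in Ioo (0 : ℝ) 1, dens r * r ^ n = kap n := by
  have hn : (0 : ℝ) ≤ n := Nat.cast_nonneg n
  have i1 := intervalIntegral.intervalIntegrable_rpow' (a := 0) (b := 1)
    (show -1 < (n : ℝ) - 1 / 2 by linarith)
  have i2 := intervalIntegral.intervalIntegrable_rpow' (a := 0) (b := 1)
    (show -1 < (n : ℝ) + 1 / 2 by linarith)
  have i3 := (i1.add i2).const_mul (Real.sqrt 2 / Real.pi)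
  have e : ∀ r ∈ Ioo (0 : ℝ) 1, Real.sqrt 2 / Real.pi *
      (r ^ ((n : ℝ) - 1 / 2) + r ^ ((n : ℝ) + 1 / 2)) = dens r * r ^ n := fun r hr =>
    (dens_mul_pow n hr.1).symm
  constructor
  · rw [intervalIntegrable_iff_integrableOn_Ioo_of_le zero_le_one] at i3
    exact i3.congr_fun e measurableSet_Ioo
  · rw [← setIntegral_congr_fun measurableSet_Ioo e, ← integral_Ioc_eq_integral_Ioo,
      ← intervalIntegral.integral_of_le zero_le_one, intervalIntegral.integral_const_mul,
      intervalIntegral.integral_add i1 i2, integral_rpow (Or.inl (by linarith)),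
      integral_rpow (Or.inl (by linarith)), Real.zero_rpow (by linarith),
      Real.zero_rpow (by linarith), Real.one_rpow, Real.one_rpow, kap]
    congr 1
    ring_nf

/-- The `n`-th term `2ⁿrⁿ/(1+r²)ⁿ⁺¹` of the geometric expansion of a resolvent. -/
noncomputable def geo (n : ℕ) (r : ℝ) : ℝ := (2 * r / (1 + r ^ 2)) ^ n / (1 + r ^ 2)

theorem geo_nonneg (n : ℕ) {r : ℝ} (hr : 0 ≤ r) : 0 ≤ geo n r := by unfold geo; positivity

theorem ratio_le_one (r : ℝ) : 2 * r / (1 + r ^ 2) ≤ 1 := by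
  rw [div_le_one (by positivity)]
  nlinarith [sq_nonneg (r - 1)]

theorem geo_le_one (n : ℕ) {r : ℝ} (hr : 0 ≤ r) : geo n r ≤ 1 := by
  unfold geo
  rw [div_le_one (by positivity)]
  have h := pow_le_one₀ (n := n) (by positivity : 0 ≤ 2 * r / (1 + r ^ 2)) (ratio_le_one r)
  nlinarith [sq_nonneg r]

theorem geo_continuous (n : ℕ) : Continuous (geo n) := by
  unfold geo
  have : ∀ r : ℝ, 1 + r ^ 2 ≠ 0 := fun r => by positivity
  fun_prop (disch := assumption)

theorem dens_geo_integrable (n : ℕ) : IntegrableOn (fun r => dens r * geo n r) (Ioo 0 1) := by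
  have h0 : IntegrableOn dens (Ioo 0 1) := by simpa using (dens_pow_integral 0).1
  refine Integrable.mono' h0 (h0.aestronglyMeasurable.mul
    (geo_continuous n).aestronglyMeasurable) ?_
  refine (ae_restrict_iff' measurableSet_Ioo).2 (Filter.Eventually.of_forall fun r hr => ?_)
  have hr0 : 0 ≤ r := hr.1.le
  rw [Real.norm_eq_abs, abs_of_nonneg (mul_nonneg (dens_nonneg hr0) (geo_nonneg n hr0))]
  exact mul_le_of_le_one_right (dens_nonneg hr0) (geo_le_one n hr0)

theorem dens_geo_integral_zero : ∫ r in Ioo (0 : ℝ) 1, dens r * geo 0 r = 1 := by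
  have hint := dens_geo_integrable 0
  rw [← intervalIntegrable_iff_integrableOn_Ioo_of_le zero_le_one] at hint
  rw [← integral_Ioc_eq_integral_Ioo, ← intervalIntegral.integral_of_le zero_le_one]
  let A : ℝ → ℝ := fun r => -(2 / Real.pi) * Real.arctan ((1 - r) / (Real.sqrt 2 * Real.sqrt r))
  have hd : ∀ r ∈ Ioo (0 : ℝ) 1, HasDerivAt A (dens r * geo 0 r) r := by
    intro r hr
    have hs := Real.sqrt_pos.2 hr.1
    have h2 : (0 : ℝ) < √2 := by positivity
    have d1 : HasDerivAt (fun r : ℝ => 1 - r) (-1) r := by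
      simpa using (hasDerivAt_id r).const_sub 1
    have d2 := (Real.hasDerivAt_sqrt hr.1.ne').const_mul (√2)
    have d3 := (d1.div d2 (by positivity)).arctan.const_mul (-(2 / Real.pi))
    refine d3.congr_deriv ?_
    simp only [dens, geo]
    have h2' : √2 ^ 2 = 2 := Real.sq_sqrt (by norm_num)
    have hs' : √r ^ 2 = r := Real.sq_sqrt hr.1.le
    have h3 : 1 + ((1 - r) / (√2 * √r)) ^ 2 = (1 + r ^ 2) / (2 * r) := by
      rw [div_pow, mul_pow, h2', hs']
      have := hr.1.ne'
      field_simp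
      ring
    simp only [Pi.div_apply]
    rw [h3]
    have hr0 := hr.1.ne'
    have hpi := Real.pi_pos.ne'
    have : 1 + r ^ 2 ≠ 0 := by positivity
    generalize hσ : √r = s at *
    generalize √2 = a at *
    subst hs'
    field_simp
    rw [h2']
    ring
  have h0 : Filter.Tendsto A (nhdsWithin 0 (Ioi 0)) (nhds (-1)) := by
    have t1 : Filter.Tendsto (fun r : ℝ => √2 * √r) (nhdsWithin 0 (Ioi 0))
        (nhdsWithin 0 (Ioi 0)) := by
      apply tendsto_nhdsWithin_of_tendsto_nhds_of_eventually_within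
      · have : Continuous fun r : ℝ => √2 * √r := by fun_prop
        have := this.tendsto 0
        simp only [Real.sqrt_zero, mul_zero] at this
        exact this.mono_left nhdsWithin_le_nhds
      · filter_upwards [self_mem_nhdsWithin] with r hr
        have := Real.sqrt_pos.2 (mem_Ioi.1 hr)
        exact mem_Ioi.2 (by positivity)
    have t2 : Filter.Tendsto (fun r : ℝ => 1 - r) (nhdsWithin 0 (Ioi 0)) (nhds 1) := by
      have : Continuous fun r : ℝ => 1 - r := by fun_prop
      have := this.tendsto 0
      simp only [sub_zero] at this
      exact this.mono_left nhdsWithin_le_nhds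
    have t3 := t2.pos_mul_atTop one_pos (tendsto_inv_nhdsGT_zero.comp t1)
    have t4 := (Real.tendsto_arctan_atTop.mono_right nhdsWithin_le_nhds).comp t3
    have t5 := t4.const_mul (-(2 / Real.pi))
    have : -(2 / Real.pi) * (Real.pi / 2) = -1 := by
      have := Real.pi_pos.ne'
      field_simp
    rw [this] at t5
    exact t5
  have h1 : Filter.Tendsto A (nhdsWithin 1 (Iio 1)) (nhds 0) := by
    have : ContinuousAt A 1 := by
      have : Real.sqrt 2 * Real.sqrt 1 ≠ 0 := by positivity
      fun_prop (disch := assumption)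
    have := this.tendsto
    have hA : A 1 = 0 := by simp [A]
    rw [hA] at this
    exact this.mono_left nhdsWithin_le_nhds
  rw [intervalIntegral.integral_eq_sub_of_hasDerivAt_of_tendsto one_pos hd hint h0 h1]
  norm_num

theorem dens_geo_integral_succ (n : ℕ) :
    ((n : ℝ) + 1) * ∫ r in Ioo (0 : ℝ) 1, dens r * geo (n + 1) r =
      ((n : ℝ) + 1 / 2) * ∫ r in Ioo (0 : ℝ) 1, dens r * geo n r := by
  have hi := fun n => (intervalIntegrable_iff_integrableOn_Ioo_of_le zero_le_one).2
    (dens_geo_integrable n)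
  let G : ℝ → ℝ := fun r =>
    √2 / Real.pi * ((1 - r) * √r * ((2 * r / (1 + r ^ 2)) ^ n / (1 + r ^ 2)))
  let g : ℝ → ℝ := fun r => ((n : ℝ) + 1 / 2) * (dens r * geo n r)
    - ((n : ℝ) + 1) * (dens r * geo (n + 1) r)
  have hc : ContinuousOn G (Icc 0 1) := by
    have : ∀ r : ℝ, 1 + r ^ 2 ≠ 0 := fun r => by positivity
    have : Continuous G := by fun_prop (disch := assumption)
    exact this.continuousOn
  have hd : ∀ r ∈ Ioo (0 : ℝ) 1, HasDerivAt G (g r) r := by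
    intro r hr
    have hs := Real.sqrt_pos.2 hr.1
    have hr0 := hr.1.ne'
    have hne : 1 + r ^ 2 ≠ 0 := by positivity
    have d1 : HasDerivAt (fun r : ℝ => 1 - r) (-1) r := by
      simpa using (hasDerivAt_id r).const_sub 1
    have d2 := Real.hasDerivAt_sqrt hr.1.ne'
    have d3 : HasDerivAt (fun r : ℝ => 1 + r ^ 2) (2 * r) r := by
      simpa using ((hasDerivAt_id r).pow 2).const_add 1
    have d4 : HasDerivAt (fun r : ℝ => 2 * r) 2 r := by
      simpa using (hasDerivAt_id r).const_mul 2
    have d5 := (d4.div d3 hne).pow n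
    have d6 := ((d1.mul d2).mul (d5.div d3 hne)).const_mul (√2 / Real.pi)
    refine d6.congr_deriv ?_
    simp only [g, dens, geo, pow_succ, Pi.mul_apply, Pi.div_apply, Pi.pow_apply]
    have hZ : (n : ℝ) * (2 * r / (1 + r ^ 2)) ^ (n - 1)
        = n * (2 * r / (1 + r ^ 2)) ^ n * ((1 + r ^ 2) / (2 * r)) := by
      rcases n with _ | n
      · simp
      · rw [Nat.add_sub_cancel, pow_succ (2 * r / (1 + r ^ 2)) n]
        generalize (2 * r / (1 + r ^ 2)) ^ n = X
        field_simp
    simp only [pow_succ, pow_zero, one_mul] at hZ ⊢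
    rw [hZ]
    simp only [pow_succ, pow_zero, one_mul] at hne
    generalize (2 * r / (1 + r * r)) ^ n = X
    have hs' : √r * √r = r := Real.mul_self_sqrt hr.1.le
    have hpi := Real.pi_pos.ne'
    generalize √r = s at *
    generalize √2 = a at *
    subst hs'
    field_simp
    ring
  have h := intervalIntegral.integral_eq_sub_of_hasDerivAt_of_le zero_le_one hc hd
    (((hi n).const_mul _).sub ((hi (n + 1)).const_mul _))
  have hG1 : G 1 = 0 := by simp [G]
  have hG0 : G 0 = 0 := by simp [G]
  rw [hG1, hG0, sub_zero] at h
  simp only [g] at h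
  rw [intervalIntegral.integral_sub ((hi n).const_mul _) ((hi (n + 1)).const_mul _),
    intervalIntegral.integral_const_mul, intervalIntegral.integral_const_mul] at h
  rw [← integral_Ioc_eq_integral_Ioo, ← intervalIntegral.integral_of_le zero_le_one,
    ← integral_Ioc_eq_integral_Ioo, ← intervalIntegral.integral_of_le zero_le_one]
  linarith

theorem dens_geo_integral (n : ℕ) : ∫ r in Ioo (0 : ℝ) 1, dens r * geo n r = bet n := by
  induction n with
  | zero => rw [dens_geo_integral_zero, bet_zero]
  | succ n ih =>
    have h1 := dens_geo_integral_succ n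
    have h2 := bet_succ n
    rw [ih, ← h2] at h1
    exact mul_left_cancel₀ (by positivity) h1

end ZRiesz

namespace FlowTree

variable {q : ℕ} (S : FlowTree q)

/-- The adjoint shift on real functions as a linear map. -/
noncomputable def star : Module.End ℝ (S.V → ℝ) where
  toFun f x := (q : ℝ)⁻¹ * ∑ y ∈ S.desc x 1, f y
  map_add' f g := by ext x; simp [Finset.sum_add_distrib, mul_add]
  map_smul' c f := by ext x; simp [Finset.mul_sum, mul_left_comm]

/-- The averaging operator `(Σ + Σ*)/2` as a linear map. -/
noncomputable def avg : Module.End ℝ (S.V → ℝ) where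
  toFun f x := (f (S.pred x) + S.star f x) / 2
  map_add' f g := by ext x; simp; ring
  map_smul' c f := by ext x; simp; ring

theorem star_apply (f : S.V → ℝ) (x : S.V) :
    S.star f x = (q : ℝ)⁻¹ * ∑ y ∈ S.desc x 1, f y := rfl

theorem avg_apply (f : S.V → ℝ) (x : S.V) :
    S.avg f x = (f (S.pred x) + S.star f x) / 2 := rfl

theorem sigStarR_eq (f : S.V → ℝ) : S.sigStarR f = S.star f := by
  ext x
  unfold sigStarR
  rw [star_apply]
  congr 1
  have : {y | S.pred y = x} = ((S.desc x 1 : Finset S.V) : Set S.V) := by ext; simp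
  rw [tsum_congr_set_coe f this]
  exact Finset.tsum_subtype' _ _

theorem lapR_eq (f : S.V → ℝ) : S.lapR f = (1 - S.avg) f := by
  ext x
  simp [lapR, sigStarR_eq, avg_apply]

theorem lapR_iterate (n : ℕ) (f : S.V → ℝ) : (S.lapR)^[n] f = ((1 - S.avg) ^ n) f := by
  induction n generalizing f with
  | zero => simp
  | succ n ih => rw [iterate_succ_apply, ih, lapR_eq, pow_succ]; rfl

theorem avg_abs_le (hq : 0 < q) {f : S.V → ℝ} {B : ℝ} (hf : ∀ x, |f x| ≤ B) (x : S.V) :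
    |S.avg f x| ≤ B := by
  have hq' : (q : ℝ) ≠ 0 := by exact_mod_cast hq.ne'
  have h1 : |S.star f x| ≤ B := by
    rw [star_apply, abs_mul, abs_of_nonneg (by positivity : (0 : ℝ) ≤ (q : ℝ)⁻¹)]
    calc (q : ℝ)⁻¹ * |∑ y ∈ S.desc x 1, f y| ≤ (q : ℝ)⁻¹ * ∑ y ∈ S.desc x 1, B := by
          gcongr
          exact (Finset.abs_sum_le_sum_abs _ _).trans (Finset.sum_le_sum fun y _ => hf y)
      _ = B := by
          rw [Finset.sum_const, card_desc, nsmul_eq_mul, pow_one]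
          field_simp
  rw [avg_apply, abs_div, abs_two]
  have := abs_add_le (f (S.pred x)) (S.star f x)
  have := hf (S.pred x)
  linarith

theorem avg_nonneg {f : S.V → ℝ} (hf : ∀ x, 0 ≤ f x) (x : S.V) : 0 ≤ S.avg f x := by
  rw [avg_apply, star_apply]
  have := Finset.sum_nonneg fun y (_ : y ∈ S.desc x 1) => hf y
  have := hf (S.pred x)
  positivity

theorem avg_pow_abs_le (hq : 0 < q) {f : S.V → ℝ} {B : ℝ} (hf : ∀ x, |f x| ≤ B) (n : ℕ) (x : S.V) :
    |(S.avg ^ n) f x| ≤ B := by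
  induction n generalizing x with
  | zero => simpa using hf x
  | succ n ih => rw [pow_succ']; exact S.avg_abs_le hq ih x

theorem avg_pow_nonneg {f : S.V → ℝ} (hf : ∀ x, 0 ≤ f x) (n : ℕ) (x : S.V) :
    0 ≤ (S.avg ^ n) f x := by
  induction n generalizing x with
  | zero => simpa using hf x
  | succ n ih => rw [pow_succ']; exact S.avg_nonneg ih x

/-- The indicator of a vertex. -/
noncomputable def delta (y : S.V) : S.V → ℝ := fun z => if z = y then 1 else 0

theorem delta_nonneg (y z : S.V) : 0 ≤ S.delta y z := by unfold delta; split_ifs <;> norm_num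

theorem delta_abs_le (y z : S.V) : |S.delta y z| ≤ 1 := by unfold delta; split_ifs <;> norm_num

theorem sum_desc_E (n : ℕ) (x y : S.V) :
    ∑ z ∈ S.desc x 1, S.E 0 n z y = S.E 0 (n + 1) x y := by
  have h : ∀ z ∈ S.desc x 1, S.E 0 n z y = if z = S.pred^[n] y then 1 else 0 := fun z _ => rfl
  rw [Finset.sum_congr rfl h, Finset.sum_ite_eq']
  simp [E, eq_comm, iterate_succ_apply']

/-- The resolvent `(1 - rΣ*)⁻¹ δ_y`. -/
noncomputable def resStar (r : ℝ) (y x : S.V) : ℝ := ∑' b : ℕ, (r / q) ^ b * S.E 0 b x y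

/-- The resolvent `(1 - rΣ)⁻¹ (1 - rΣ*)⁻¹ δ_y`. -/
noncomputable def res (r : ℝ) (y x : S.V) : ℝ := ∑' a : ℕ, r ^ a * S.resStar r y (S.pred^[a] x)

theorem div_q_le (hq : 2 ≤ q) {r : ℝ} (hr0 : 0 < r) (hr1 : r < 1) : r / q ≤ 2⁻¹ := by
  have : (2 : ℝ) ≤ q := by exact_mod_cast hq
  rw [div_le_iff₀ (by linarith)]
  linarith

theorem resStar_term_le (hq : 2 ≤ q) {r : ℝ} (hr0 : 0 < r) (hr1 : r < 1)
    (b : ℕ) (x y : S.V) : (r / q) ^ b * S.E 0 b x y ≤ (2⁻¹ : ℝ) ^ b := by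
  have h := div_q_le hq hr0 hr1
  calc (r / q) ^ b * S.E 0 b x y ≤ (r / q) ^ b * 1 := by gcongr; exact S.E_le_one _ _ _ _
    _ ≤ _ := by rw [mul_one]; gcongr

theorem resStar_term_nonneg (hq : 2 ≤ q) {r : ℝ} (hr0 : 0 < r)
    (b : ℕ) (x y : S.V) : 0 ≤ (r / q) ^ b * S.E 0 b x y :=
  mul_nonneg (by positivity) (S.E_nonneg _ _ _ _)

theorem resStar_summable (hq : 2 ≤ q) {r : ℝ} (hr0 : 0 < r) (hr1 : r < 1)
    (x y : S.V) : Summable fun b : ℕ => (r / q) ^ b * S.E 0 b x y :=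
  Summable.of_nonneg_of_le (fun b => S.resStar_term_nonneg hq hr0 b x y)
    (fun b => S.resStar_term_le hq hr0 hr1 b x y)
    (summable_geometric_of_lt_one (by norm_num) (by norm_num))

theorem resStar_abs_le (hq : 2 ≤ q) {r : ℝ} (hr0 : 0 < r) (hr1 : r < 1)
    (x y : S.V) : |S.resStar r y x| ≤ 2 := by
  rw [resStar, abs_of_nonneg (tsum_nonneg fun b => S.resStar_term_nonneg hq hr0 b x y)]
  refine ((S.resStar_summable hq hr0 hr1 x y).tsum_le_tsum
    (fun b => S.resStar_term_le hq hr0 hr1 b x y)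
    (summable_geometric_of_lt_one (by norm_num) (by norm_num))).trans_eq ?_
  rw [tsum_geometric_of_lt_one (by norm_num) (by norm_num)]
  norm_num

theorem resStar_eq (hq : 2 ≤ q) {r : ℝ} (hr0 : 0 < r) (hr1 : r < 1) (x y : S.V) :
    r * S.star (S.resStar r y) x = S.resStar r y x - S.delta y x := by
  have hs := S.resStar_summable hq hr0 hr1
  have hq' : (q : ℝ) ≠ 0 := by
    have : 0 < q := by omega
    exact_mod_cast this.ne'
  rw [star_apply]
  simp only [resStar]
  rw [← Summable.tsum_finsetSum (fun z _ => hs z y), (hs x y).tsum_eq_zero_add]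
  simp_rw [← Finset.mul_sum, sum_desc_E]
  rw [← mul_assoc, ← div_eq_mul_inv, ← tsum_mul_left]
  simp_rw [← mul_assoc, ← pow_succ']
  have h0 : (r / q) ^ 0 * S.E 0 0 x y = S.delta y x := by
    rw [pow_zero, one_mul]
    rfl
  rw [h0, add_sub_cancel_left]

theorem res_summable (hq : 2 ≤ q) {r : ℝ} (hr0 : 0 < r) (hr1 : r < 1)
    (x y : S.V) : Summable fun a : ℕ => r ^ a * S.resStar r y (S.pred^[a] x) := by
  refine Summable.of_norm_bounded ((summable_geometric_of_lt_one hr0.le hr1).mul_right 2)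
    fun a => ?_
  rw [Real.norm_eq_abs, abs_mul, abs_of_nonneg (by positivity : 0 ≤ r ^ a)]
  gcongr
  exact S.resStar_abs_le hq hr0 hr1 _ _

theorem res_abs_le (hq : 2 ≤ q) {r : ℝ} (hr0 : 0 < r) (hr1 : r < 1)
    (x y : S.V) : |S.res r y x| ≤ (1 - r)⁻¹ * 2 := by
  rw [res, ← Real.norm_eq_abs]
  refine tsum_of_norm_bounded ((hasSum_geometric_of_lt_one hr0.le hr1).mul_right 2) fun a => ?_
  rw [Real.norm_eq_abs, abs_mul, abs_of_nonneg (by positivity : 0 ≤ r ^ a)]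
  gcongr
  exact S.resStar_abs_le hq hr0 hr1 _ _

theorem res_eq (hq : 2 ≤ q) {r : ℝ} (hr0 : 0 < r) (hr1 : r < 1)
    (x y : S.V) : S.res r y x = S.resStar r y x + r * S.res r y (S.pred x) := by
  unfold res
  rw [(S.res_summable hq hr0 hr1 x y).tsum_eq_zero_add, ← tsum_mul_left]
  simp [pow_succ', mul_assoc, iterate_succ_apply]

theorem res_avg (hq : 2 ≤ q) {r : ℝ} (hr0 : 0 < r) (hr1 : r < 1) (x y : S.V) :
    S.res r y x = S.delta y x / (1 + r ^ 2) + 2 * r / (1 + r ^ 2) * S.avg (S.res r y) x := by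
  have hq' : (q : ℝ) ≠ 0 := by
    have : 0 < q := by omega
    exact_mod_cast this.ne'
  have h1 : S.star (S.res r y) x = S.star (S.resStar r y) x + r * S.res r y x := by
    simp only [star_apply]
    rw [Finset.sum_congr rfl fun z _ => S.res_eq hq hr0 hr1 z y, Finset.sum_add_distrib, mul_add]
    congr 1
    have : ∀ z ∈ S.desc x 1, r * S.res r y (S.pred z) = r * S.res r y x := by
      intro z hz
      rw [mem_desc] at hz
      simp only [iterate_one] at hz
      rw [hz]
    rw [Finset.sum_congr rfl this, Finset.sum_const, card_desc, nsmul_eq_mul, pow_one]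
    field_simp
  have h2 := S.res_eq hq hr0 hr1 x y
  have h3 := S.resStar_eq hq hr0 hr1 x y
  rw [avg_apply, h1]
  have : 1 + r ^ 2 ≠ 0 := by positivity
  field_simp
  linear_combination h2 - h3

theorem res_hasSum (hq : 2 ≤ q) {r : ℝ} (hr0 : 0 < r) (hr1 : r < 1) (x y : S.V) :
    HasSum (fun n => ZRiesz.geo n r * (S.avg ^ n) (S.delta y) x) (S.res r y x) := by
  set θ := 2 * r / (1 + r ^ 2) with hθ
  have hθ0 : 0 ≤ θ := by positivity
  have hθ1 : θ < 1 := by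
    rw [hθ, div_lt_one (by positivity)]
    nlinarith [sq_pos_of_ne_zero (sub_ne_zero.2 hr1.ne)]
  rw [hasSum_iff_tendsto_nat_of_nonneg fun n => mul_nonneg (ZRiesz.geo_nonneg n hr0.le)
    (S.avg_pow_nonneg (S.delta_nonneg y) n x)]
  have hfun : S.res r y = (1 + r ^ 2)⁻¹ • S.delta y + θ • S.avg (S.res r y) := by
    ext z
    rw [S.res_avg hq hr0 hr1 z y]
    simp [hθ]
    ring
  have key : ∀ N : ℕ, S.res r y x = ∑ n ∈ Finset.range N,
      ZRiesz.geo n r * (S.avg ^ n) (S.delta y) x + θ ^ N * (S.avg ^ N) (S.res r y) x := by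
    intro N
    induction N with
    | zero => simp
    | succ N ih =>
      rw [ih, Finset.sum_range_succ]
      have : (S.avg ^ N) (S.res r y) x = (1 + r ^ 2)⁻¹ * (S.avg ^ N) (S.delta y) x
          + θ * (S.avg ^ (N + 1)) (S.res r y) x := by
        conv_lhs => rw [hfun]
        rw [map_add, map_smul, map_smul, pow_succ]
        rfl
      rw [this, ZRiesz.geo, ← hθ]
      ring
  have hlim : Filter.Tendsto (fun N : ℕ => θ ^ N * (S.avg ^ N) (S.res r y) x) Filter.atTop
      (nhds 0) := by
    apply squeeze_zero_norm (a := fun N : ℕ => θ ^ N * ((1 - r)⁻¹ * 2))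
    · intro N
      rw [Real.norm_eq_abs, abs_mul, abs_of_nonneg (by positivity : 0 ≤ θ ^ N)]
      gcongr
      exact S.avg_pow_abs_le (by omega) (fun z => S.res_abs_le hq hr0 hr1 z y) N x
    · simpa using (tendsto_pow_atTop_nhds_zero_of_lt_one hθ0 hθ1).mul_const ((1 - r)⁻¹ * 2)
  have := (tendsto_const_nhds (x := S.res r y x)).sub hlim
  rw [sub_zero] at this
  refine this.congr fun N => ?_
  rw [key N]
  ring

theorem res_eq_tsum (hq : 2 ≤ q) {r : ℝ} (hr0 : 0 < r) (hr1 : r < 1) (x y : S.V) : S.res r y x =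
    ∑' ab : ℕ × ℕ, r ^ (ab.1 + ab.2) * (S.E ab.1 ab.2 x y * ((q : ℝ) ^ ab.2)⁻¹) := by
  have hs := S.summable_mul_E hq x y (d := fun ab => r ^ (ab.1 + ab.2)) (B := 1) fun ab => by
    rw [abs_of_nonneg (by positivity)]
    exact pow_le_one₀ hr0.le hr1.le
  rw [hs.tsum_prod]
  unfold res resStar
  congr 1
  ext a
  rw [← tsum_mul_left]
  congr 1
  ext b
  have hE : S.E 0 b (S.pred^[a] x) y = S.E a b x y := rfl
  rw [hE, div_pow, pow_add]
  ring

end FlowTree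

theorem hasSum_of_ennreal_tsum_ofReal_eq {ι : Type*} {f : ι → ℝ} {K : ℝ} (hf : ∀ i, 0 ≤ f i)
    (hK : 0 ≤ K) (h : ∑' i, ENNReal.ofReal (f i) = ENNReal.ofReal K) : HasSum f K := by
  have hs : Summable f := by
    have := ENNReal.summable_toReal (f := fun i => ENNReal.ofReal (f i)) (by rw [h]; simp)
    simpa [ENNReal.toReal_ofReal (hf _)] using this
  rw [← ENNReal.ofReal_tsum_of_nonneg hf hs,
    ENNReal.ofReal_eq_ofReal_iff (tsum_nonneg hf) hK] at h
  exact h ▸ hs.hasSum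

namespace FlowTree

variable {q : ℕ} (S : FlowTree q)

/-- The kernel of `𝓛^{-1/2}` with respect to the counting measure. -/
noncomputable def Kc (x y : S.V) : ℝ :=
  ∑' ab : ℕ × ℕ, ZRiesz.kap (ab.1 + ab.2) * (S.E ab.1 ab.2 x y * ((q : ℝ) ^ ab.2)⁻¹)

theorem E_weight_nonneg (ab : ℕ × ℕ) (x y : S.V) :
    0 ≤ S.E ab.1 ab.2 x y * ((q : ℝ) ^ ab.2)⁻¹ :=
  mul_nonneg (S.E_nonneg _ _ _ _) (by positivity)

theorem lintegral_res (hq : 2 ≤ q) (x y : S.V) :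
    ∫⁻ r in Ioo (0 : ℝ) 1, ENNReal.ofReal (ZRiesz.dens r * S.res r y x)
      = ENNReal.ofReal (S.Kc x y) := by
  have hk : ∀ ab : ℕ × ℕ, |ZRiesz.kap (ab.1 + ab.2)| ≤ 2 := fun ab => by
    rw [abs_of_pos (ZRiesz.kap_pos _)]; exact ZRiesz.kap_le_two _
  have h1 : ∀ r ∈ Ioo (0 : ℝ) 1, ENNReal.ofReal (ZRiesz.dens r * S.res r y x) =
      ∑' ab : ℕ × ℕ, ENNReal.ofReal (ZRiesz.dens r * r ^ (ab.1 + ab.2)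
        * (S.E ab.1 ab.2 x y * ((q : ℝ) ^ ab.2)⁻¹)) := by
    intro r hr
    have hs := S.summable_mul_E hq x y (d := fun ab => r ^ (ab.1 + ab.2)) (B := 1) fun ab => by
      rw [abs_of_nonneg (pow_nonneg hr.1.le _)]
      exact pow_le_one₀ hr.1.le hr.2.le
    rw [S.res_eq_tsum hq hr.1 hr.2, ← tsum_mul_left, ENNReal.ofReal_tsum_of_nonneg]
    · simp_rw [mul_assoc]
    · exact fun ab => mul_nonneg (ZRiesz.dens_nonneg hr.1.le)
        (mul_nonneg (pow_nonneg hr.1.le _) (S.E_weight_nonneg ab x y))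
    · exact hs.mul_left _
  rw [setLIntegral_congr_fun measurableSet_Ioo h1, lintegral_tsum, Kc,
    ENNReal.ofReal_tsum_of_nonneg _ (S.summable_mul_E hq x y hk)]
  · congr 1
    ext ab
    obtain ⟨hi, he⟩ := ZRiesz.dens_pow_integral (ab.1 + ab.2)
    rw [← ofReal_integral_eq_lintegral_ofReal (hi.mul_const _), integral_mul_const, he]
    rw [Filter.EventuallyLE, ae_restrict_iff' measurableSet_Ioo]
    exact Filter.Eventually.of_forall fun r hr => mul_nonneg (mul_nonneg
      (ZRiesz.dens_nonneg hr.1.le) (pow_nonneg hr.1.le _)) (S.E_weight_nonneg ab x y)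
  · exact fun ab => mul_nonneg (ZRiesz.kap_pos _).le (S.E_weight_nonneg ab x y)
  · intro ab
    exact ((ZRiesz.dens_pow_integral (ab.1 + ab.2)).1.mul_const _).aestronglyMeasurable.aemeasurable.ennreal_ofReal

theorem Kc_nonneg (x y : S.V) : 0 ≤ S.Kc x y :=
  tsum_nonneg fun ab => mul_nonneg (ZRiesz.kap_pos _).le (S.E_weight_nonneg ab x y)

theorem hasSum_bet (hq : 2 ≤ q) (x y : S.V) :
    HasSum (fun n => ZRiesz.bet n * (S.avg ^ n) (S.delta y) x) (S.Kc x y) := by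
  have ha : ∀ n, 0 ≤ (S.avg ^ n) (S.delta y) x := fun n => S.avg_pow_nonneg (S.delta_nonneg y) n x
  refine hasSum_of_ennreal_tsum_ofReal_eq
    (fun n => mul_nonneg (ZRiesz.bet_nonneg n) (ha n)) (S.Kc_nonneg x y) ?_
  rw [← S.lintegral_res hq x y]
  have h1 : ∀ r ∈ Ioo (0 : ℝ) 1, ENNReal.ofReal (ZRiesz.dens r * S.res r y x) =
      ∑' n : ℕ, ENNReal.ofReal (ZRiesz.dens r * ZRiesz.geo n r * (S.avg ^ n) (S.delta y) x) := by
    intro r hr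
    have hs := S.res_hasSum hq hr.1 hr.2 x y
    rw [← hs.tsum_eq, ← tsum_mul_left, ENNReal.ofReal_tsum_of_nonneg]
    · simp_rw [mul_assoc]
    · exact fun n => mul_nonneg (ZRiesz.dens_nonneg hr.1.le)
        (mul_nonneg (ZRiesz.geo_nonneg n hr.1.le) (ha n))
    · exact hs.summable.mul_left _
  rw [setLIntegral_congr_fun measurableSet_Ioo h1, lintegral_tsum]
  · congr 1
    ext n
    have hi := ZRiesz.dens_geo_integrable n
    rw [← ofReal_integral_eq_lintegral_ofReal (hi.mul_const _), integral_mul_const,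
      ZRiesz.dens_geo_integral]
    rw [Filter.EventuallyLE, ae_restrict_iff' measurableSet_Ioo]
    exact Filter.Eventually.of_forall fun r hr => mul_nonneg (mul_nonneg
      (ZRiesz.dens_nonneg hr.1.le) (ZRiesz.geo_nonneg n hr.1.le)) (ha n)
  · intro n
    exact ((ZRiesz.dens_geo_integrable n).mul_const _).aestronglyMeasurable.aemeasurable.ennreal_ofReal

theorem deltaMu_eq (y : S.V) : S.deltaMu y = (S.wR y)⁻¹ • S.delta y := by
  ext z
  simp [deltaMu, delta]

theorem one_sub_avg_pow (k : ℕ) (f : S.V → ℝ) (x : S.V) : ((1 - S.avg) ^ k) f x =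
    ∑ m ∈ Finset.HasAntidiagonal.antidiagonal k, (k.choose m.1 : ℝ) * ((-1) ^ m.2 * (S.avg ^ m.2) f x) := by
  have : (1 - S.avg) ^ k = ∑ m ∈ Finset.HasAntidiagonal.antidiagonal k,
      k.choose m.1 • ((1 : Module.End ℝ (S.V → ℝ)) ^ m.1 * (-S.avg) ^ m.2) := by
    rw [sub_eq_add_neg]
    exact (Commute.one_left _).add_pow' k
  rw [this]
  simp only [LinearMap.sum_apply, Finset.sum_apply]
  apply Finset.sum_congr rfl
  intro m _
  rw [one_pow, one_mul, ← neg_one_smul ℝ S.avg, smul_pow]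
  simp
  ring

theorem Hker_eq (hq : 0 < q) (t : ℝ) (x y : S.V) : S.Hker t x y = (S.wR y)⁻¹ *
    (Real.exp (-t) * ∑' n : ℕ, t ^ n / (n.factorial : ℝ) * (S.avg ^ n) (S.delta y) x) := by
  have h1 : Summable fun n : ℕ => ‖(-t) ^ n / (n.factorial : ℝ)‖ :=
    (Real.summable_pow_div_factorial (-t)).norm
  have h2 : Summable fun n : ℕ => ‖t ^ n / (n.factorial : ℝ) * (S.avg ^ n) (S.delta y) x‖ := by
    refine Summable.of_nonneg_of_le (fun _ => norm_nonneg _) (fun n => ?_)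
      (Real.summable_pow_div_factorial t).norm
    rw [norm_mul]
    exact mul_le_of_le_one_right (norm_nonneg _) (S.avg_pow_abs_le hq (S.delta_abs_le y) n x)
  have h3 : Real.exp (-t) = ∑' n : ℕ, (-t) ^ n / (n.factorial : ℝ) := by
    rw [Real.exp_eq_exp_ℝ, NormedSpace.exp_eq_tsum_div]
  rw [h3, tsum_mul_tsum_eq_tsum_sum_antidiagonal_of_summable_norm h1 h2, ← tsum_mul_left, Hker]
  congr 1
  ext k
  rw [lapR_iterate, deltaMu_eq, map_smul, Pi.smul_apply, smul_eq_mul, one_sub_avg_pow,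
    Finset.mul_sum, Finset.mul_sum, Finset.mul_sum]
  apply Finset.sum_congr rfl
  rintro ⟨i, j⟩ hij
  rw [Finset.HasAntidiagonal.mem_antidiagonal] at hij
  simp only at hij ⊢
  subst hij
  have h4 : ((i + j).choose i : ℝ) * (i.factorial * j.factorial) = (i + j).factorial := by
    rw [← mul_assoc, Nat.choose_symm_add]
    exact_mod_cast Nat.add_choose_mul_factorial_mul_factorial i j
  have h5 : ((i + j).factorial : ℝ) ≠ 0 := by positivity
  have h6 : (-t) ^ (i + j) * (-1) ^ j = (-t) ^ i * t ^ j := by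
    rw [pow_add, mul_assoc, ← mul_pow]
    ring
  have h7 : (-t) ^ (i + j) / ((i + j).factorial : ℝ) * ((i + j).choose i : ℝ) * (-1) ^ j
      = (-t) ^ i / (i.factorial : ℝ) * (t ^ j / (j.factorial : ℝ)) := by
    field_simp
    rw [mul_assoc ((-t) ^ (i + j)), ← h4]
    linear_combination ((i.factorial : ℝ) * j.factorial * (i + j).choose i) * h6
  linear_combination ((S.wR y)⁻¹ * (S.avg ^ j) (S.delta y) x) * h7

theorem heat_moment (n : ℕ) : IntegrableOn
      (fun t : ℝ => Real.exp (-t) * (t ^ n / (n.factorial : ℝ)) * t ^ (-(1 : ℝ) / 2)) (Ioi 0) ∧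
    ∫ t in Ioi (0 : ℝ), Real.exp (-t) * (t ^ n / (n.factorial : ℝ)) * t ^ (-(1 : ℝ) / 2)
      = Real.sqrt Real.pi * ZRiesz.bet n := by
  have h0 : ∀ t ∈ Ioi (0 : ℝ), Real.exp (-t) * (t ^ n / (n.factorial : ℝ)) * t ^ (-(1 : ℝ) / 2)
      = (n.factorial : ℝ)⁻¹ * (Real.exp (-t) * t ^ (((n : ℝ) + 1 / 2) - 1)) := by
    intro t ht
    have : ((n : ℝ) + 1 / 2) - 1 = n + (-(1 : ℝ) / 2) := by ring
    rw [this, Real.rpow_add ht, Real.rpow_natCast]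
    ring
  have hpos : (0 : ℝ) < (n : ℝ) + 1 / 2 := by positivity
  constructor
  · exact IntegrableOn.congr_fun ((Real.GammaIntegral_convergent hpos).const_mul _)
      (fun t ht => (h0 t ht).symm) measurableSet_Ioi
  · rw [setIntegral_congr_fun measurableSet_Ioi h0, integral_const_mul,
      ← Real.Gamma_eq_integral hpos, ZRiesz.gamma_half]
    field_simp

theorem Kker_mul_wR (hq : 2 ≤ q) (x y : S.V) : S.Kker x y * S.wR y = S.Kc x y := by
  have hw : S.wR y ≠ 0 := (S.wR_pos (by omega) y).ne'
  have ha : ∀ n, 0 ≤ (S.avg ^ n) (S.delta y) x := fun n => S.avg_pow_nonneg (S.delta_nonneg y) n x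
  set F : ℕ → ℝ → ℝ := fun n t => Real.exp (-t) * (t ^ n / (n.factorial : ℝ)) * t ^ (-(1 : ℝ) / 2)
    * (S.avg ^ n) (S.delta y) x with hF
  have hFint : ∀ n, ∫ t in Ioi (0 : ℝ), F n t
      = Real.sqrt Real.pi * (ZRiesz.bet n * (S.avg ^ n) (S.delta y) x) := fun n => by
    rw [hF, integral_mul_const, (heat_moment n).2, mul_assoc]
  have hs := (S.hasSum_bet hq x y).mul_left (Real.sqrt Real.pi)
  have hnorm : ∀ n, ∫ t in Ioi (0 : ℝ), ‖F n t‖ = ∫ t in Ioi (0 : ℝ), F n t := fun n => by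
    refine setIntegral_congr_fun measurableSet_Ioi fun t ht => ?_
    rw [Real.norm_eq_abs, abs_of_nonneg]
    have ht' : (0 : ℝ) < t := ht
    exact mul_nonneg (by positivity) (ha n)
  have key := hasSum_integral_of_summable_integral_norm (μ := volume.restrict (Ioi (0 : ℝ)))
    (F := F) (fun n => (heat_moment n).1.mul_const _) (by
      simp_rw [hnorm, hFint]
      exact hs.summable)
  simp_rw [hFint] at key
  have h1 := key.unique hs
  have h2 : ∀ t : ℝ, S.Hker t x y * t ^ (-(1 : ℝ) / 2) = (S.wR y)⁻¹ * ∑' n, F n t := by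
    intro t
    rw [S.Hker_eq (by omega), mul_assoc, mul_assoc, mul_comm (tsum _), ← mul_assoc (Real.exp _),
      ← tsum_mul_left, hF]
    congr 2
    ext n
    ring
  unfold Kker
  simp_rw [h2]
  rw [integral_const_mul, h1]
  have : Real.sqrt Real.pi ≠ 0 := by positivity
  field_simp

/-- The coefficients of the Riesz kernel in terms of confluence pairs. -/
noncomputable def cof : ℕ → ℕ → ℝ
  | 0, n => ZRiesz.kap n
  | m + 1, n => ZRiesz.kap (m + 1 + n) - ZRiesz.kap (m + n)

/-- The kernel of the Riesz transform with respect to the counting measure. -/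
noncomputable def rk (x y : S.V) : ℝ := (S.Kker x y - S.Kker (S.pred x) y) * S.wR y

theorem rk_hasSum (hq : 2 ≤ q) (x y : S.V) :
    HasSum (fun ab : ℕ × ℕ => cof ab.1 ab.2 * (S.E ab.1 ab.2 x y * ((q : ℝ) ^ ab.2)⁻¹))
      (S.rk x y) := by
  have hk : ∀ ab : ℕ × ℕ, |ZRiesz.kap (ab.1 + ab.2)| ≤ 2 := fun ab => by
    rw [abs_of_pos (ZRiesz.kap_pos _)]; exact ZRiesz.kap_le_two _
  have h1 := (S.summable_mul_E hq x y hk).hasSum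
  have h2 := (S.summable_mul_E hq (S.pred x) y hk).hasSum
  set G : ℕ × ℕ → ℝ := fun ab => if ab.1 = 0 then 0 else
    ZRiesz.kap (ab.1 - 1 + ab.2) * (S.E ab.1 ab.2 x y * ((q : ℝ) ^ ab.2)⁻¹) with hG
  have hinj : Injective fun ab : ℕ × ℕ => (ab.1 + 1, ab.2) := by
    rintro ⟨a, b⟩ ⟨a', b'⟩ h
    simpa using h
  have h3 : HasSum G (S.Kc (S.pred x) y) := by
    rw [← hinj.hasSum_iff]
    · exact h2
    · rintro ⟨a, b⟩ hab
      cases a with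
      | zero => simp [hG]
      | succ a => exact absurd ⟨(a, b), rfl⟩ hab
  have h4 := h1.sub h3
  rw [rk, sub_mul, S.Kker_mul_wR hq, S.Kker_mul_wR hq]
  refine h4.congr_fun ?_
  rintro ⟨a, b⟩
  cases a with
  | zero => simp [hG, cof]
  | succ a => simp [hG, cof, sub_mul]

end FlowTree

namespace ZRiesz

theorem bet_antitone : Antitone bet := by
  refine antitone_nat_of_succ_le fun n => ?_
  have h := bet_succ n
  have h1 := bet_nonneg n
  have h2 : (0 : ℝ) < (n : ℝ) + 1 := by positivity
  refine le_of_mul_le_mul_left ?_ h2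
  rw [h]
  gcongr
  norm_num

theorem sum_bet_antidiagonal (n : ℕ) :
    ∑ ij ∈ Finset.HasAntidiagonal.antidiagonal n, bet ij.1 * bet ij.2 = 1 := by
  set F : PowerSeries ℝ := PowerSeries.mk bet with hF
  have hode : 2 * ((1 - PowerSeries.X) * PowerSeries.derivative ℝ F) = F := by
    ext n
    rw [show (2 : PowerSeries ℝ) = PowerSeries.C (2 : ℝ) from (map_ofNat PowerSeries.C 2).symm, PowerSeries.coeff_C_mul, sub_mul,
      one_mul, map_sub,  PowerSeries.coeff_derivative]
    cases n with
    | zero =>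
      have := bet_succ 0
      simp only [PowerSeries.coeff_zero_X_mul, hF, PowerSeries.coeff_mk]
      push_cast at this ⊢
      linear_combination 2 * this
    | succ n =>
      have := bet_succ (n + 1)
      rw [PowerSeries.coeff_succ_X_mul, PowerSeries.coeff_derivative]
      simp only [hF, PowerSeries.coeff_mk]
      push_cast at this ⊢
      linear_combination 2 * this
  have hG : (1 - PowerSeries.X) * PowerSeries.derivative ℝ (F * F) = F * F := by
    rw [Derivation.leibniz, smul_eq_mul]
    linear_combination F * hode
  have hrec : ∀ n, PowerSeries.coeff n (F * F) = 1 := by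
    intro n
    induction n with
    | zero => simp [hF, bet_zero, PowerSeries.coeff_zero_eq_constantCoeff]
    | succ n ih =>
      have := congrArg (PowerSeries.coeff n) hG
      rw [sub_mul, one_mul, map_sub, 
        PowerSeries.coeff_derivative] at this
      have h0 : (0 : ℝ) < (n : ℝ) + 1 := by positivity
      cases n with
      | zero =>
        rw [PowerSeries.coeff_zero_X_mul, ih] at this
        push_cast at this
        linarith
      | succ n =>
        rw [PowerSeries.coeff_succ_X_mul, PowerSeries.coeff_derivative, ih] at this
        push_cast at this h0
        have h1 : ((n : ℝ) + 1 + 1) * (PowerSeries.coeff (n + 1 + 1) (F * F) - 1) = 0 := by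
          linarith
        rcases mul_eq_zero.1 h1 with h | h
        · linarith
        · linarith
  have := hrec n
  rw [PowerSeries.coeff_mul] at this
  simpa [hF] using this

/-- Truncation of `bet`. -/
noncomputable def betTrunc (N n : ℕ) : ℝ := if n ≤ N then bet n else 0

theorem betTrunc_nonneg (N n : ℕ) : 0 ≤ betTrunc N n := by
  unfold betTrunc
  split_ifs
  · exact bet_nonneg n
  · rfl

theorem betTrunc_antitone (N : ℕ) : Antitone (betTrunc N) := by
  refine antitone_nat_of_succ_le fun n => ?_
  unfold betTrunc
  split_ifs with h1 h2
  · exact bet_antitone n.le_succ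
  · omega
  · exact bet_nonneg n
  · rfl

/-- Taylor polynomial of `(1 - X)^{-1/2}`. -/
noncomputable def betPoly (N : ℕ) : Polynomial ℝ :=
  ∑ n ∈ Finset.range (N + 1), Polynomial.C (bet n) * Polynomial.X ^ n

theorem coeff_betPoly (N n : ℕ) : (betPoly N).coeff n = betTrunc N n := by
  simp [betPoly, betTrunc, Polynomial.coeff_X_pow]

theorem coeff_betPoly_sq (N n : ℕ) : (betPoly N * betPoly N).coeff n =
    ∑ ij ∈ Finset.HasAntidiagonal.antidiagonal n, betTrunc N ij.1 * betTrunc N ij.2 := by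
  rw [Polynomial.coeff_mul]
  simp_rw [coeff_betPoly]

theorem coeff_betPoly_sq_eq_one {N n : ℕ} (h : n ≤ N) : (betPoly N * betPoly N).coeff n = 1 := by
  rw [coeff_betPoly_sq, ← sum_bet_antidiagonal n]
  apply Finset.sum_congr rfl
  rintro ⟨i, j⟩ hij
  rw [Finset.HasAntidiagonal.mem_antidiagonal] at hij
  simp only at hij
  simp only [betTrunc]
  rw [if_pos (by omega), if_pos (by omega)]

theorem coeff_betPoly_sq_nonneg (N n : ℕ) : 0 ≤ (betPoly N * betPoly N).coeff n := by
  rw [coeff_betPoly_sq]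
  exact Finset.sum_nonneg fun ij _ => mul_nonneg (betTrunc_nonneg _ _) (betTrunc_nonneg _ _)

theorem coeff_betPoly_sq_antitone (N : ℕ) : Antitone (betPoly N * betPoly N).coeff := by
  refine antitone_nat_of_succ_le fun n => ?_
  rcases lt_or_ge n N with h | h
  · rw [coeff_betPoly_sq_eq_one (by omega), coeff_betPoly_sq_eq_one (by omega)]
  · rw [coeff_betPoly_sq, coeff_betPoly_sq, Finset.Nat.sum_antidiagonal_succ]
    have : betTrunc N (n + 1) = 0 := if_neg (by omega)
    rw [this, mul_zero, zero_add]
    exact Finset.sum_le_sum fun ij _ => mul_le_mul_of_nonneg_right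
      (betTrunc_antitone N (Nat.le_succ _)) (betTrunc_nonneg _ _)

theorem sum_abs_coeff_le (N L : ℕ) : ∑ n ∈ Finset.range L,
    |((1 - Polynomial.X) * (betPoly N * betPoly N)).coeff n| ≤ 2 := by
  set e := betPoly N * betPoly N with he
  have h0 : e.coeff 0 = 1 := coeff_betPoly_sq_eq_one (Nat.zero_le _)
  have h1 : ∀ L, ∑ n ∈ Finset.range (L + 1), |((1 - Polynomial.X) * e).coeff n|
      = 2 - e.coeff L := by
    intro L
    induction L with
    | zero => simp [sub_mul, h0]; norm_num
    | succ L ih =>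
      rw [Finset.sum_range_succ, ih, sub_mul, one_mul, Polynomial.coeff_sub,
        Polynomial.coeff_X_mul, abs_of_nonpos (by
          have := coeff_betPoly_sq_antitone N L.le_succ
          rw [← he] at this
          exact sub_nonpos.2 this)]
      ring
  cases L with
  | zero => simp
  | succ L =>
    rw [h1]
    have := coeff_betPoly_sq_nonneg N L
    rw [← he] at this
    linarith

end ZRiesz

namespace FlowTree

variable {q : ℕ} (S : FlowTree q)

/-- The real `L²(μ)` inner product. -/
noncomputable def form (f g : S.V → ℝ) : ℝ := ∑' x, f x * g x * S.wR x

theorem form_eq_sum {f : S.V → ℝ} (g : S.V → ℝ) {A : Finset S.V} (hA : support f ⊆ A) :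
    S.form f g = ∑ x ∈ A, f x * g x * S.wR x :=
  tsum_eq_sum fun x hx => by
    have : f x = 0 := by
      by_contra h
      exact hx (hA h)
    simp [this]

theorem form_comm (f g : S.V → ℝ) : S.form f g = S.form g f := by
  unfold form
  congr 1
  ext x
  ring

theorem form_self_nonneg (hq : 0 < q) (f : S.V → ℝ) : 0 ≤ S.form f f :=
  tsum_nonneg fun x => mul_nonneg (mul_self_nonneg _) (S.wR_pos hq x).le

theorem tsum_desc {h : S.V → ℝ} (hh : (support h).Finite) :
    ∑' z, ∑ x ∈ S.desc z 1, h x = ∑' x, h x := by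
  set A := hh.toFinset with hA
  have h0 : ∀ x, x ∉ A → h x = 0 := fun x hx => by simpa [hA] using hx
  rw [tsum_eq_sum (s := A) h0, tsum_eq_sum (s := A.image S.pred),
    ← Finset.sum_fiberwise_of_maps_to (s := A) (t := A.image S.pred) (g := S.pred) (fun x hx => Finset.mem_image_of_mem S.pred hx)]
  · apply Finset.sum_congr rfl
    intro z _
    symm
    apply Finset.sum_subset_zero_on_sdiff
    · intro x hx
      simpa using (Finset.mem_filter.1 hx).2
    · intro x hx
      rw [Finset.mem_sdiff, mem_desc, Finset.mem_filter] at hx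
      exact h0 x fun hxA => hx.2 ⟨hxA, hx.1⟩
    · exact fun _ _ => rfl
  · intro z hz
    apply Finset.sum_eq_zero
    intro x hx
    apply h0
    intro hxA
    rw [mem_desc] at hx
    exact hz (hx ▸ Finset.mem_image_of_mem S.pred hxA)

theorem finite_support_pred {f : S.V → ℝ} (hf : (support f).Finite) :
    (support fun x => f (S.pred x)).Finite := by
  refine (hf.biUnion fun z _ => S.desc_finite z 1).subset fun x hx => ?_
  simp only [mem_iUnion, mem_ofPred_eq]
  exact ⟨S.pred x, hx, rfl⟩

theorem finite_support_star {f : S.V → ℝ} (hf : (support f).Finite) :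
    (support (S.star f)).Finite := by
  refine (hf.image S.pred).subset fun x hx => ?_
  by_contra hn
  apply hx
  rw [star_apply, Finset.sum_eq_zero, mul_zero]
  intro y hy
  rw [mem_desc] at hy
  by_contra hy'
  exact hn ⟨y, hy', hy⟩

theorem finite_support_avg {f : S.V → ℝ} (hf : (support f).Finite) :
    (support (S.avg f)).Finite := by
  refine ((S.finite_support_pred hf).union (S.finite_support_star hf)).subset fun x hx => ?_
  by_contra hn
  simp only [mem_union, mem_support, not_or, not_not] at hn
  apply hx
  rw [avg_apply, hn.1, hn.2]
  norm_num

theorem finite_support_avg_pow {f : S.V → ℝ} (hf : (support f).Finite) (n : ℕ) :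
    (support ((S.avg ^ n) f)).Finite := by
  induction n with
  | zero => simpa using hf
  | succ n ih => rw [pow_succ']; exact S.finite_support_avg ih

theorem wR_pred (hq : 0 < q) (x : S.V) : S.wR (S.pred x) = q * S.wR x := by
  simpa using S.wR_iterate hq 1 x

theorem form_pred (hq : 0 < q) {f : S.V → ℝ} (hf : (support f).Finite) (g : S.V → ℝ) :
    S.form (fun x => f (S.pred x)) g = S.form f (S.star g) := by
  have hq' : (q : ℝ) ≠ 0 := by exact_mod_cast hq.ne'
  unfold form
  rw [← S.tsum_desc (h := fun x => f (S.pred x) * g x * S.wR x)]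
  · congr 1
    ext z
    rw [star_apply, ← mul_assoc, Finset.mul_sum, Finset.sum_mul]
    apply Finset.sum_congr rfl
    intro x hx
    have hx' : S.pred x = z := by simpa using hx
    rw [← hx', S.wR_pred hq]
    field_simp
  · exact (S.finite_support_pred hf).subset fun x hx h => hx (by simp only [h, zero_mul])

theorem form_add_left {f f' : S.V → ℝ} (g : S.V → ℝ) (hf : (support f).Finite)
    (hf' : (support f').Finite) : S.form (f + f') g = S.form f g + S.form f' g := by
  unfold form
  rw [← Summable.tsum_add]
  · simp [add_mul]
  · exact summable_of_hasFiniteSupport (hf.subset fun x hx h => hx (by simp [h]))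
  · exact summable_of_hasFiniteSupport (hf'.subset fun x hx h => hx (by simp [h]))

theorem form_smul_left (c : ℝ) (f g : S.V → ℝ) : S.form (c • f) g = c * S.form f g := by
  unfold form
  rw [← tsum_mul_left]
  simp [mul_assoc]

theorem form_sum_left {ι : Type*} (s : Finset ι) {F : ι → S.V → ℝ} (g : S.V → ℝ)
    (hF : ∀ i ∈ s, (support (F i)).Finite) :
    S.form (∑ i ∈ s, F i) g = ∑ i ∈ s, S.form (F i) g := by
  unfold form
  rw [← Summable.tsum_finsetSum]
  · simp [Finset.sum_mul]
  · intro i hi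
    exact summable_of_hasFiniteSupport ((hF i hi).subset fun x hx h => hx (by simp [h]))

theorem avg_eq (f : S.V → ℝ) : S.avg f = (2⁻¹ : ℝ) • ((fun x => f (S.pred x)) + S.star f) := by
  ext x
  rw [avg_apply]
  simp
  ring

theorem form_avg (hq : 0 < q) {f g : S.V → ℝ} (hf : (support f).Finite) (hg : (support g).Finite) :
    S.form (S.avg f) g = S.form f (S.avg g) := by
  rw [S.form_comm f, avg_eq, avg_eq, form_smul_left, form_smul_left,
    S.form_add_left _ (S.finite_support_pred hf) (S.finite_support_star hf),
    S.form_add_left _ (S.finite_support_pred hg) (S.finite_support_star hg),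
    S.form_pred hq hf, S.form_pred hq hg, S.form_comm (S.star f), S.form_comm (S.star g)]
  ring

theorem form_avg_pow (hq : 0 < q) {f g : S.V → ℝ} (hf : (support f).Finite)
    (hg : (support g).Finite) (n : ℕ) :
    S.form ((S.avg ^ n) f) g = S.form f ((S.avg ^ n) g) := by
  induction n generalizing f with
  | zero => simp
  | succ n ih =>
    rw [pow_succ, Module.End.mul_apply, ih (S.finite_support_avg hf), S.form_avg hq hf
      (S.finite_support_avg_pow hg n), ← Module.End.mul_apply, ← pow_succ', ← pow_succ]

theorem aeval_avg (P : Polynomial ℝ) (f : S.V → ℝ) :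
    Polynomial.aeval S.avg P f
      = ∑ i ∈ Finset.range (P.natDegree + 1), P.coeff i • (S.avg ^ i) f := by
  rw [Polynomial.aeval_eq_sum_range, LinearMap.sum_apply]
  rfl

theorem finite_support_smul (c : ℝ) {f : S.V → ℝ} (hf : (support f).Finite) :
    (support (c • f)).Finite :=
  hf.subset fun x hx h => hx (by simp [h])

theorem finite_support_aeval (P : Polynomial ℝ) {f : S.V → ℝ} (hf : (support f).Finite) :
    (support (Polynomial.aeval S.avg P f)).Finite := by
  rw [aeval_avg]
  refine Set.Finite.subset (Set.Finite.biUnion (Finset.finite_toSet (Finset.range (P.natDegree + 1)))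
    fun i _ => S.finite_support_smul (P.coeff i) (S.finite_support_avg_pow hf i)) fun x hx => ?_
  by_contra hn
  apply hx
  rw [Finset.sum_apply]
  apply Finset.sum_eq_zero
  intro i hi
  by_contra h
  exact hn (mem_biUnion hi h)

theorem form_aeval_eq (P : Polynomial ℝ) {f : S.V → ℝ} (g : S.V → ℝ) (hf : (support f).Finite) :
    S.form (Polynomial.aeval S.avg P f) g
      = ∑ i ∈ Finset.range (P.natDegree + 1), P.coeff i * S.form ((S.avg ^ i) f) g := by
  rw [aeval_avg, S.form_sum_left _ _ fun i _ => S.finite_support_smul _ (S.finite_support_avg_pow hf i)]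
  simp_rw [form_smul_left]

theorem form_aeval (hq : 0 < q) (P : Polynomial ℝ) {f g : S.V → ℝ} (hf : (support f).Finite)
    (hg : (support g).Finite) :
    S.form (Polynomial.aeval S.avg P f) g = S.form f (Polynomial.aeval S.avg P g) := by
  rw [S.form_comm f, S.form_aeval_eq P g hf, S.form_aeval_eq P f hg]
  apply Finset.sum_congr rfl
  intro i _
  rw [S.form_avg_pow hq hf hg, S.form_comm f]

theorem form_pred_pred (hq : 0 < q) {f : S.V → ℝ} (hf : (support f).Finite) :
    S.form (fun x => f (S.pred x)) (fun x => f (S.pred x)) = S.form f f := by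
  have hq' : (q : ℝ) ≠ 0 := by exact_mod_cast hq.ne'
  rw [S.form_pred hq hf]
  congr 1
  ext z
  rw [star_apply]
  have : ∀ x ∈ S.desc z 1, f (S.pred x) = f z := fun x hx => by
    rw [show S.pred x = z by simpa using hx]
  rw [Finset.sum_congr rfl this, Finset.sum_const, card_desc, nsmul_eq_mul, pow_one]
  field_simp

theorem form_abs_le (hq : 0 < q) {f g : S.V → ℝ} (hf : (support f).Finite)
    (hg : (support g).Finite) : |S.form f g| ≤ (S.form f f + S.form g g) / 2 := by
  have h1 := S.form_self_nonneg hq (f + g)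
  have h2 := S.form_self_nonneg hq (f + (-1 : ℝ) • g)
  have hg' := S.finite_support_smul (-1) hg
  have hfg : (support (f + g)).Finite := (hf.union hg).subset (support_add f g)
  have hfg' : (support (f + (-1 : ℝ) • g)).Finite := (hf.union hg').subset (support_add _ _)
  rw [S.form_add_left _ hf hg, S.form_comm f, S.form_comm g, S.form_add_left _ hf hg,
    S.form_add_left _ hf hg, S.form_comm g f] at h1
  rw [S.form_add_left _ hf hg', S.form_comm f, S.form_smul_left, S.form_comm g,
    S.form_add_left _ hf hg', S.form_add_left _ hf hg', S.form_smul_left, S.form_smul_left,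
    S.form_comm g f] at h2
  rw [abs_le]
  constructor <;> linarith

theorem form_sub_pred (hq : 0 < q) {u : S.V → ℝ} (hu : (support u).Finite) :
    S.form (fun x => u x - u (S.pred x)) (fun x => u x - u (S.pred x))
      = 2 * S.form ((1 - S.avg) u) u := by
  have hp := S.finite_support_smul (-1) (S.finite_support_pred hu)
  have h1 : (fun x => u x - u (S.pred x)) = u + (-1 : ℝ) • fun x => u (S.pred x) := by
    ext x; simp; ring
  have h2 : (1 - S.avg) u = u + (-1 : ℝ) • S.avg u := by
    ext x; simp; ring
  rw [h2, S.form_add_left _ hu (S.finite_support_smul _ (S.finite_support_avg hu)),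
    S.form_smul_left, avg_eq, S.form_smul_left, S.form_add_left _ (S.finite_support_pred hu)
      (S.finite_support_star hu), S.form_comm (S.star u), ← S.form_pred hq hu, h1,
    S.form_add_left _ hu hp, S.form_comm u, S.form_smul_left,
    S.form_comm (fun x => u (S.pred x)), S.form_add_left _ hu hp, S.form_add_left _ hu hp,
    S.form_smul_left, S.form_smul_left, S.form_pred_pred hq hu,
    S.form_comm u (fun x => u (S.pred x))]
  ring

theorem form_star_le (hq : 0 < q) {f : S.V → ℝ} (hf : (support f).Finite) :
    S.form (S.star f) (S.star f) ≤ S.form f f := by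
  have hs := S.finite_support_star hf
  have h := S.form_pred hq hs f
  have h2 := (abs_le.1 (S.form_abs_le hq (S.finite_support_pred hs) hf)).2
  rw [h, S.form_pred_pred hq hs] at h2
  linarith

theorem form_avg_le (hq : 0 < q) {f : S.V → ℝ} (hf : (support f).Finite) :
    S.form (S.avg f) (S.avg f) ≤ S.form f f := by
  have hs := S.finite_support_star hf
  have hp := S.finite_support_pred hf
  have ha := S.finite_support_avg hf
  have h1 := (abs_le.1 (S.form_abs_le hq hp ha)).2
  have h2 := (abs_le.1 (S.form_abs_le hq hs ha)).2
  have h3 : S.form (S.avg f) (S.avg f)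
      = 2⁻¹ * (S.form (fun x => f (S.pred x)) (S.avg f) + S.form (S.star f) (S.avg f)) := by
    rw [← S.form_add_left _ hp hs, ← form_smul_left, ← avg_eq]
  rw [S.form_pred_pred hq hf] at h1
  have := S.form_star_le hq hf
  linarith

theorem form_avg_pow_le (hq : 0 < q) {f : S.V → ℝ} (hf : (support f).Finite) (n : ℕ) :
    S.form ((S.avg ^ n) f) ((S.avg ^ n) f) ≤ S.form f f := by
  induction n with
  | zero => simp
  | succ n ih =>
    rw [pow_succ']
    exact (S.form_avg_le hq (S.finite_support_avg_pow hf n)).trans ih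

theorem form_avg_pow_abs_le (hq : 0 < q) {f : S.V → ℝ} (hf : (support f).Finite) (n : ℕ) :
    |S.form ((S.avg ^ n) f) f| ≤ S.form f f := by
  have h1 := S.form_abs_le hq (S.finite_support_avg_pow hf n) hf
  have h2 := S.form_avg_pow_le hq hf n
  linarith

theorem form_grad_betPoly_le (hq : 0 < q) {f : S.V → ℝ} (hf : (support f).Finite) (N : ℕ) :
    S.form (fun x => Polynomial.aeval S.avg (ZRiesz.betPoly N) f x
        - Polynomial.aeval S.avg (ZRiesz.betPoly N) f (S.pred x))
      (fun x => Polynomial.aeval S.avg (ZRiesz.betPoly N) f x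
        - Polynomial.aeval S.avg (ZRiesz.betPoly N) f (S.pred x)) ≤ 4 * S.form f f := by
  set P := ZRiesz.betPoly N
  have hu := S.finite_support_aeval P hf
  have hQ : (1 - S.avg) (Polynomial.aeval S.avg P f)
      = Polynomial.aeval S.avg ((1 - Polynomial.X) * P) f := by
    simp [map_mul]
  rw [S.form_sub_pred hq hu, hQ, ← S.form_aeval hq P (S.finite_support_aeval _ hf) hf,
    ← Module.End.mul_apply, ← map_mul, show P * ((1 - Polynomial.X) * P)
      = (1 - Polynomial.X) * (P * P) by ring, S.form_aeval_eq _ _ hf]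
  have hf0 := S.form_self_nonneg hq f
  have : ∑ i ∈ Finset.range (((1 - Polynomial.X) * (P * P)).natDegree + 1),
      ((1 - Polynomial.X) * (P * P)).coeff i * S.form ((S.avg ^ i) f) f ≤ 2 * S.form f f := by
    refine le_trans ?_ (mul_le_mul_of_nonneg_right (ZRiesz.sum_abs_coeff_le N
      (((1 - Polynomial.X) * (P * P)).natDegree + 1)) hf0)
    rw [Finset.sum_mul]
    refine Finset.sum_le_sum fun i _ => (le_abs_self _).trans ?_
    rw [abs_mul]
    exact mul_le_mul_of_nonneg_left (S.form_avg_pow_abs_le hq hf i) (abs_nonneg _)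
  linarith

theorem avg_pow_sum_delta (n : ℕ) (B : Finset S.V) (f : S.V → ℝ) (x : S.V) :
    (S.avg ^ n) (∑ y ∈ B, f y • S.delta y) x = ∑ y ∈ B, f y * (S.avg ^ n) (S.delta y) x := by
  simp [map_sum]

theorem sum_delta_apply (B : Finset S.V) (f : S.V → ℝ) (x : S.V) :
    (∑ y ∈ B, f y • S.delta y) x = if x ∈ B then f x else 0 := by
  simp [delta]

theorem Kc_tendsto (hq : 2 ≤ q) (B : Finset S.V) (f : S.V → ℝ) (x : S.V) :
    Filter.Tendsto (fun N => Polynomial.aeval S.avg (ZRiesz.betPoly N)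
      (∑ y ∈ B, f y • S.delta y) x) Filter.atTop (nhds (∑ y ∈ B, S.Kc x y * f y)) := by
  have h : ∀ N, Polynomial.aeval S.avg (ZRiesz.betPoly N) (∑ y ∈ B, f y • S.delta y) x =
      ∑ y ∈ B, (∑ n ∈ Finset.range (N + 1), ZRiesz.bet n * (S.avg ^ n) (S.delta y) x) * f y := by
    intro N
    simp_rw [Finset.sum_mul]
    rw [Finset.sum_comm, ZRiesz.betPoly, map_sum (Polynomial.aeval S.avg),
      LinearMap.sum_apply, Finset.sum_apply]
    apply Finset.sum_congr rfl
    intro n _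
    rw [map_mul, map_pow, Polynomial.aeval_X, Polynomial.aeval_C, Module.End.mul_apply,
      Module.algebraMap_end_apply, Pi.smul_apply, avg_pow_sum_delta, smul_eq_mul, Finset.mul_sum]
    exact Finset.sum_congr rfl fun y _ => by ring
  simp_rw [h]
  refine tendsto_finsetSum _ fun y _ => Filter.Tendsto.mul_const _ ?_
  exact (S.hasSum_bet hq x y).tendsto_sum_nat.comp (Filter.tendsto_add_atTop_nat 1)

theorem rk_eq (hq : 2 ≤ q) (x y : S.V) : S.rk x y = S.Kc x y - S.Kc (S.pred x) y := by
  rw [rk, sub_mul, S.Kker_mul_wR hq, S.Kker_mul_wR hq]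

theorem rk_l2 (hq : 2 ≤ q) (F B : Finset S.V) (f : S.V → ℝ) :
    ∑ x ∈ F, (∑ y ∈ B, S.rk x y * f y) ^ 2 * S.wR x ≤ 4 * ∑ y ∈ B, f y ^ 2 * S.wR y := by
  have hq0 : 0 < q := by omega
  set φ := ∑ y ∈ B, f y • S.delta y with hφ
  have hsupp : support φ ⊆ B := fun x hx => by
    by_contra hn
    exact hx (by rw [hφ, sum_delta_apply, if_neg (by simpa using hn)])
  have hfin : (support φ).Finite := B.finite_toSet.subset hsupp
  have hnorm : S.form φ φ = ∑ y ∈ B, f y ^ 2 * S.wR y := by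
    rw [S.form_eq_sum φ hsupp]
    refine Finset.sum_congr rfl fun y hy => ?_
    rw [hφ, sum_delta_apply, if_pos hy, sq]
  rw [← hnorm]
  refine le_of_tendsto (f := fun N => ∑ x ∈ F, (Polynomial.aeval S.avg (ZRiesz.betPoly N) φ x
      - Polynomial.aeval S.avg (ZRiesz.betPoly N) φ (S.pred x)) ^ 2 * S.wR x)
    (x := Filter.atTop) ?_ (Filter.Eventually.of_forall fun N => ?_)
  · refine tendsto_finsetSum _ fun x _ => Filter.Tendsto.mul_const _ (Filter.Tendsto.pow ?_ 2)
    have := (S.Kc_tendsto hq B f x).sub (S.Kc_tendsto hq B f (S.pred x))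
    rw [← Finset.sum_sub_distrib] at this
    convert this using 2
    refine Finset.sum_congr rfl fun y _ => ?_
    rw [S.rk_eq hq, sub_mul]
  · refine le_trans ?_ (S.form_grad_betPoly_le hq0 hfin N)
    unfold form
    simp_rw [← sq]
    refine Summable.sum_le_tsum F (fun x _ => mul_nonneg (sq_nonneg _) (S.wR_pos hq0 x).le)
      (summable_of_hasFiniteSupport ?_)
    have hu := S.finite_support_aeval (ZRiesz.betPoly N) hfin
    refine (hu.union (S.finite_support_pred hu)).subset fun x hx => ?_
    by_contra hn
    simp only [mem_union, mem_support, not_or, not_not] at hn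
    exact hx (by simp [hn.1, hn.2])

end FlowTree

/-- A system of nested finite partitions (dyadic cubes) on a weighted discrete set. -/
structure CubeSystem (V : Type*) where
  w : V → ℝ
  w_pos : ∀ x, 0 < w x
  Q : ℤ → V → Finset V
  D : ℝ
  mem_self : ∀ t x, x ∈ Q t x
  eq_of_mem : ∀ t x y, y ∈ Q t x → Q t y = Q t x
  mono : ∀ t x, Q t x ⊆ Q (t + 1) x
  doubling : ∀ t x, ∑ y ∈ Q (t + 1) x, w y ≤ D * ∑ y ∈ Q t x, w y
  bot : ∀ x, ∃ t, Q t x = {x}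
  top : ∀ x (R : ℝ), ∃ t₀, ∀ t, t₀ ≤ t → R ≤ ∑ y ∈ Q t x, w y

namespace CubeSystem

variable {V : Type*} (S : CubeSystem V)

theorem mass_pos (t : ℤ) (x : V) : 0 < ∑ y ∈ S.Q t x, S.w y :=
  Finset.sum_pos (fun y _ => S.w_pos y) ⟨x, S.mem_self t x⟩

theorem D_nonneg (x : V) : 0 ≤ S.D := by
  have h := S.doubling 0 x
  have h1 := S.mass_pos 0 x
  have h2 := S.mass_pos (0 + 1) x
  by_contra hD
  push Not at hD
  nlinarith

theorem Q_eq_of_mem_of_le {t t' : ℤ} (h : t ≤ t') {x y : V} (hy : y ∈ S.Q t x) :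
    S.Q t' y = S.Q t' x := by
  have key : ∀ n : ℕ, y ∈ S.Q (t + n) x := by
    intro n
    induction n with
    | zero => simpa using hy
    | succ n ih => simpa [add_assoc] using S.mono _ _ ih
  obtain ⟨n, rfl⟩ := Int.le.dest h
  exact S.eq_of_mem _ _ _ (key n)

/-- The set of scales at which the average of `|f|` around `x` exceeds `l`. -/
def Large (f : V → ℝ) (l : ℝ) (x : V) (t : ℤ) : Prop :=
  l * ∑ y ∈ S.Q t x, S.w y < ∑ y ∈ S.Q t x, |f y| * S.w y

theorem large_congr {f : V → ℝ} {l : ℝ} {t t' : ℤ} (h : t ≤ t') {x y : V} (hy : y ∈ S.Q t x) :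
    S.Large f l y t' ↔ S.Large f l x t' := by
  unfold Large; rw [S.Q_eq_of_mem_of_le h hy]

theorem exists_maximal_scale {f : V → ℝ} {l : ℝ} (hl : 0 < l) {A : Finset V} (hf : ∀ x, x ∉ A → f x = 0)
    {x : V} (hx : ∃ t, S.Large f l x t) :
    ∃ t, S.Large f l x t ∧ ∀ t', S.Large f l x t' → t' ≤ t := by
  obtain ⟨t₀, ht₀⟩ := S.top x ((∑ y ∈ A, |f y| * S.w y) / l)
  have hb : ∀ t, S.Large f l x t → t ≤ t₀ := by
    intro t ht
    by_contra h
    push Not at h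
    have h1 := ht₀ t h.le
    rw [div_le_iff₀ hl] at h1
    have h2 : ∑ y ∈ S.Q t x, |f y| * S.w y ≤ ∑ y ∈ A, |f y| * S.w y := by
      rw [← Finset.sum_filter_add_sum_filter_not (S.Q t x) (· ∈ A)]
      have : ∑ y ∈ (S.Q t x).filter (· ∉ A), |f y| * S.w y = 0 := by
        apply Finset.sum_eq_zero
        intro y hy
        simp [hf y (Finset.mem_filter.1 hy).2]
      rw [this, add_zero]
      apply Finset.sum_le_sum_of_subset_of_nonneg
      · intro y hy; exact (Finset.mem_filter.1 hy).2
      · intro y _ _; exact mul_nonneg (abs_nonneg _) (S.w_pos y).le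
    unfold Large at ht
    linarith
  exact Int.exists_greatest_of_bdd ⟨t₀, hb⟩ hx

/-- Calderón–Zygmund stopping cubes: a pairwise disjoint finite family. -/
theorem exists_maximal_cubes {f : V → ℝ} {l : ℝ} (hl : 0 < l) {A : Finset V}
    (hf : ∀ x, x ∉ A → f x = 0) :
    ∃ I : Finset (Finset V), (I : Set (Finset V)).PairwiseDisjoint id ∧
      (∀ C ∈ I, ∃ t x, C = S.Q t x ∧ l * ∑ y ∈ C, S.w y < ∑ y ∈ C, |f y| * S.w y ∧
        ∑ y ∈ C, |f y| * S.w y ≤ S.D * l * ∑ y ∈ C, S.w y) ∧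
      ∀ x, x ∉ I.biUnion id → |f x| ≤ l := by
  have hmax := fun x (hx : ∃ t, S.Large f l x t) => S.exists_maximal_scale hl hf hx
  choose! τ hτ1 hτ2 using hmax
  let A' := A.filter (fun x => ∃ t, S.Large f l x t)
  have hR : ∀ x, (∃ t, S.Large f l x t) → ∀ y ∈ S.Q (τ x) x,
      S.Q (τ y) y = S.Q (τ x) x := by
    intro x hx y hy
    have hy' : S.Large f l y (τ x) := (S.large_congr le_rfl hy).2 (hτ1 x hx)
    have h1 : τ x ≤ τ y := hτ2 y ⟨_, hy'⟩ _ hy'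
    have h2 : τ y ≤ τ x := hτ2 x hx _ ((S.large_congr h1 hy).1 (hτ1 y ⟨_, hy'⟩))
    rw [le_antisymm h2 h1]
    exact S.eq_of_mem _ _ _ hy
  refine ⟨A'.image (fun x => S.Q (τ x) x), ?_, ?_, ?_⟩
  · intro C hC C' hC' hne
    simp only [Finset.coe_image, Set.mem_image, Finset.mem_coe] at hC hC'
    obtain ⟨a, ha, rfl⟩ := hC
    obtain ⟨b, hb, rfl⟩ := hC'
    simp only [onFun, id]
    rw [Finset.disjoint_left]
    intro z hz hz'
    apply hne
    rw [← hR a (Finset.mem_filter.1 ha).2 z hz, ← hR b (Finset.mem_filter.1 hb).2 z hz']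
  · intro C hC
    obtain ⟨a, ha, rfl⟩ := Finset.mem_image.1 hC
    have ha' := (Finset.mem_filter.1 ha).2
    refine ⟨τ a, a, rfl, hτ1 a ha', ?_⟩
    have h1 : ¬ S.Large f l a (τ a + 1) := by
      intro h
      have := hτ2 a ha' _ h
      omega
    unfold Large at h1
    push Not at h1
    calc ∑ y ∈ S.Q (τ a) a, |f y| * S.w y
        ≤ ∑ y ∈ S.Q (τ a + 1) a, |f y| * S.w y :=
          Finset.sum_le_sum_of_subset_of_nonneg (S.mono _ _)
            (fun y _ _ => mul_nonneg (abs_nonneg _) (S.w_pos y).le)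
      _ ≤ l * ∑ y ∈ S.Q (τ a + 1) a, S.w y := h1
      _ ≤ l * (S.D * ∑ y ∈ S.Q (τ a) a, S.w y) := by gcongr; exact S.doubling _ _
      _ = _ := by ring
  · intro x hx
    by_contra h
    push Not at h
    obtain ⟨t, ht⟩ := S.bot x
    have hxl : ∃ t, S.Large f l x t := by
      refine ⟨t, ?_⟩
      unfold Large
      rw [ht]
      simpa using mul_lt_mul_of_pos_right h (S.w_pos x)
    apply hx
    simp only [Finset.mem_biUnion, id]
    refine ⟨S.Q (τ x) x, Finset.mem_image.2 ⟨x, Finset.mem_filter.2 ⟨?_, hxl⟩, rfl⟩, S.mem_self _ _⟩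
    by_contra hxA
    rw [hf x hxA, abs_zero] at h
    exact absurd h (not_lt.2 hl.le)

end CubeSystem

namespace CubeSystem

variable {V : Type*} (S : CubeSystem V)

theorem sum_union_le {u : V → ℝ} (hu : ∀ x, 0 ≤ u x) (s t : Finset V) :
    ∑ x ∈ s ∪ t, u x ≤ ∑ x ∈ s, u x + ∑ x ∈ t, u x := by
  rw [← Finset.sum_union_inter]
  linarith [Finset.sum_nonneg fun x (_ : x ∈ s ∩ t) => hu x]

theorem sum_biUnion_le {ι : Type*} {u : V → ℝ} (hu : ∀ x, 0 ≤ u x) (I : Finset ι)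
    (t : ι → Finset V) : ∑ x ∈ I.biUnion t, u x ≤ ∑ i ∈ I, ∑ x ∈ t i, u x := by
  induction I using Finset.induction_on with
  | empty => simp
  | insert i I hi ih =>
    rw [Finset.biUnion_insert, Finset.sum_insert hi]
    exact (sum_union_le hu _ _).trans (by gcongr)

/-- The Hörmander integral condition, relative to a cube system. -/
def Hormander (k : V → V → ℝ) (Cb Cc : ℝ) : Prop :=
  ∀ t z, ∃ Q' : Finset V, ∑ x ∈ Q', S.w x ≤ Cb * ∑ x ∈ S.Q t z, S.w x ∧
    ∀ y ∈ S.Q t z, ∀ y' ∈ S.Q t z, ∀ F : Finset V, Disjoint F Q' →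
      ∑ x ∈ F, |k x y / S.w y - k x y' / S.w y'| * S.w x ≤ Cc

theorem chebyshev_one (F : Finset V) (u : V → ℝ) {l : ℝ} (hl : 0 < l) :
    ∑ x ∈ F with l < |u x|, S.w x ≤ l⁻¹ * ∑ x ∈ F, |u x| * S.w x := by
  rw [inv_mul_eq_div, le_div_iff₀ hl, Finset.sum_mul]
  calc ∑ x ∈ F with l < |u x|, S.w x * l ≤ ∑ x ∈ F with l < |u x|, |u x| * S.w x := by
        apply Finset.sum_le_sum
        intro x hx
        have := (Finset.mem_filter.1 hx).2
        rw [mul_comm]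
        exact mul_le_mul_of_nonneg_right this.le (S.w_pos x).le
    _ ≤ _ := Finset.sum_le_sum_of_subset_of_nonneg (Finset.filter_subset _ _)
            (fun y _ _ => mul_nonneg (abs_nonneg _) (S.w_pos y).le)

theorem chebyshev_two (F : Finset V) (u : V → ℝ) {l : ℝ} (hl : 0 < l) :
    ∑ x ∈ F with l < |u x|, S.w x ≤ (l ^ 2)⁻¹ * ∑ x ∈ F, u x ^ 2 * S.w x := by
  rw [inv_mul_eq_div, le_div_iff₀ (by positivity), Finset.sum_mul]
  calc ∑ x ∈ F with l < |u x|, S.w x * l ^ 2 ≤ ∑ x ∈ F with l < |u x|, u x ^ 2 * S.w x := by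
        apply Finset.sum_le_sum
        intro x hx
        have := (Finset.mem_filter.1 hx).2
        rw [mul_comm, ← sq_abs (u x)]
        exact mul_le_mul_of_nonneg_right (by gcongr) (S.w_pos x).le
    _ ≤ _ := Finset.sum_le_sum_of_subset_of_nonneg (Finset.filter_subset _ _)
            (fun y _ _ => mul_nonneg (sq_nonneg _) (S.w_pos y).le)

theorem bad_part_bound {k : V → V → ℝ} {Cc : ℝ} {C F : Finset V} {f : V → ℝ} {z : V}
    (hH : ∀ y ∈ C, ∑ x ∈ F, |k x y / S.w y - k x z / S.w z| * S.w x ≤ Cc)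
    (hmean : ∑ y ∈ C, f y * S.w y = 0) :
    ∑ x ∈ F, |∑ y ∈ C, k x y * f y| * S.w x ≤ Cc * ∑ y ∈ C, |f y| * S.w y := by
  have h1 : ∀ x, ∑ y ∈ C, k x y * f y
      = ∑ y ∈ C, (k x y / S.w y - k x z / S.w z) * (f y * S.w y) := by
    intro x
    simp_rw [sub_mul, Finset.sum_sub_distrib, ← Finset.mul_sum, hmean, mul_zero, sub_zero]
    apply Finset.sum_congr rfl
    intro y _
    have := (S.w_pos y).ne'
    field_simp
  calc ∑ x ∈ F, |∑ y ∈ C, k x y * f y| * S.w x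
      ≤ ∑ x ∈ F, ∑ y ∈ C, |k x y / S.w y - k x z / S.w z| * S.w x * (|f y| * S.w y) := by
        apply Finset.sum_le_sum
        intro x _
        rw [h1]
        refine (mul_le_mul_of_nonneg_right (Finset.abs_sum_le_sum_abs _ _)
          (S.w_pos x).le).trans_eq ?_
        rw [Finset.sum_mul]
        apply Finset.sum_congr rfl
        intro y _
        rw [abs_mul, abs_mul, abs_of_pos (S.w_pos y)]
        ring
    _ = ∑ y ∈ C, (∑ x ∈ F, |k x y / S.w y - k x z / S.w z| * S.w x) * (|f y| * S.w y) := by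
        rw [Finset.sum_comm]
        simp_rw [Finset.sum_mul]
    _ ≤ ∑ y ∈ C, Cc * (|f y| * S.w y) := by
        apply Finset.sum_le_sum
        intro y hy
        exact mul_le_mul_of_nonneg_right (hH y hy) (mul_nonneg (abs_nonneg _) (S.w_pos y).le)
    _ = _ := by rw [Finset.mul_sum]

theorem maximal_cubes_mass {l : ℝ} (hl : 0 < l) {f : V → ℝ} {C : Finset V}
    (hC : l * ∑ y ∈ C, S.w y < ∑ y ∈ C, |f y| * S.w y) :
    ∑ y ∈ C, S.w y ≤ 2 * l⁻¹ * ∑ y ∈ C with l / 2 < |f y|, |f y| * S.w y := by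
  have h1 : ∑ y ∈ C with ¬ l / 2 < |f y|, |f y| * S.w y ≤ l / 2 * ∑ y ∈ C, S.w y := by
    calc _ ≤ ∑ y ∈ C with ¬ l / 2 < |f y|, l / 2 * S.w y := by
          apply Finset.sum_le_sum
          intro y hy
          exact mul_le_mul_of_nonneg_right (not_lt.1 (Finset.mem_filter.1 hy).2) (S.w_pos y).le
      _ ≤ ∑ y ∈ C, l / 2 * S.w y := Finset.sum_le_sum_of_subset_of_nonneg
            (Finset.filter_subset _ _) (fun y _ _ => mul_nonneg (by positivity) (S.w_pos y).le)
      _ = _ := by rw [Finset.mul_sum]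
  have h2 := Finset.sum_filter_add_sum_filter_not C (fun y => l / 2 < |f y|)
    (fun y => |f y| * S.w y)
  have : 2 * l⁻¹ * ∑ y ∈ C with l / 2 < |f y|, |f y| * S.w y
      = (∑ y ∈ C with l / 2 < |f y|, |f y| * S.w y) / (l / 2) := by field_simp
  rw [this, le_div_iff₀ (by positivity)]
  linarith

theorem level_estimate {k : V → V → ℝ} {Ca Cb Cc : ℝ} (ha : 0 ≤ Ca) (hb : 0 ≤ Cb) (hc : 0 ≤ Cc)
    (hL2 : ∀ (F B : Finset V) (f : V → ℝ), ∑ x ∈ F, (∑ y ∈ B, k x y * f y) ^ 2 * S.w x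
      ≤ Ca * ∑ y ∈ B, f y ^ 2 * S.w y)
    (hH : S.Hormander k Cb Cc) {f : V → ℝ} {A : Finset V} (hf : ∀ x, x ∉ A → f x = 0)
    {l : ℝ} (hl : 0 < l) (F : Finset V) :
    ∑ x ∈ F with l < |∑ y ∈ A, k x y * f y|, S.w x ≤
      4 * Ca * ((l ^ 2)⁻¹ * ∑ x ∈ A with |f x| ≤ l, f x ^ 2 * S.w x) +
      2 * (4 * Ca * S.D ^ 2 + Cb + 4 * Cc * S.D) *
        (l⁻¹ * ∑ x ∈ A with l / 2 < |f x|, |f x| * S.w x) := by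
  obtain ⟨I, hdisj, hI, hout⟩ := S.exists_maximal_cubes hl hf
  set O := I.biUnion id with hO
  have hIne : ∀ C ∈ I, 0 < ∑ y ∈ C, S.w y := by
    intro C hC
    obtain ⟨t, x, rfl, -, -⟩ := hI C hC
    exact S.mass_pos t x
  have hsumO : ∀ u : V → ℝ, ∑ x ∈ O, u x = ∑ C ∈ I, ∑ x ∈ C, u x := fun u =>
    Finset.sum_biUnion hdisj
  -- mass of the exceptional set
  have hmO : ∑ x ∈ O, S.w x ≤ 2 * l⁻¹ * ∑ x ∈ A with l / 2 < |f x|, |f x| * S.w x := by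
    rw [hsumO]
    calc ∑ C ∈ I, ∑ x ∈ C, S.w x
        ≤ ∑ C ∈ I, 2 * l⁻¹ * ∑ y ∈ C with l / 2 < |f y|, |f y| * S.w y :=
          Finset.sum_le_sum fun C hC => by
            obtain ⟨t, x, -, h, -⟩ := hI C hC
            exact S.maximal_cubes_mass hl h
      _ = 2 * l⁻¹ * ∑ x ∈ O with l / 2 < |f x|, |f x| * S.w x := by
          rw [← Finset.mul_sum, Finset.sum_filter, hsumO]
          simp_rw [Finset.sum_filter]
      _ ≤ _ := by
          gcongr 2 * l⁻¹ * ?_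
          apply Finset.sum_le_sum_of_subset_of_nonneg
          · intro x hx
            rw [Finset.mem_filter] at hx ⊢
            refine ⟨?_, hx.2⟩
            by_contra hxA
            have := hx.2
            rw [hf x hxA, abs_zero] at this
            linarith
          · intro y _ _
            exact mul_nonneg (abs_nonneg _) (S.w_pos y).le
  let avg : Finset V → ℝ := fun C => (∑ y ∈ C, f y * S.w y) / ∑ y ∈ C, S.w y
  let bad : Finset V → V → ℝ := fun C x => if x ∈ C then f x - avg C else 0
  have havg : ∀ C ∈ I, |avg C| ≤ S.D * l := by
    intro C hC
    obtain ⟨t, x, -, -, h⟩ := hI C hC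
    simp only [avg]
    rw [abs_div, abs_of_pos (hIne C hC), div_le_iff₀ (hIne C hC)]
    refine (Finset.abs_sum_le_sum_abs _ _).trans (le_trans (le_of_eq ?_) h)
    apply Finset.sum_congr rfl
    intro y _
    rw [abs_mul, abs_of_pos (S.w_pos y)]
  have havg' : ∀ C ∈ I, |avg C| * ∑ y ∈ C, S.w y ≤ S.D * l * ∑ y ∈ C, S.w y := fun C hC =>
    mul_le_mul_of_nonneg_right (havg C hC) (hIne C hC).le
  let g : V → ℝ := fun x => f x - ∑ C ∈ I, bad C x
  have hgO : ∀ C ∈ I, ∀ x ∈ C, g x = avg C := by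
    intro C hC x hx
    have : ∑ C' ∈ I, bad C' x = bad C x := by
      apply Finset.sum_eq_single_of_mem C hC
      intro C' hC' hne
      simp only [bad]
      rw [if_neg]
      intro hx'
      exact Finset.disjoint_left.1 (hdisj hC' hC hne) hx' hx
    simp only [g, this]
    simp only [bad, if_pos hx]
    ring
  have hgout : ∀ x, x ∉ O → g x = f x := by
    intro x hx
    simp only [g]
    rw [Finset.sum_eq_zero, sub_zero]
    intro C hC
    simp only [bad]
    rw [if_neg]
    intro hxC
    exact hx (Finset.mem_biUnion.2 ⟨C, hC, hxC⟩)
  set B := A ∪ O with hB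
  let Tb : V → ℝ := fun x => ∑ C ∈ I, ∑ y ∈ C, k x y * bad C y
  let Tg : V → ℝ := fun x => ∑ y ∈ B, k x y * g y
  have hT : ∀ x, ∑ y ∈ A, k x y * f y = Tg x + Tb x := by
    intro x
    have e1 : ∑ y ∈ A, k x y * f y = ∑ y ∈ B, k x y * f y := by
      apply Finset.sum_subset Finset.subset_union_left
      intro y _ hy
      rw [hf y hy, mul_zero]
    have e2 : Tb x = ∑ y ∈ B, k x y * ∑ C ∈ I, bad C y := by
      simp only [Tb, Finset.mul_sum]
      rw [Finset.sum_comm]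
      apply Finset.sum_congr rfl
      intro C hC
      apply Finset.sum_subset
      · intro y hy
        exact Finset.mem_union_right _ (Finset.mem_biUnion.2 ⟨C, hC, hy⟩)
      · intro y _ hy
        simp [bad, hy]
    rw [e1, e2, ← Finset.sum_add_distrib]
    apply Finset.sum_congr rfl
    intro y _
    simp only [g]
    ring
  -- the good part
  have hgood : ∑ x ∈ F with l / 2 < |Tg x|, S.w x ≤
      4 * Ca * ((l ^ 2)⁻¹ * ∑ x ∈ A with |f x| ≤ l, f x ^ 2 * S.w x)
        + 4 * Ca * S.D ^ 2 * ∑ x ∈ O, S.w x := by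
    have h0 : ∑ x ∈ B, g x ^ 2 * S.w x ≤ ∑ x ∈ A with |f x| ≤ l, f x ^ 2 * S.w x
        + S.D ^ 2 * l ^ 2 * ∑ x ∈ O, S.w x := by
      have hBO : B = (A \ O) ∪ O := by simp [hB]
      rw [hBO, Finset.sum_union Finset.sdiff_disjoint]
      apply add_le_add
      · calc ∑ x ∈ A \ O, g x ^ 2 * S.w x = ∑ x ∈ A \ O, f x ^ 2 * S.w x := by
              apply Finset.sum_congr rfl
              intro x hx
              rw [hgout x (Finset.mem_sdiff.1 hx).2]
          _ ≤ _ := by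
              apply Finset.sum_le_sum_of_subset_of_nonneg
              · intro x hx
                rw [Finset.mem_sdiff] at hx
                exact Finset.mem_filter.2 ⟨hx.1, hout x hx.2⟩
              · intro y _ _
                exact mul_nonneg (sq_nonneg _) (S.w_pos y).le
      · rw [hsumO, hsumO, Finset.mul_sum]
        apply Finset.sum_le_sum
        intro C hC
        rw [Finset.mul_sum]
        apply Finset.sum_le_sum
        intro x hx
        rw [hgO C hC x hx, ← mul_pow, ← sq_abs (avg C)]
        apply mul_le_mul_of_nonneg_right _ (S.w_pos x).le
        exact pow_le_pow_left₀ (abs_nonneg _) (havg C hC) 2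
    refine (S.chebyshev_two F Tg (half_pos hl)).trans ?_
    calc ((l / 2) ^ 2)⁻¹ * ∑ x ∈ F, Tg x ^ 2 * S.w x
        ≤ ((l / 2) ^ 2)⁻¹ * (Ca * ∑ x ∈ B, g x ^ 2 * S.w x) := by
          gcongr; exact hL2 F B g
      _ ≤ ((l / 2) ^ 2)⁻¹ * (Ca * (∑ x ∈ A with |f x| ≤ l, f x ^ 2 * S.w x
        + S.D ^ 2 * l ^ 2 * ∑ x ∈ O, S.w x)) := by gcongr
      _ = _ := by field_simp; ring
  -- the bad part
  have hstar : ∀ C ∈ I, ∃ Q' : Finset V, ∑ x ∈ Q', S.w x ≤ Cb * ∑ x ∈ C, S.w x ∧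
      ∀ y ∈ C, ∀ y' ∈ C, ∀ F : Finset V, Disjoint F Q' →
      ∑ x ∈ F, |k x y / S.w y - k x y' / S.w y'| * S.w x ≤ Cc := by
    intro C hC
    obtain ⟨t, x, rfl, -, -⟩ := hI C hC
    exact hH t x
  choose! Qs hQs1 hQs2 using hstar
  set O' := I.biUnion Qs with hO'
  have hmO' : ∑ x ∈ O', S.w x ≤ Cb * ∑ x ∈ O, S.w x := by
    calc ∑ x ∈ O', S.w x ≤ ∑ C ∈ I, ∑ x ∈ Qs C, S.w x :=
          sum_biUnion_le (fun x => (S.w_pos x).le) _ _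
      _ ≤ ∑ C ∈ I, Cb * ∑ x ∈ C, S.w x := Finset.sum_le_sum hQs1
      _ = _ := by rw [hsumO, Finset.mul_sum]
  have hbad : ∑ x ∈ F \ O' with l / 2 < |Tb x|, S.w x ≤ 4 * Cc * S.D * ∑ x ∈ O, S.w x := by
    refine (S.chebyshev_one _ Tb (half_pos hl)).trans ?_
    have h1 : ∑ x ∈ F \ O', |Tb x| * S.w x ≤ Cc * (2 * S.D * l * ∑ x ∈ O, S.w x) := by
      calc ∑ x ∈ F \ O', |Tb x| * S.w x
          ≤ ∑ x ∈ F \ O', ∑ C ∈ I, |∑ y ∈ C, k x y * bad C y| * S.w x := by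
            apply Finset.sum_le_sum
            intro x _
            rw [← Finset.sum_mul]
            exact mul_le_mul_of_nonneg_right (Finset.abs_sum_le_sum_abs _ _) (S.w_pos x).le
        _ = ∑ C ∈ I, ∑ x ∈ F \ O', |∑ y ∈ C, k x y * bad C y| * S.w x := Finset.sum_comm
        _ ≤ ∑ C ∈ I, Cc * (2 * S.D * l * ∑ x ∈ C, S.w x) := by
            apply Finset.sum_le_sum
            intro C hC
            obtain ⟨t, z, hCz, -, hup⟩ := hI C hC
            have hz : z ∈ C := hCz ▸ S.mem_self t z
            have hd : Disjoint (F \ O') (Qs C) := by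
              rw [Finset.disjoint_left]
              intro x hx hx'
              exact (Finset.mem_sdiff.1 hx).2 (Finset.mem_biUnion.2 ⟨C, hC, hx'⟩)
            have hm : ∑ y ∈ C, bad C y * S.w y = 0 := by
              have : ∑ y ∈ C, bad C y * S.w y = ∑ y ∈ C, (f y * S.w y - avg C * S.w y) := by
                apply Finset.sum_congr rfl
                intro y hy
                simp only [bad, if_pos hy]
                ring
              rw [this, Finset.sum_sub_distrib, ← Finset.mul_sum]
              simp only [avg]
              rw [div_mul_cancel₀ _ (hIne C hC).ne', sub_self]
            refine (S.bad_part_bound (fun y hy => hQs2 C hC y hy z hz _ hd) hm).trans ?_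
            gcongr
            calc ∑ y ∈ C, |bad C y| * S.w y
                ≤ ∑ y ∈ C, (|f y| * S.w y + |avg C| * S.w y) := by
                  apply Finset.sum_le_sum
                  intro y hy
                  simp only [bad, if_pos hy, ← add_mul]
                  exact mul_le_mul_of_nonneg_right (abs_sub _ _) (S.w_pos y).le
              _ = ∑ y ∈ C, |f y| * S.w y + |avg C| * ∑ y ∈ C, S.w y := by
                  rw [Finset.sum_add_distrib, Finset.mul_sum]
              _ ≤ _ := by linarith [havg' C hC]
        _ = _ := by rw [hsumO, ← Finset.mul_sum, ← Finset.mul_sum]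
    calc (l / 2)⁻¹ * ∑ x ∈ F \ O', |Tb x| * S.w x
        ≤ (l / 2)⁻¹ * (Cc * (2 * S.D * l * ∑ x ∈ O, S.w x)) := by gcongr
      _ = _ := by field_simp; ring
  -- combine
  have hsplit : ∑ x ∈ F with l < |∑ y ∈ A, k x y * f y|, S.w x ≤
      ∑ x ∈ F with l / 2 < |Tg x|, S.w x + (∑ x ∈ O', S.w x
        + ∑ x ∈ F \ O' with l / 2 < |Tb x|, S.w x) := by
    have hun : F.filter (fun x => l < |∑ y ∈ A, k x y * f y|) ⊆
        F.filter (fun x => l / 2 < |Tg x|) ∪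
          (O' ∪ (F \ O').filter (fun x => l / 2 < |Tb x|)) := by
      intro x hx
      obtain ⟨hxF, hxl⟩ := Finset.mem_filter.1 hx
      rw [hT x] at hxl
      simp only [Finset.mem_union, Finset.mem_filter, Finset.mem_sdiff]
      by_contra hcon
      push Not at hcon
      have h1 := hcon.1 hxF
      have h2 := hcon.2.2 ⟨hxF, hcon.2.1⟩
      have := abs_add_le (Tg x) (Tb x)
      linarith
    have hu := sum_union_le (fun x => (S.w_pos x).le)
    refine (Finset.sum_le_sum_of_subset_of_nonneg hun (fun x _ _ => (S.w_pos x).le)).trans ?_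
    refine (hu _ _).trans ?_
    gcongr
    exact hu _ _
  rcases isEmpty_or_nonempty V with hV | ⟨⟨x₀⟩⟩
  · have hA : A = ∅ := Finset.eq_empty_of_isEmpty A
    have hF : F = ∅ := Finset.eq_empty_of_isEmpty F
    subst hA; subst hF
    simp
  have hD := S.D_nonneg x₀
  have hfin : (4 * Ca * S.D ^ 2 + Cb + 4 * Cc * S.D) * ∑ x ∈ O, S.w x ≤
      (4 * Ca * S.D ^ 2 + Cb + 4 * Cc * S.D) *
        (2 * l⁻¹ * ∑ x ∈ A with l / 2 < |f x|, |f x| * S.w x) := by gcongr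
  linarith

end CubeSystem

theorem integral_rpow_below {s : ℝ} (hs : -1 < s) {a : ℝ} (ha : 0 ≤ a) :
    IntegrableOn (fun l : ℝ => if l < a then l ^ s else 0) (Ioi 0) ∧
      ∫ l in Ioi (0 : ℝ), (if l < a then l ^ s else 0) = a ^ (s + 1) / (s + 1) := by
  have e : (fun l : ℝ => if l < a then l ^ s else 0) = (Iio a).indicator (fun l => l ^ s) := by
    ext l; simp [Set.indicator]
  rw [e]
  have hI : Ioi (0 : ℝ) ∩ Iio a = Ioo 0 a := by ext; simp
  have hint : IntegrableOn (fun l : ℝ => l ^ s) (Ioo 0 a) := by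
    have := intervalIntegral.intervalIntegrable_rpow' (a := 0) (b := a) hs
    rw [intervalIntegrable_iff_integrableOn_Ioo_of_le ha] at this
    exact this
  constructor
  · rw [IntegrableOn, integrable_indicator_iff measurableSet_Iio, IntegrableOn,
      Measure.restrict_restrict measurableSet_Iio, inter_comm, hI]
    exact hint
  · rw [setIntegral_indicator measurableSet_Iio, hI, ← integral_Ioc_eq_integral_Ioo,
      ← intervalIntegral.integral_of_le ha, integral_rpow (Or.inl hs),
      Real.zero_rpow (by linarith), sub_zero]

theorem integral_rpow_above {s : ℝ} (hs : s < -1) {a : ℝ} (ha : 0 < a) :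
    IntegrableOn (fun l : ℝ => if a ≤ l then l ^ s else 0) (Ioi 0) ∧
      ∫ l in Ioi (0 : ℝ), (if a ≤ l then l ^ s else 0) = -a ^ (s + 1) / (s + 1) := by
  have e : (fun l : ℝ => if a ≤ l then l ^ s else 0) = (Ici a).indicator (fun l => l ^ s) := by
    ext l; simp [Set.indicator]
  rw [e]
  have hI : Ioi (0 : ℝ) ∩ Ici a = Ici a := by
    ext; simp only [mem_inter_iff, mem_Ioi, mem_Ici, and_iff_right_iff_imp]; intro h; linarith
  constructor
  · rw [IntegrableOn, integrable_indicator_iff measurableSet_Ici, IntegrableOn,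
      Measure.restrict_restrict measurableSet_Ici, inter_comm, hI]
    exact (integrableOn_Ici_iff_integrableOn_Ioi).2 (integrableOn_Ioi_rpow_of_lt hs ha)
  · rw [setIntegral_indicator measurableSet_Ici, hI, integral_Ici_eq_integral_Ioi,
      integral_Ioi_rpow_of_lt hs ha]

namespace CubeSystem

variable {V : Type*} (S : CubeSystem V)

theorem strong_type_aux {k : V → V → ℝ} {Ca Cb Cc : ℝ} (ha : 0 ≤ Ca) (hb : 0 ≤ Cb) (hc : 0 ≤ Cc)
    (hL2 : ∀ (F B : Finset V) (f : V → ℝ), ∑ x ∈ F, (∑ y ∈ B, k x y * f y) ^ 2 * S.w x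
      ≤ Ca * ∑ y ∈ B, f y ^ 2 * S.w y)
    (hH : S.Hormander k Cb Cc) {p : ℝ} (hp1 : 1 < p) (hp2 : p < 2)
    {f : V → ℝ} {A : Finset V} (hf : ∀ x, x ∉ A → f x = 0) (F : Finset V) :
    ∑ x ∈ F, |∑ y ∈ A, k x y * f y| ^ p * S.w x ≤
      p * (4 * Ca / (2 - p) +
      2 * (4 * Ca * S.D ^ 2 + Cb + 4 * Cc * S.D) * (2 ^ (p - 1) / (p - 1))) *
        ∑ x ∈ A, |f x| ^ p * S.w x := by
  set u : V → ℝ := fun x => ∑ y ∈ A, k x y * f y with hu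
  set K₁ := 4 * Ca
  set K₂ := 2 * (4 * Ca * S.D ^ 2 + Cb + 4 * Cc * S.D)
  let φ : V → ℝ → ℝ := fun x l => (if l < |u x| then l ^ (p - 1) else 0) * S.w x
  let ψ : V → ℝ → ℝ := fun x l => f x ^ 2 * (if |f x| ≤ l then l ^ (p - 3) else 0) * S.w x
  let χ : V → ℝ → ℝ := fun x l => (if l < 2 * |f x| then l ^ (p - 2) else 0) * (|f x| * S.w x)
  have hφ : ∀ x, IntegrableOn (φ x) (Ioi 0) ∧
      ∫ l in Ioi (0 : ℝ), φ x l = |u x| ^ p / p * S.w x := by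
    intro x
    obtain ⟨h1, h2⟩ := integral_rpow_below (s := p - 1) (by linarith) (abs_nonneg (u x))
    refine ⟨h1.mul_const _, ?_⟩
    simp only [φ]
    rw [integral_mul_const, h2, sub_add_cancel]
  have hχ : ∀ x, IntegrableOn (χ x) (Ioi 0) ∧
      ∫ l in Ioi (0 : ℝ), χ x l = 2 ^ (p - 1) / (p - 1) * (|f x| ^ p * S.w x) := by
    intro x
    obtain ⟨h1, h2⟩ := integral_rpow_below (s := p - 2) (a := 2 * |f x|) (by linarith)
      (by positivity)
    refine ⟨h1.mul_const _, ?_⟩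
    simp only [χ]
    rw [integral_mul_const, h2, show p - 2 + 1 = p - 1 by ring,
      Real.mul_rpow (by norm_num) (abs_nonneg _)]
    have : |f x| ^ (p - 1) * |f x| = |f x| ^ p := by
      rcases eq_or_lt_of_le (abs_nonneg (f x)) with h | h
      · rw [← h, mul_zero, Real.zero_rpow (by linarith)]
      · rw [Real.rpow_sub_one h.ne']; field_simp
    rw [← this]; ring
  have hψ : ∀ x, IntegrableOn (ψ x) (Ioi 0) ∧
      ∫ l in Ioi (0 : ℝ), ψ x l = 1 / (2 - p) * (|f x| ^ p * S.w x) := by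
    intro x
    by_cases h0 : f x = 0
    · have : ψ x = fun _ => 0 := by ext l; simp [ψ, h0]
      rw [this]
      refine ⟨integrableOn_zero, ?_⟩
      simp [h0, Real.zero_rpow (by linarith : p ≠ 0)]
    · have hpos : 0 < |f x| := abs_pos.2 h0
      obtain ⟨h1, h2⟩ := integral_rpow_above (s := p - 3) (by linarith) hpos
      refine ⟨(h1.const_mul _).mul_const _, ?_⟩
      simp only [ψ]
      rw [integral_mul_const, integral_const_mul, h2, show p - 3 + 1 = p - 2 by ring,
        show (2 : ℝ) = ((2 : ℕ) : ℝ) by norm_num, Real.rpow_sub_natCast hpos.ne', sq_abs]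
      have : (2 - p) ≠ 0 := by linarith
      have : (p - 2) ≠ 0 := by linarith
      push_cast
      field_simp
      ring
  have hpt : ∀ l ∈ Ioi (0 : ℝ), ∑ x ∈ F, φ x l ≤
      K₁ * ∑ x ∈ A, ψ x l + K₂ * ∑ x ∈ A, χ x l := by
    intro l hl
    rw [mem_Ioi] at hl
    have h := S.level_estimate ha hb hc hL2 hH hf hl F
    have hlp : 0 < l ^ (p - 1) := Real.rpow_pos_of_pos hl _
    have h' := mul_le_mul_of_nonneg_left h hlp.le
    have e1 : l ^ (p - 1) * ∑ x ∈ F with l < |∑ y ∈ A, k x y * f y|, S.w x = ∑ x ∈ F, φ x l := by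
      rw [Finset.sum_filter, Finset.mul_sum]
      apply Finset.sum_congr rfl
      intro x _
      simp only [φ, hu]
      split_ifs <;> simp
    have e2 : l ^ (p - 1) * ((l ^ 2)⁻¹ * ∑ x ∈ A with |f x| ≤ l, f x ^ 2 * S.w x)
        = ∑ x ∈ A, ψ x l := by
      have : l ^ (p - 1) * (l ^ 2)⁻¹ = l ^ (p - 3) := by
        rw [show p - 3 = p - 1 - ((2 : ℕ) : ℝ) by push_cast; ring,
          Real.rpow_sub_natCast hl.ne', div_eq_mul_inv]
      rw [← mul_assoc, this, Finset.sum_filter, Finset.mul_sum]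
      apply Finset.sum_congr rfl
      intro x _
      simp only [ψ]
      split_ifs
      · ring
      · simp
    have e3 : l ^ (p - 1) * (l⁻¹ * ∑ x ∈ A with l / 2 < |f x|, |f x| * S.w x)
        = ∑ x ∈ A, χ x l := by
      have : l ^ (p - 1) * l⁻¹ = l ^ (p - 2) := by
        rw [show p - 2 = p - 1 - 1 by ring, Real.rpow_sub_one hl.ne' (p - 1), div_eq_mul_inv]
      rw [← mul_assoc, this, Finset.sum_filter, Finset.mul_sum]
      apply Finset.sum_congr rfl
      intro x _
      simp only [χ]
      have : l / 2 < |f x| ↔ l < 2 * |f x| := by constructor <;> intro h <;> linarith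
      simp only [this]
      split_ifs <;> simp
    rw [e1, mul_add, mul_left_comm, e2, mul_left_comm _ (2 * _), e3] at h'
    exact h'
  have hF1 : IntegrableOn (fun l => ∑ x ∈ F, φ x l) (Ioi 0) :=
    integrable_finsetSum _ fun x _ => (hφ x).1
  have hA1 : IntegrableOn (fun l => ∑ x ∈ A, ψ x l) (Ioi 0) :=
    integrable_finsetSum _ fun x _ => (hψ x).1
  have hA2 : IntegrableOn (fun l => ∑ x ∈ A, χ x l) (Ioi 0) :=
    integrable_finsetSum _ fun x _ => (hχ x).1
  have hmain := setIntegral_mono_on hF1 ((hA1.const_mul K₁).add (hA2.const_mul K₂))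
    measurableSet_Ioi hpt
  simp only [Pi.add_apply] at hmain
  rw [integral_add (hA1.const_mul K₁) (hA2.const_mul K₂), integral_const_mul, integral_const_mul,
    integral_finsetSum _ fun x _ => (hφ x).1, integral_finsetSum _ fun x _ => (hψ x).1,
    integral_finsetSum _ fun x _ => (hχ x).1] at hmain
  simp only [hφ, hψ, hχ] at hmain
  rw [← Finset.mul_sum, ← Finset.mul_sum] at hmain
  have hp0 : 0 < p := by linarith
  have : ∑ x ∈ F, |u x| ^ p * S.w x = p * ∑ x ∈ F, |u x| ^ p / p * S.w x := by
    rw [Finset.mul_sum]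
    apply Finset.sum_congr rfl
    intro x _
    field_simp
  rw [this]
  refine (mul_le_mul_of_nonneg_left hmain hp0.le).trans_eq ?_
  ring

theorem strong_type {k : V → V → ℝ} {Ca Cb Cc : ℝ} (ha : 0 ≤ Ca) (hb : 0 ≤ Cb) (hc : 0 ≤ Cc)
    (hL2 : ∀ (F B : Finset V) (f : V → ℝ), ∑ x ∈ F, (∑ y ∈ B, k x y * f y) ^ 2 * S.w x
      ≤ Ca * ∑ y ∈ B, f y ^ 2 * S.w y)
    (hH : S.Hormander k Cb Cc) {p : ℝ} (hp1 : 1 < p) (hp2 : p < 2) :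
    ∃ C : ℝ, ∀ (F A : Finset V) (f : V → ℝ), ∑ x ∈ F, |∑ y ∈ A, k x y * f y| ^ p * S.w x ≤
      C * ∑ x ∈ A, |f x| ^ p * S.w x := by
  refine ⟨p * (4 * Ca / (2 - p) +
      2 * (4 * Ca * S.D ^ 2 + Cb + 4 * Cc * S.D) * (2 ^ (p - 1) / (p - 1))), fun F A f => ?_⟩
  have h := S.strong_type_aux ha hb hc hL2 hH hp1 hp2 (f := fun x => if x ∈ A then f x else 0)
    (A := A) (fun x hx => if_neg hx) F
  have e1 : ∀ x, ∑ y ∈ A, k x y * (if y ∈ A then f y else 0) = ∑ y ∈ A, k x y * f y := fun x =>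
    Finset.sum_congr rfl fun y hy => by rw [if_pos hy]
  have e2 : ∑ x ∈ A, |if x ∈ A then f x else 0| ^ p * S.w x = ∑ x ∈ A, |f x| ^ p * S.w x :=
    Finset.sum_congr rfl fun y hy => by rw [if_pos hy]
  simp only [e1, e2] at h
  exact h

end CubeSystem

namespace FlowTree

/-- The level from which a vertex of level `n` belongs to a cube of height `2 ^ b`. -/
def scale (b : ℕ) (n : ℤ) : ℤ := 2 ^ b * (n / 2 ^ b) + 2 * 2 ^ b

theorem scale_zero (n : ℤ) : scale 0 n = n + 2 := by simp [scale]

theorem ediv_two_pow_succ (b : ℕ) (n : ℤ) : n / 2 ^ (b + 1) = n / 2 ^ b / 2 := by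
  rw [pow_succ, Int.ediv_ediv_of_nonneg (by positivity)]

theorem scale_add_le (b : ℕ) (n : ℤ) : scale b n + 2 ^ b ≤ scale (b + 1) n := by
  unfold scale
  rw [ediv_two_pow_succ, pow_succ]
  have h : n / 2 ^ b - 1 ≤ 2 * (n / 2 ^ b / 2) := by omega
  have h2 : (0 : ℤ) < 2 ^ b := by positivity
  nlinarith

theorem scale_strictMono (n : ℤ) : StrictMono fun b => scale b n :=
  strictMono_nat_of_lt_succ fun b => by
    have h2 : (0 : ℤ) < 2 ^ b := by positivity
    have := scale_add_le b n
    omega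

theorem ediv_bounds (b : ℕ) (n : ℤ) : 2 ^ b * (n / 2 ^ b) ≤ n ∧ n < 2 ^ b * (n / 2 ^ b) + 2 ^ b := by
  have h2 : (0 : ℤ) < 2 ^ b := by positivity
  have h3 := Int.mul_ediv_add_emod n (2 ^ b)
  have h4 := Int.emod_nonneg n h2.ne'
  have h5 := Int.emod_lt_of_pos n h2
  constructor <;> linarith

theorem lt_scale (b : ℕ) (n : ℤ) : n + 2 ^ b < scale b n := by
  have := (ediv_bounds b n).2
  unfold scale
  linarith

theorem scale_congr {b : ℕ} {n n' : ℤ} (h : n / 2 ^ b = n' / 2 ^ b) :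
    scale b n = scale b n' ∧ scale (b + 1) n = scale (b + 1) n' := by
  unfold scale
  rw [ediv_two_pow_succ, ediv_two_pow_succ, h]
  exact ⟨rfl, rfl⟩

theorem exists_scale {n t : ℤ} (h : n + 2 ≤ t) : ∃ b, scale b n ≤ t ∧ t < scale (b + 1) n := by
  have hex : ∃ b, t < scale b n := by
    refine ⟨(t - n).toNat, ?_⟩
    have h1 := lt_scale (t - n).toNat n
    have h2 : ((t - n).toNat : ℤ) < 2 ^ (t - n).toNat := by exact_mod_cast Nat.lt_two_pow_self
    omega
  obtain ⟨b, hb⟩ : ∃ b, Nat.find hex = b + 1 := by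
    refine Nat.exists_eq_succ_of_ne_zero fun h0 => ?_
    have := Nat.find_spec hex
    rw [h0, scale_zero] at this
    omega
  refine ⟨b, ?_, hb ▸ Nat.find_spec hex⟩
  have := Nat.find_min hex (m := b) (by omega)
  omega

theorem scale_unique {n t : ℤ} {b b' : ℕ} (h1 : scale b n ≤ t) (h2 : t < scale (b + 1) n)
    (h1' : scale b' n ≤ t) (h2' : t < scale (b' + 1) n) : b = b' := by
  have h3 := (scale_strictMono n).lt_iff_lt.1 (h1.trans_lt h2')
  have h4 := (scale_strictMono n).lt_iff_lt.1 (h1'.trans_lt h2)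
  omega

variable {q : ℕ} (S : FlowTree q)

/-- The descendants of `z` at depths in `(N - h, N]`. -/
noncomputable def block (z : S.V) (h N : ℕ) : Finset S.V :=
  (Finset.Ioc (N - h) N).biUnion (S.desc z)

theorem mem_block {z y : S.V} {h N : ℕ} :
    y ∈ S.block z h N ↔ ∃ k, (N - h < k ∧ k ≤ N) ∧ S.pred^[k] y = z := by
  simp [block]

theorem sum_biUnion_desc (hq : 0 < q) (z : S.V) (I : Finset ℕ) :
    ∑ y ∈ I.biUnion (S.desc z), S.wR y = I.card * S.wR z := by
  rw [Finset.sum_biUnion, Finset.sum_congr rfl fun k _ => S.sum_desc_wR hq z k, Finset.sum_const,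
    nsmul_eq_mul]
  intro k _ k' _ hkk'
  rw [Function.onFun, Finset.disjoint_left]
  intro y hy hy'
  have h1 := S.level_of_mem_desc hy
  have h2 := S.level_of_mem_desc hy'
  omega

theorem sum_block (hq : 0 < q) (z : S.V) {h N : ℕ} (hN : h ≤ N) :
    ∑ y ∈ S.block z h N, S.wR y = h * S.wR z := by
  rw [block, S.sum_biUnion_desc hq, Nat.card_Ioc]
  congr 2
  omega

/-- The cube of scale `t` containing `x`. -/
noncomputable def cube (t : ℤ) (x : S.V) : Finset S.V :=
  if h : S.level x + 2 ≤ t then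
    S.block (S.pred^[(t - S.level x).toNat] x) (2 ^ (exists_scale h).choose)
      (t - 2 ^ (exists_scale h).choose * (S.level x / 2 ^ (exists_scale h).choose)).toNat
  else {x}

theorem cube_of_lt {t : ℤ} {x : S.V} (h : t < S.level x + 2) : S.cube t x = {x} :=
  dif_neg (by omega)

theorem le_of_scale_le {b : ℕ} {n t : ℤ} (h : scale b n ≤ t) : n + 2 ≤ t := by
  have := (scale_strictMono n).monotone (Nat.zero_le b)
  simp only [scale_zero] at this
  omega

theorem cube_of_scale {t : ℤ} {x : S.V} {b : ℕ} (h1 : scale b (S.level x) ≤ t)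
    (h2 : t < scale (b + 1) (S.level x)) : S.cube t x =
      S.block (S.pred^[(t - S.level x).toNat] x) (2 ^ b)
        (t - 2 ^ b * (S.level x / 2 ^ b)).toNat := by
  have h := le_of_scale_le h1
  have hb := scale_unique (exists_scale h).choose_spec.1 (exists_scale h).choose_spec.2 h1 h2
  rw [cube, dif_pos h, hb]

theorem mem_cube_iff {t : ℤ} {x y : S.V} {b : ℕ} (h1 : scale b (S.level x) ≤ t)
    (h2 : t < scale (b + 1) (S.level x)) : y ∈ S.cube t x ↔
      S.level y / 2 ^ b = S.level x / 2 ^ b ∧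
        S.pred^[(t - S.level y).toNat] y = S.pred^[(t - S.level x).toNat] x := by
  have hx := le_of_scale_le h1
  have hH : (0 : ℤ) < 2 ^ b := by positivity
  have hc : ((2 ^ b : ℕ) : ℤ) = 2 ^ b := by push_cast; rfl
  have hlz := S.level_iterate (t - S.level x).toNat x
  have hb := ediv_bounds b (S.level x)
  rw [S.cube_of_scale h1 h2, mem_block]
  unfold scale at h1
  constructor
  · rintro ⟨k, ⟨hk1, hk2⟩, hk⟩
    have hly := S.level_iterate k y
    rw [hk] at hly
    have hk' : (t - S.level y).toNat = k := by omega
    rw [hk']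
    refine ⟨?_, hk⟩
    have h3 : 2 ^ b * (S.level x / 2 ^ b) ≤ S.level y := by omega
    have h4 : S.level y < 2 ^ b * (S.level x / 2 ^ b) + 2 ^ b := by omega
    apply le_antisymm
    · apply Int.le_of_lt_add_one
      apply Int.ediv_lt_of_lt_mul hH
      linarith
    · apply Int.le_ediv_of_mul_le hH
      linarith
  · rintro ⟨h3, h4⟩
    have hb' := ediv_bounds b (S.level y)
    rw [h3] at hb'
    exact ⟨_, ⟨by omega, by omega⟩, h4⟩

theorem sum_cube (hq : 0 < q) {t : ℤ} {x : S.V} {b : ℕ} (h1 : scale b (S.level x) ≤ t)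
    (h2 : t < scale (b + 1) (S.level x)) : ∑ y ∈ S.cube t x, S.wR y = 2 ^ b * (q : ℝ) ^ t := by
  have hx := le_of_scale_le h1
  have hb := ediv_bounds b (S.level x)
  have hc : ((2 ^ b : ℕ) : ℤ) = 2 ^ b := by push_cast; rfl
  rw [S.cube_of_scale h1 h2, S.sum_block hq, wR, level_iterate]
  · push_cast
    congr 2
    omega
  · unfold scale at h1
    omega

theorem cube_cases (t : ℤ) (x : S.V) : t < S.level x + 2 ∨
    ∃ b, scale b (S.level x) ≤ t ∧ t < scale (b + 1) (S.level x) := by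
  rcases lt_or_ge t (S.level x + 2) with h | h
  · exact Or.inl h
  · exact Or.inr (exists_scale h)

theorem cube_eq_singleton_or_block (t : ℤ) (x : S.V) : S.cube t x = {x} ∨ ∃ z h N, 1 ≤ h ∧
    2 * h ≤ N ∧ N ≤ 4 * h ∧ S.cube t x = S.block z h N := by
  rcases S.cube_cases t x with h | ⟨b, h1, h2⟩
  · exact Or.inl (S.cube_of_lt h)
  · refine Or.inr ⟨_, _, _, Nat.one_le_two_pow, ?_, ?_, S.cube_of_scale h1 h2⟩
    · have hc : ((2 ^ b : ℕ) : ℤ) = 2 ^ b := by push_cast; rfl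
      unfold scale at h1
      omega
    · have hc : ((2 ^ b : ℕ) : ℤ) = 2 ^ b := by push_cast; rfl
      have h3 : (2 : ℤ) ^ (b + 1) * (S.level x / 2 ^ (b + 1)) ≤ 2 ^ b * (S.level x / 2 ^ b) := by
        rw [ediv_two_pow_succ, pow_succ, mul_assoc]
        apply mul_le_mul_of_nonneg_left _ (by positivity)
        omega
      unfold scale at h2
      have h4 : (2 : ℤ) ^ (b + 1) = 2 * 2 ^ b := by ring
      omega

theorem mem_cube_self (t : ℤ) (x : S.V) : x ∈ S.cube t x := by
  rcases S.cube_cases t x with h | ⟨b, h1, h2⟩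
  · rw [S.cube_of_lt h]; simp
  · rw [S.mem_cube_iff h1 h2]; exact ⟨rfl, rfl⟩

theorem cube_eq_of_mem (t : ℤ) (x y : S.V) (hy : y ∈ S.cube t x) : S.cube t y = S.cube t x := by
  rcases S.cube_cases t x with h | ⟨b, h1, h2⟩
  · rw [S.cube_of_lt h, Finset.mem_singleton] at hy
    rw [hy]
  · rw [S.mem_cube_iff h1 h2] at hy
    obtain ⟨e1, e2⟩ := scale_congr hy.1
    rw [S.cube_of_scale h1 h2, S.cube_of_scale (e1 ▸ h1) (e2 ▸ h2), hy.1, hy.2]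

theorem scale_step {b : ℕ} {n t : ℤ} (h1 : scale b n ≤ t) (h2 : t < scale (b + 1) n) :
    ∃ b', b ≤ b' ∧ b' ≤ b + 1 ∧ scale b' n ≤ t + 1 ∧ t + 1 < scale (b' + 1) n := by
  rcases lt_or_ge (t + 1) (scale (b + 1) n) with h | h
  · exact ⟨b, le_rfl, by omega, by omega, h⟩
  · have : scale (b + 1) n < scale (b + 1 + 1) n := scale_strictMono n (Nat.lt_succ_self _)
    exact ⟨b + 1, by omega, le_rfl, h, by omega⟩

theorem cube_mono (t : ℤ) (x : S.V) : S.cube t x ⊆ S.cube (t + 1) x := by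
  rcases S.cube_cases t x with h | ⟨b, h1, h2⟩
  · rw [S.cube_of_lt h, Finset.singleton_subset_iff]
    exact S.mem_cube_self _ _
  · obtain ⟨b', hb1, hb2, h3, h4⟩ := scale_step h1 h2
    intro y hy
    rw [S.mem_cube_iff h1 h2] at hy
    have e1 := (scale_congr hy.1).1
    have hx := le_of_scale_le h1
    have hy' := le_of_scale_le (e1 ▸ h1)
    rw [S.mem_cube_iff h3 h4]
    constructor
    · rcases hb1.eq_or_lt with h | h
      · rw [← h]; exact hy.1
      · rw [show b' = b + 1 by omega, ediv_two_pow_succ, hy.1, ediv_two_pow_succ]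
    · rw [show (t + 1 - S.level y).toNat = (t - S.level y).toNat + 1 by omega,
        show (t + 1 - S.level x).toNat = (t - S.level x).toNat + 1 by omega,
        iterate_succ_apply', iterate_succ_apply', hy.2]

theorem cube_doubling (hq : 2 ≤ q) (t : ℤ) (x : S.V) :
    ∑ y ∈ S.cube (t + 1) x, S.wR y ≤ (q : ℝ) ^ 2 * ∑ y ∈ S.cube t x, S.wR y := by
  have hq0 : 0 < q := by omega
  have hq' : (2 : ℝ) ≤ q := by exact_mod_cast hq
  have hqne : (q : ℝ) ≠ 0 := by positivity
  rcases S.cube_cases t x with h | ⟨b, h1, h2⟩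
  · rw [S.cube_of_lt h, Finset.sum_singleton]
    rcases lt_or_ge (t + 1) (S.level x + 2) with h' | h'
    · rw [S.cube_of_lt h', Finset.sum_singleton]
      exact le_mul_of_one_le_left (S.wR_pos hq0 x).le (one_le_pow₀ (by linarith))
    · have ht : t + 1 = S.level x + 2 := by omega
      have h3 : scale 0 (S.level x) ≤ t + 1 := by rw [scale_zero]; omega
      have h4 : t + 1 < scale (0 + 1) (S.level x) := by
        have : scale 0 (S.level x) < scale (0 + 1) (S.level x) :=
          scale_strictMono _ (Nat.lt_succ_self _)
        rw [scale_zero] at this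
        omega
      rw [S.sum_cube hq0 h3 h4, ht, zpow_add₀ hqne, wR]
      norm_num
      rw [mul_comm]
  · obtain ⟨b', hb1, hb2, h3, h4⟩ := scale_step h1 h2
    rw [S.sum_cube hq0 h1 h2, S.sum_cube hq0 h3 h4, zpow_add₀ hqne, zpow_one]
    have h5 : (2 : ℝ) ^ b' ≤ 2 * 2 ^ b := by
      rw [← pow_succ']
      exact pow_le_pow_right₀ (by norm_num) hb2
    have h6 : (0 : ℝ) < (q : ℝ) ^ t := by positivity
    calc (2 : ℝ) ^ b' * ((q : ℝ) ^ t * q) ≤ (q * 2 ^ b) * ((q : ℝ) ^ t * q) := by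
          gcongr
          exact h5.trans (by gcongr)
      _ = _ := by ring

theorem cube_top (hq : 2 ≤ q) (x : S.V) (R : ℝ) :
    ∃ t₀ : ℤ, ∀ t, t₀ ≤ t → R ≤ ∑ y ∈ S.cube t x, S.wR y := by
  have hq' : (2 : ℝ) ≤ q := by exact_mod_cast hq
  refine ⟨max (S.level x + 2) (max ⌈R⌉ 0), fun t ht => ?_⟩
  simp only [max_le_iff] at ht
  obtain ⟨b, h1, h2⟩ := exists_scale ht.1
  rw [S.sum_cube (by omega) h1 h2]
  lift t to ℕ using ht.2.2
  have hR : R ≤ t := (Int.le_ceil R).trans (by exact_mod_cast ht.2.1)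
  calc R ≤ t := hR
    _ ≤ (2 : ℝ) ^ t := by exact_mod_cast Nat.lt_two_pow_self.le
    _ ≤ (q : ℝ) ^ t := by gcongr
    _ ≤ 2 ^ b * (q : ℝ) ^ (t : ℤ) := by
      rw [zpow_natCast]
      exact le_mul_of_one_le_left (by positivity) (one_le_pow₀ (by norm_num))

/-- The cube system of the flow tree. -/
noncomputable def cubes (hq : 2 ≤ q) : CubeSystem S.V where
  w := S.wR
  w_pos := S.wR_pos (by omega)
  Q := S.cube
  D := (q : ℝ) ^ 2
  mem_self := S.mem_cube_self
  eq_of_mem := S.cube_eq_of_mem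
  mono := S.cube_mono
  doubling := S.cube_doubling hq
  bot x := ⟨S.level x, S.cube_of_lt (by omega)⟩
  top := S.cube_top hq

end FlowTree

theorem tsum_ofReal_sub_succ {g : ℕ → ℝ} (hg : Antitone g)
    (h0 : Filter.Tendsto g Filter.atTop (nhds 0)) :
    ∑' m, ENNReal.ofReal (g m - g (m + 1)) = ENNReal.ofReal (g 0) := by
  have h1 : ∀ m, 0 ≤ g m - g (m + 1) := fun m => sub_nonneg.2 (hg m.le_succ)
  have h2 : HasSum (fun m => g m - g (m + 1)) (g 0) := by
    rw [hasSum_iff_tendsto_nat_of_nonneg h1]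
    simp_rw [Finset.sum_range_sub']
    simpa using h0.const_sub (g 0)
  rw [← ENNReal.ofReal_tsum_of_nonneg h1 h2.summable, h2.tsum_eq]

namespace ZRiesz

theorem kap_tendsto_add (n : ℕ) : Filter.Tendsto (fun m => kap (m + n)) Filter.atTop (nhds 0) :=
  (Filter.tendsto_add_atTop_iff_nat n).2 kap_tendsto

theorem kap_antitone_add (n : ℕ) : Antitone fun m => kap (m + n) :=
  fun _ _ h => kap_antitone (Nat.add_le_add_right h n)

theorem tsum_kap_shift_le (N s : ℕ) :
    ∑' k, ENNReal.ofReal (kap (N + k) - kap (N + s + k)) ≤ ENNReal.ofReal (s * kap N) := by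
  have h : ∀ k, ENNReal.ofReal (kap (N + k) - kap (N + s + k)) =
      ∑ j ∈ Finset.range s, ENNReal.ofReal (kap (k + (N + j)) - kap (k + 1 + (N + j))) := by
    intro k
    rw [← ENNReal.ofReal_sum_of_nonneg fun j _ => sub_nonneg.2 (kap_antitone (by omega))]
    congr 1
    have := Finset.sum_range_sub' (fun j => kap (N + k + j)) s
    rw [add_zero] at this
    rw [show N + s + k = N + k + s by omega, ← this]
    exact Finset.sum_congr rfl fun j _ => by
      rw [show N + k + j = k + (N + j) by omega, show N + k + (j + 1) = k + 1 + (N + j) by omega]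
  simp_rw [h]
  rw [Summable.tsum_finsetSum fun _ _ => ENNReal.summable]
  have h2 : ∀ j ∈ Finset.range s,
      ∑' k, ENNReal.ofReal (kap (k + (N + j)) - kap (k + 1 + (N + j))) ≤ ENNReal.ofReal (kap N) := by
    intro j _
    rw [tsum_ofReal_sub_succ (kap_antitone_add _) (kap_tendsto_add _)]
    exact ENNReal.ofReal_le_ofReal (kap_antitone (by omega))
  refine (Finset.sum_le_sum h2).trans_eq ?_
  rw [Finset.sum_const, Finset.card_range, nsmul_eq_mul, ENNReal.ofReal_mul (by positivity),
    ENNReal.ofReal_natCast]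

end ZRiesz

namespace FlowTree
open ZRiesz

theorem enorm_cof_succ_sub (m N s k : ℕ) : ‖cof (m + 1) (N + k) - cof (m + 1) (N + s + k)‖ₑ =
    ENNReal.ofReal ((kap (m + (N + k)) - kap (m + (N + s + k)))
      - (kap (m + 1 + (N + k)) - kap (m + 1 + (N + s + k)))) := by
  have := kap_diff_antitone (by omega : m + (N + k) ≤ m + (N + s + k))
  simp only at this
  rw [show m + (N + k) + 1 = m + 1 + (N + k) by omega,
    show m + (N + s + k) + 1 = m + 1 + (N + s + k) by omega] at this
  rw [← ofReal_norm, Real.norm_eq_abs, cof, cof, abs_of_nonpos (by linarith)]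
  congr 1
  ring

theorem tsum_enorm_cof_shift (N s : ℕ) :
    ∑' mk : ℕ × ℕ, ‖cof mk.1 (N + mk.2) - cof mk.1 (N + s + mk.2)‖ₑ
      ≤ ENNReal.ofReal (2 * (s * kap N)) := by
  have hnn : ∀ k, 0 ≤ kap (N + k) - kap (N + s + k) := fun k =>
    sub_nonneg.2 (kap_antitone (by omega))
  rw [ENNReal.tsum_prod (f := fun m k => ‖cof m (N + k) - cof m (N + s + k)‖ₑ),
    ENNReal.tsum_comm]
  have h : ∀ k, ∑' m, ‖cof m (N + k) - cof m (N + s + k)‖ₑ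
      = 2 * ENNReal.ofReal (kap (N + k) - kap (N + s + k)) := by
    intro k
    rw [tsum_eq_zero_add' ENNReal.summable]
    simp_rw [enorm_cof_succ_sub]
    have := tsum_ofReal_sub_succ (g := fun m => kap (m + (N + k)) - kap (m + (N + s + k)))
      (antitone_nat_of_succ_le fun m => by
        have := kap_diff_antitone (by omega : m + (N + k) ≤ m + (N + s + k))
        simp only at this
        rw [show m + (N + k) + 1 = m + 1 + (N + k) by omega,
          show m + (N + s + k) + 1 = m + 1 + (N + s + k) by omega] at this
        linarith)
      (by simpa using (kap_tendsto_add (N + k)).sub (kap_tendsto_add (N + s + k)))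
    rw [this, ← ofReal_norm, Real.norm_eq_abs, cof, cof, zero_add, zero_add, abs_of_nonneg (hnn k),
      two_mul]
  simp_rw [h]
  rw [ENNReal.tsum_mul_left, ENNReal.ofReal_mul (by norm_num), ENNReal.ofReal_ofNat]
  gcongr
  exact tsum_kap_shift_le N s

theorem tsum_enorm_cof_tail {M N : ℕ} (hM : 1 ≤ M) :
    ∑' mn : ℕ × ℕ, ‖if mn.2 < N ∧ M ≤ mn.1 then cof mn.1 mn.2 else 0‖ₑ
      ≤ ENNReal.ofReal (N * kap (M - 1)) := by
  rw [ENNReal.tsum_prod (f := fun m n => ‖if n < N ∧ M ≤ m then cof m n else 0‖ₑ),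
    ENNReal.tsum_comm, tsum_eq_sum (s := Finset.range N)]
  · have h : ∀ n ∈ Finset.range N, ∑' m, ‖if n < N ∧ M ≤ m then cof m n else 0‖ₑ
        ≤ ENNReal.ofReal (kap (M - 1)) := by
      intro n hn
      have h1 : ∑' m, ‖if n < N ∧ M ≤ m then cof m n else 0‖ₑ
          = ∑' m, ‖if n < N ∧ M ≤ m + M then cof (m + M) n else 0‖ₑ := by
        symm
        refine (add_left_injective M).tsum_eq (f := fun m => ‖if n < N ∧ M ≤ m then cof m n else 0‖ₑ)
          fun m hm => ?_
        have : M ≤ m := by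
          by_contra hlt
          exact hm (by simp [hlt])
        exact ⟨m - M, Nat.sub_add_cancel this⟩
      have h2 : ∀ m, ‖if n < N ∧ M ≤ m + M then cof (m + M) n else 0‖ₑ =
          ENNReal.ofReal (kap (m + (M - 1 + n)) - kap (m + 1 + (M - 1 + n))) := by
        intro m
        rw [if_pos ⟨Finset.mem_range.1 hn, by omega⟩]
        obtain ⟨M', rfl⟩ := Nat.exists_eq_add_of_le' hM
        have h3 := kap_antitone (by omega : m + M' + n ≤ m + M' + 1 + n)
        rw [← add_assoc, cof, ← ofReal_norm, Real.norm_eq_abs, abs_of_nonpos (by linarith)]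
        congr 1
        rw [neg_sub, Nat.add_sub_cancel]
        congr 2 <;> omega
      rw [h1]
      simp_rw [h2]
      rw [tsum_ofReal_sub_succ (kap_antitone_add _) (kap_tendsto_add _)]
      exact ENNReal.ofReal_le_ofReal (kap_antitone (by omega))
    refine (Finset.sum_le_sum h).trans_eq ?_
    rw [Finset.sum_const, Finset.card_range, nsmul_eq_mul, ENNReal.ofReal_mul (by positivity),
      ENNReal.ofReal_natCast]
  · intro n hn
    rw [Finset.mem_range] at hn
    simp [hn]

variable {q : ℕ} (S : FlowTree q)

theorem sum_tsum_enorm_le (hq : 0 < q) (d : ℕ × ℕ → ℝ) (z : S.V) (F : Finset S.V) :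
    ∑ x ∈ F, ∑' mn : ℕ × ℕ, ‖d mn * (S.E mn.1 mn.2 x z * ((q : ℝ) ^ mn.1)⁻¹)‖ₑ
      ≤ ∑' mn, ‖d mn‖ₑ := by
  rw [← Summable.tsum_finsetSum fun _ _ => ENNReal.summable]
  refine ENNReal.tsum_le_tsum fun mn => ?_
  simp_rw [enorm_mul (d mn)]
  rw [← Finset.mul_sum]
  refine mul_le_of_le_one_right' ?_
  have hnn : ∀ x, 0 ≤ S.E mn.1 mn.2 x z * ((q : ℝ) ^ mn.1)⁻¹ := fun x =>
    mul_nonneg (S.E_nonneg _ _ _ _) (by positivity)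
  simp_rw [← ofReal_norm, Real.norm_eq_abs, abs_of_nonneg (hnn _)]
  rw [← ENNReal.ofReal_sum_of_nonneg fun x _ => hnn x, ← Finset.sum_mul]
  apply ENNReal.ofReal_le_one.2
  have h := S.sum_E_left_le mn.1 mn.2 z F
  have : (0 : ℝ) < (q : ℝ) ^ mn.1 := by positivity
  calc _ ≤ (q : ℝ) ^ mn.1 * ((q : ℝ) ^ mn.1)⁻¹ := by gcongr
    _ = 1 := mul_inv_cancel₀ this.ne'

theorem rk_weighted_hasSum (hq : 2 ≤ q) (x y : S.V) :
    HasSum (fun mn : ℕ × ℕ => cof mn.1 mn.2 * (S.E mn.1 mn.2 x y * ((q : ℝ) ^ mn.1)⁻¹))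
      (S.rk x y / S.wR y * S.wR x) := by
  have hw := (S.wR_pos (by omega) y).ne'
  have h := (S.rk_hasSum hq x y).mul_right (S.wR x / S.wR y)
  rw [show S.rk x y / S.wR y * S.wR x = S.rk x y * (S.wR x / S.wR y) by ring]
  refine h.congr_fun fun mn => ?_
  have := S.E_weight (by omega) mn.1 mn.2 x y
  field_simp at this ⊢
  linear_combination (-cof mn.1 mn.2) * this

theorem E_add_right (m N k : ℕ) {x y z : S.V} (hy : S.pred^[N] y = z) :
    S.E m (N + k) x y = S.E m k x z := by
  unfold E
  rw [add_comm N k, iterate_add_apply, hy]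

theorem rk_split_hasSum (hq : 2 ≤ q) {x y z : S.V} {N : ℕ} (hy : S.pred^[N] y = z) :
    ∃ A B : ℝ, S.rk x y / S.wR y * S.wR x = A + B ∧
      HasSum (fun mn : ℕ × ℕ => if mn.2 < N then
        cof mn.1 mn.2 * (S.E mn.1 mn.2 x y * ((q : ℝ) ^ mn.1)⁻¹) else 0) A ∧
      HasSum (fun mk : ℕ × ℕ => cof mk.1 (N + mk.2) *
        (S.E mk.1 mk.2 x z * ((q : ℝ) ^ mk.1)⁻¹)) B := by
  have h := S.rk_weighted_hasSum hq x y
  set f := fun mn : ℕ × ℕ => cof mn.1 mn.2 * (S.E mn.1 mn.2 x y * ((q : ℝ) ^ mn.1)⁻¹) with hf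
  have hA := (h.summable.indicator {mn | mn.2 < N}).hasSum
  have hB := h.sub hA
  have hinj : Injective fun mk : ℕ × ℕ => (mk.1, N + mk.2) := by
    rintro ⟨a, b⟩ ⟨a', b'⟩ h
    simpa using h
  refine ⟨_, _, (add_sub_cancel _ _).symm, hA.congr_fun fun mn => ?_, ?_⟩
  · simp [indicator, hf]
  · rw [← hinj.hasSum_iff] at hB
    · refine hB.congr_fun fun mk => ?_
      simp [indicator, hf, S.E_add_right _ _ _ hy]
    · rintro ⟨m, n⟩ hmn
      have : n < N := by
        by_contra hn
        exact hmn ⟨(m, n - N), by simp; omega⟩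
      simp [indicator, this]

theorem hormander_block_enorm (hq : 2 ≤ q) {y y' z : S.V} {h N s : ℕ}
    (hhN : h < N) (hN' : N + s ≤ 4 * h) (hs : s ≤ h) (hy : S.pred^[N] y = z)
    (hy' : S.pred^[N + s] y' = z) {F : Finset S.V}
    (hF : ∀ x ∈ F, ∀ k < 8 * h, S.pred^[k] x ≠ z) :
    ∑ x ∈ F, ‖S.rk x y / S.wR y * S.wR x - S.rk x y' / S.wR y' * S.wR x‖ₑ ≤ ENNReal.ofReal 8 := by
  have hh : 1 ≤ h := by omega
  have near : ∀ {u : S.V} {L : ℕ}, L ≤ 4 * h → S.pred^[L] u = z → ∀ x ∈ F, ∀ A : ℝ,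
      HasSum (fun mn : ℕ × ℕ => if mn.2 < L then
        cof mn.1 mn.2 * (S.E mn.1 mn.2 x u * ((q : ℝ) ^ mn.1)⁻¹) else 0) A →
      ‖A‖ₑ ≤ ∑' mn : ℕ × ℕ, ‖(if mn.2 < L ∧ 4 * h ≤ mn.1 then cof mn.1 mn.2 else 0) *
        (S.E mn.1 mn.2 x u * ((q : ℝ) ^ mn.1)⁻¹)‖ₑ := by
    intro u L hL hu x hx A hA
    have hA' : HasSum (fun mn : ℕ × ℕ => (if mn.2 < L ∧ 4 * h ≤ mn.1 then cof mn.1 mn.2 else 0) *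
        (S.E mn.1 mn.2 x u * ((q : ℝ) ^ mn.1)⁻¹)) A := by
      refine hA.congr_fun fun mn => ?_
      by_cases h1 : mn.2 < L
      · by_cases h2 : 4 * h ≤ mn.1
        · simp [h1, h2]
        · have : S.E mn.1 mn.2 x u = 0 := by
            unfold E
            refine if_neg fun he => ?_
            refine hF x hx (L - mn.2 + mn.1) (by omega) ?_
            rw [iterate_add_apply, he, ← iterate_add_apply, Nat.sub_add_cancel h1.le, hu]
          simp [this]
      · simp [h1]
    rw [← hA'.tsum_eq]
    exact enorm_tsum_le_tsum_enorm
  have nearSum : ∀ {u : S.V} {L : ℕ}, L ≤ 4 * h → ∑ x ∈ F, ∑' mn : ℕ × ℕ,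
      ‖(if mn.2 < L ∧ 4 * h ≤ mn.1 then cof mn.1 mn.2 else 0) *
        (S.E mn.1 mn.2 x u * ((q : ℝ) ^ mn.1)⁻¹)‖ₑ ≤ ENNReal.ofReal 2 := by
    intro u L hL
    refine (S.sum_tsum_enorm_le (by omega) _ u F).trans ((tsum_enorm_cof_tail (by omega)).trans
      (ENNReal.ofReal_le_ofReal ?_))
    have h1 := kap_le (4 * h - 1)
    rw [← Nat.cast_succ, Nat.succ_eq_add_one, Nat.sub_add_cancel (by omega)] at h1
    have h2 : (L : ℝ) ≤ (4 * h : ℕ) := by exact_mod_cast hL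
    have h3 : (0 : ℝ) < (4 * h : ℕ) := by exact_mod_cast (by omega : 0 < 4 * h)
    calc (L : ℝ) * kap (4 * h - 1) ≤ (4 * h : ℕ) * (2 / (4 * h : ℕ)) :=
          mul_le_mul h2 h1 (kap_pos _).le h3.le
      _ = 2 := by field_simp
  have farSum : ∑ x ∈ F, ∑' mk : ℕ × ℕ, ‖(cof mk.1 (N + mk.2) - cof mk.1 (N + s + mk.2)) *
      (S.E mk.1 mk.2 x z * ((q : ℝ) ^ mk.1)⁻¹)‖ₑ ≤ ENNReal.ofReal 4 := by
    refine (S.sum_tsum_enorm_le (by omega) _ z F).trans ((tsum_enorm_cof_shift N s).trans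
      (ENNReal.ofReal_le_ofReal ?_))
    have h1 := kap_le N
    have h2 : (s : ℝ) ≤ (N : ℝ) + 1 := by exact_mod_cast (by omega : s ≤ N + 1)
    have h3 : (0 : ℝ) < (N : ℝ) + 1 := by positivity
    calc 2 * ((s : ℝ) * kap N) ≤ 2 * (((N : ℝ) + 1) * (2 / ((N : ℝ) + 1))) := by
          gcongr
          exact (kap_pos _).le
      _ = 4 := by field_simp; norm_num
  have pointwise : ∀ x ∈ F, ‖S.rk x y / S.wR y * S.wR x - S.rk x y' / S.wR y' * S.wR x‖ₑ ≤
      ∑' mn : ℕ × ℕ, ‖(if mn.2 < N ∧ 4 * h ≤ mn.1 then cof mn.1 mn.2 else 0) *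
        (S.E mn.1 mn.2 x y * ((q : ℝ) ^ mn.1)⁻¹)‖ₑ +
      ∑' mn : ℕ × ℕ, ‖(if mn.2 < N + s ∧ 4 * h ≤ mn.1 then cof mn.1 mn.2 else 0) *
        (S.E mn.1 mn.2 x y' * ((q : ℝ) ^ mn.1)⁻¹)‖ₑ +
      ∑' mk : ℕ × ℕ, ‖(cof mk.1 (N + mk.2) - cof mk.1 (N + s + mk.2)) *
        (S.E mk.1 mk.2 x z * ((q : ℝ) ^ mk.1)⁻¹)‖ₑ := by
    intro x hx
    obtain ⟨A, B, e, hA, hB⟩ := S.rk_split_hasSum hq (x := x) hy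
    obtain ⟨A', B', e', hA', hB'⟩ := S.rk_split_hasSum hq (x := x) hy'
    have h1 := near (by omega) hy x hx A hA
    have h2 := near (by omega) hy' x hx A' hA'
    have h3 : ‖B - B'‖ₑ ≤ ∑' mk : ℕ × ℕ, ‖(cof mk.1 (N + mk.2) - cof mk.1 (N + s + mk.2)) *
        (S.E mk.1 mk.2 x z * ((q : ℝ) ^ mk.1)⁻¹)‖ₑ := by
      rw [← (hB.sub hB').tsum_eq]
      simp_rw [← sub_mul]
      exact enorm_tsum_le_tsum_enorm
    rw [e, e', show A + B - (A' + B') = A - A' + (B - B') by ring]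
    exact (enorm_add_le _ _).trans (add_le_add (enorm_sub_le.trans (add_le_add h1 h2)) h3)
  refine (Finset.sum_le_sum pointwise).trans ?_
  rw [Finset.sum_add_distrib, Finset.sum_add_distrib, show (8 : ℝ) = 2 + 2 + 4 by norm_num,
    ENNReal.ofReal_add (by norm_num) (by norm_num), ENNReal.ofReal_add (by norm_num) (by norm_num)]
  exact add_le_add (add_le_add (nearSum (by omega)) (nearSum (by omega))) farSum

theorem hormander_block (hq : 2 ≤ q) {y y' z : S.V} {h N N' : ℕ}
    (hN : h < N ∧ N ≤ 4 * h) (hN' : h < N' ∧ N' ≤ 4 * h) (hNN : N' ≤ N + h) (hNN' : N ≤ N' + h)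
    (hy : S.pred^[N] y = z) (hy' : S.pred^[N'] y' = z) {F : Finset S.V}
    (hF : ∀ x ∈ F, ∀ k < 8 * h, S.pred^[k] x ≠ z) :
    ∑ x ∈ F, |S.rk x y / S.wR y - S.rk x y' / S.wR y'| * S.wR x ≤ 8 := by
  have key : ∑ x ∈ F, ‖S.rk x y / S.wR y * S.wR x - S.rk x y' / S.wR y' * S.wR x‖ₑ
      ≤ ENNReal.ofReal 8 := by
    rcases le_total N N' with hle | hle
    · obtain ⟨s, rfl⟩ := Nat.exists_eq_add_of_le hle
      exact S.hormander_block_enorm hq hN.1 hN'.2 (by omega) hy hy' hF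
    · obtain ⟨s, rfl⟩ := Nat.exists_eq_add_of_le hle
      have := S.hormander_block_enorm hq hN'.1 hN.2 (by omega) hy' hy hF
      simp_rw [enorm_sub_rev] at this ⊢
      refine le_trans (Finset.sum_le_sum fun x _ => ?_) this
      rw [enorm_sub_rev]
  simp_rw [← sub_mul, ← ofReal_norm, norm_mul, Real.norm_eq_abs,
    abs_of_pos (S.wR_pos (by omega : 0 < q) _)] at key
  rw [← ENNReal.ofReal_sum_of_nonneg fun x _ => mul_nonneg (abs_nonneg _)
    (S.wR_pos (by omega : 0 < q) _).le] at key
  exact (ENNReal.ofReal_le_ofReal_iff (by norm_num)).1 key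

theorem rk_hormander (hq : 2 ≤ q) : (S.cubes hq).Hormander S.rk 8 8 := by
  have hq0 : 0 < q := by omega
  intro t x₀
  rcases S.cube_eq_singleton_or_block t x₀ with hc | ⟨z, h, N₀, hh, hN1, hN2, hc⟩
  · refine ⟨∅, ?_, ?_⟩
    · rw [Finset.sum_empty]
      exact mul_nonneg (by norm_num) ((S.cubes hq).mass_pos t x₀).le
    · intro y hy y' hy' F _
      have h1 : y = x₀ := by
        have : y ∈ S.cube t x₀ := hy
        simpa [hc] using this
      have h2 : y' = x₀ := by
        have : y' ∈ S.cube t x₀ := hy'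
        simpa [hc] using this
      simp [h1, h2]
  · refine ⟨(Finset.range (8 * h)).biUnion (S.desc z), ?_, ?_⟩
    · change ∑ x ∈ _, S.wR x ≤ 8 * ∑ x ∈ S.cube t x₀, S.wR x
      rw [hc, S.sum_biUnion_desc hq0, S.sum_block hq0 z (by omega), Finset.card_range]
      push_cast
      linarith
    · intro y hy y' hy' F hF
      have h1 : y ∈ S.cube t x₀ := hy
      have h2 : y' ∈ S.cube t x₀ := hy'
      rw [hc, mem_block] at h1 h2
      obtain ⟨N, hN, hyN⟩ := h1
      obtain ⟨N', hN', hyN'⟩ := h2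
      refine S.hormander_block hq (h := h) (by omega) (by omega) (by omega) (by omega) hyN hyN'
        fun x hx k hk hkz => ?_
      refine Finset.disjoint_left.1 hF hx ?_
      simp only [Finset.mem_biUnion, Finset.mem_range, mem_desc]
      exact ⟨k, hk, hkz⟩

theorem rk_strong_type (hq : 2 ≤ q) {p : ℝ} (hp1 : 1 < p) (hp2 : p < 2) :
    ∃ C : ℝ, ∀ (F A : Finset S.V) (f : S.V → ℝ), ∑ x ∈ F, |∑ y ∈ A, S.rk x y * f y| ^ p * S.wR x ≤
      C * ∑ x ∈ A, |f x| ^ p * S.wR x :=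
  (S.cubes hq).strong_type (by norm_num : (0 : ℝ) ≤ 4) (by norm_num) (by norm_num)
    (S.rk_l2 hq) (S.rk_hormander hq) hp1 hp2

end FlowTree

theorem summable_of_tsum_enorm_ne_top {ι : Type*} {f : ι → ℝ} (h : ∑' i, ‖f i‖ₑ ≠ ∞) :
    Summable f := by
  refine Summable.of_norm ?_
  have := ENNReal.summable_toReal h
  simpa using this

namespace FlowTree
open ZRiesz

/-- The coefficients of the kernel `ρ` obtained by restricting `rk` to radial functions. -/
noncomputable def radCof (k l : ℕ) (mn : ℕ × ℕ) : ℝ :=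
  if l + mn.2 = k + mn.1 then cof mn.1 mn.2 else 0

theorem summable_radCof (k l : ℕ) : Summable (radCof k l) := by
  apply summable_of_tsum_enorm_ne_top
  rw [ENNReal.tsum_prod (f := fun m n => ‖radCof k l (m, n)‖ₑ)]
  have h1 : ∀ m, ∑' n, ‖radCof k l (m, n)‖ₑ ≤ ‖cof m (k + m - l)‖ₑ := by
    intro m
    rw [tsum_eq_single (k + m - l)]
    · unfold radCof
      split_ifs
      · rfl
      · simp
    · intro n hn
      unfold radCof
      rw [if_neg (by simp only; omega), enorm_zero]
  have h2 : ∀ m, ‖cof (m + 1) (k + (m + 1) - l)‖ₑ ≤ ENNReal.ofReal (kap m - kap (m + 1)) := by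
    intro m
    set n := k + (m + 1) - l
    have h3 := kap_diff_antitone (Nat.le_add_right m n)
    simp only at h3
    have h4 := kap_antitone (Nat.le_succ (m + n))
    rw [cof, ← ofReal_norm, Real.norm_eq_abs]
    refine ENNReal.ofReal_le_ofReal ?_
    rw [show m + 1 + n = m + n + 1 by omega, abs_of_nonpos (sub_nonpos.2 h4)]
    linarith
  refine ne_top_of_le_ne_top ?_ (ENNReal.tsum_le_tsum h1)
  rw [tsum_eq_zero_add' ENNReal.summable]
  refine ENNReal.add_ne_top.2 ⟨enorm_ne_top, ne_top_of_le_ne_top ?_ (ENNReal.tsum_le_tsum h2)⟩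
  rw [tsum_ofReal_sub_succ kap_antitone kap_tendsto]
  exact ENNReal.ofReal_ne_top

/-- The kernel on `ℤ` induced by `rk` on radial functions. -/
noncomputable def rho (k l : ℕ) : ℝ := ∑' mn, radCof k l mn

theorem rho_congr {k l k' l' : ℕ} (h : k + l' = k' + l) : rho k l = rho k' l' := by
  refine tsum_congr fun mn => ?_
  unfold radCof
  congr 1
  exact propext ⟨fun _ => by omega, fun _ => by omega⟩

theorem cof_symm_succ (m n : ℕ) : cof (m + 1) (n + 1) = cof (n + 1) (m + 1) := by
  rw [cof, cof]
  congr 2 <;> omega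

theorem radCof_sub_eq_zero {k l : ℕ} {mn : ℕ × ℕ} (h : mn ≠ (l - k, k - l)) :
    radCof k l mn - radCof l k mn.swap = 0 := by
  obtain ⟨m, n⟩ := mn
  unfold radCof
  by_cases h1 : l + n = k + m
  · rcases m with _ | m
    · exact absurd (by ext <;> simp only <;> omega) h
    rcases n with _ | n
    · exact absurd (by ext <;> simp only <;> omega) h
    simp [h1, cof_symm_succ]
  · simp [h1, Ne.symm h1]

theorem rho_sub_rho (k l : ℕ) :
    rho k l - rho l k = cof (l - k) (k - l) - cof (k - l) (l - k) := by
  have h := (summable_radCof k l).hasSum.sub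
    ((Equiv.prodComm ℕ ℕ).hasSum_iff.2 (summable_radCof l k).hasSum)
  have h2 := hasSum_single (f := fun mn => radCof k l mn - radCof l k mn.swap) (l - k, k - l)
    fun mn hmn => radCof_sub_eq_zero hmn
  refine (h.unique h2).trans ?_
  simp only [radCof, Prod.swap]
  rw [if_pos (by omega), if_pos (by omega)]

variable {q : ℕ} (S : FlowTree q)

theorem sum_layer_E (hq : 0 < q) {k l T : ℕ} (hk : k ≤ T) (hl : l ≤ T) {x z : S.V}
    (hx : x ∈ S.desc z (T - k)) (m n : ℕ) :
    ∑ y ∈ S.desc z (T - l), S.E m n x y * ((q : ℝ) ^ n)⁻¹ =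
      if l + n = k + m then (if m + k ≤ T then 1 else (q : ℝ) ^ (T - l) * ((q : ℝ) ^ n)⁻¹)
      else 0 := by
  have hq' : (q : ℝ) ≠ 0 := by exact_mod_cast hq.ne'
  have hxz := S.mem_desc.1 hx
  rw [← Finset.sum_mul]
  split_ifs with h1 h2
  · have : S.desc (S.pred^[m] x) n ⊆ S.desc z (T - l) := by
      intro y hy
      rw [mem_desc] at hy ⊢
      rw [show T - l = (T - k - m) + n by omega, iterate_add_apply, hy, ← iterate_add_apply,
        Nat.sub_add_cancel (by omega), hxz]
    rw [← Finset.sum_subset this fun y _ hy => ?_]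
    · have h3 : ∀ y ∈ S.desc (S.pred^[m] x) n, S.E m n x y = 1 := fun y hy =>
        if_pos (S.mem_desc.1 hy).symm
      rw [Finset.sum_congr rfl h3, Finset.sum_const, card_desc, nsmul_eq_mul]
      push_cast
      field_simp
    · exact if_neg fun h => hy (S.mem_desc.2 h.symm)
  · have h3 : ∀ y ∈ S.desc z (T - l), S.E m n x y = 1 := fun y hy => by
      rw [mem_desc] at hy
      refine if_pos ?_
      rw [show m = (m - (T - k)) + (T - k) by omega, iterate_add_apply, hxz,
        show n = (m - (T - k)) + (T - l) by omega, iterate_add_apply, hy]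
    rw [Finset.sum_congr rfl h3, Finset.sum_const, card_desc, nsmul_eq_mul]
    push_cast
    ring
  · refine mul_eq_zero_of_left (Finset.sum_eq_zero fun y hy => ?_) _
    by_contra h
    have h2 := S.level_of_E_ne h
    rw [S.level_of_mem_desc hx, S.level_of_mem_desc hy] at h2
    omega

/-- The average of `rk` over truncated radial layers. -/
noncomputable def truncRho (q T k l : ℕ) : ℝ := ∑' mn : ℕ × ℕ,
  radCof k l mn * (if mn.1 + k ≤ T then 1 else (q : ℝ) ^ (T - l) * ((q : ℝ) ^ mn.2)⁻¹)

theorem sum_desc_rk (hq : 2 ≤ q) {k l T : ℕ} (hk : k ≤ T) (hl : l ≤ T) {x z : S.V}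
    (hx : x ∈ S.desc z (T - k)) : ∑ y ∈ S.desc z (T - l), S.rk x y = truncRho q T k l := by
  have h := hasSum_sum fun y (_ : y ∈ S.desc z (T - l)) => S.rk_hasSum hq x y
  rw [← h.tsum_eq]
  refine tsum_congr fun mn => ?_
  rw [← Finset.mul_sum, S.sum_layer_E (by omega) hk hl hx, radCof]
  split_ifs <;> simp

theorem truncRho_tendsto (hq : 0 < q) (k l : ℕ) :
    Filter.Tendsto (fun T => truncRho q T k l) Filter.atTop (nhds (rho k l)) := by
  have hq1 : (1 : ℝ) ≤ q := by exact_mod_cast hq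
  refine tendsto_tsum_of_dominated_convergence (summable_radCof k l).norm (fun mn => ?_) ?_
  · refine tendsto_const_nhds.congr' ?_
    filter_upwards [Filter.eventually_ge_atTop (mn.1 + k)] with T hT
    rw [if_pos hT, mul_one]
  · filter_upwards [Filter.eventually_ge_atTop l] with T hT mn
    rw [norm_mul]
    by_cases h : l + mn.2 = k + mn.1
    · refine mul_le_of_le_one_right (norm_nonneg _) ?_
      split_ifs with h1
      · simp
      · rw [Real.norm_eq_abs, abs_of_nonneg (by positivity), ← div_eq_mul_inv,
          div_le_one (by positivity)]
        exact pow_le_pow_right₀ hq1 (by omega)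
    · simp [radCof, h]

/-- The `J` consecutive layers of descendants of `z` starting `T` levels below. -/
noncomputable def layers (z : S.V) (T J : ℕ) : Finset S.V :=
  (Finset.range J).biUnion fun k => S.desc z (T - k)

theorem sum_layers (z : S.V) {T J : ℕ} (hJ : J ≤ T + 1) (h : S.V → ℝ) :
    ∑ x ∈ S.layers z T J, h x = ∑ k ∈ Finset.range J, ∑ x ∈ S.desc z (T - k), h x := by
  rw [layers, Finset.sum_biUnion]
  intro k hk k' hk' hkk'
  rw [Function.onFun, Finset.disjoint_left]
  intro y hy hy'
  have h1 := S.level_of_mem_desc hy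
  have h2 := S.level_of_mem_desc hy'
  rw [Finset.mem_coe, Finset.mem_range] at hk hk'
  omega

theorem truncRho_strong_type (hq : 2 ≤ q) (z : S.V) {p C : ℝ}
    (hC : ∀ (F A : Finset S.V) (f : S.V → ℝ), ∑ x ∈ F, |∑ y ∈ A, S.rk x y * f y| ^ p * S.wR x ≤
      C * ∑ x ∈ A, |f x| ^ p * S.wR x) {J T : ℕ} (hT : J ≤ T) (F : ℕ → ℝ) :
    ∑ k ∈ Finset.range J, |∑ l ∈ Finset.range J, truncRho q T k l * F l| ^ p ≤
      C * ∑ l ∈ Finset.range J, |F l| ^ p := by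
  have hz := S.wR_pos (by omega : 0 < q) z
  set f : S.V → ℝ := fun y => F (S.level y - S.level z + T).toNat
  have hf : ∀ l < J, ∀ y ∈ S.desc z (T - l), f y = F l := by
    intro l hl y hy
    simp only [f]
    rw [S.level_of_mem_desc hy]
    congr
    omega
  have h := hC (S.layers z T J) (S.layers z T J) f
  simp_rw [S.sum_layers z (by omega : J ≤ T + 1)] at h
  have hR : ∀ l ∈ Finset.range J, ∑ y ∈ S.desc z (T - l), |f y| ^ p * S.wR y =
      |F l| ^ p * S.wR z := by
    intro l hl
    rw [← S.sum_desc_wR (by omega) z (T - l), Finset.mul_sum]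
    exact Finset.sum_congr rfl fun y hy => by rw [hf l (Finset.mem_range.1 hl) y hy]
  have hL : ∀ k ∈ Finset.range J, ∑ x ∈ S.desc z (T - k),
      |∑ l ∈ Finset.range J, ∑ y ∈ S.desc z (T - l), S.rk x y * f y| ^ p * S.wR x =
      |∑ l ∈ Finset.range J, truncRho q T k l * F l| ^ p * S.wR z := by
    intro k hk
    rw [← S.sum_desc_wR (by omega) z (T - k), Finset.mul_sum]
    refine Finset.sum_congr rfl fun x hx => ?_
    congr 3
    refine Finset.sum_congr rfl fun l hl => ?_
    rw [Finset.mem_range] at hl hk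
    rw [← S.sum_desc_rk hq (by omega) (by omega) hx, Finset.sum_mul]
    exact Finset.sum_congr rfl fun y hy => by rw [hf l hl y hy]
  rw [Finset.sum_congr rfl hL, Finset.sum_congr rfl hR, ← Finset.sum_mul, ← Finset.sum_mul,
    ← mul_assoc] at h
  exact le_of_mul_le_mul_right h hz

theorem rho_strong_type (hq : 2 ≤ q) (z : S.V) {p C : ℝ} (hp : 0 ≤ p)
    (hC : ∀ (F A : Finset S.V) (f : S.V → ℝ), ∑ x ∈ F, |∑ y ∈ A, S.rk x y * f y| ^ p * S.wR x ≤
      C * ∑ x ∈ A, |f x| ^ p * S.wR x) (J : ℕ) (F : ℕ → ℝ) :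
    ∑ k ∈ Finset.range J, |∑ l ∈ Finset.range J, rho k l * F l| ^ p ≤
      C * ∑ l ∈ Finset.range J, |F l| ^ p := by
  have h : Filter.Tendsto (fun T => ∑ k ∈ Finset.range J,
      |∑ l ∈ Finset.range J, truncRho q T k l * F l| ^ p) Filter.atTop
      (nhds (∑ k ∈ Finset.range J, |∑ l ∈ Finset.range J, rho k l * F l| ^ p)) :=
    tendsto_finsetSum _ fun k _ => ((tendsto_finsetSum _ fun l _ =>
      (truncRho_tendsto (by omega) k l).mul_const _).abs).rpow_const (Or.inr hp)
  refine le_of_tendsto h ?_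
  filter_upwards [Filter.eventually_ge_atTop J] with T hT
  exact S.truncRho_strong_type hq z hC hT F

theorem rho_flip_strong_type {p C : ℝ} {J : ℕ}
    (hC : ∀ F : ℕ → ℝ, ∑ k ∈ Finset.range J, |∑ l ∈ Finset.range J, rho k l * F l| ^ p ≤
      C * ∑ l ∈ Finset.range J, |F l| ^ p) (F : ℕ → ℝ) :
    ∑ k ∈ Finset.range J, |∑ l ∈ Finset.range J, rho l k * F l| ^ p ≤
      C * ∑ l ∈ Finset.range J, |F l| ^ p := by
  have h := hC fun l => F (J - 1 - l)
  rw [Finset.sum_range_reflect fun l => |F l| ^ p] at h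
  refine le_of_eq_of_le ?_ h
  rw [← Finset.sum_range_reflect]
  refine Finset.sum_congr rfl fun k hk => ?_
  rw [← Finset.sum_range_reflect]
  congr 2
  refine Finset.sum_congr rfl fun l hl => ?_
  rw [Finset.mem_range] at hk hl
  rw [rho_congr (k' := k) (l' := l) (by omega)]

theorem abs_sub_rpow_le {p : ℝ} (hp : 0 ≤ p) (a b : ℝ) :
    |a - b| ^ p ≤ 2 ^ p * (|a| ^ p + |b| ^ p) := by
  have h : |a - b| ≤ 2 * max |a| |b| := by
    have := abs_sub a b
    have := le_max_left |a| |b|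
    have := le_max_right |a| |b|
    linarith
  calc |a - b| ^ p ≤ (2 * max |a| |b|) ^ p := Real.rpow_le_rpow (abs_nonneg _) h hp
    _ = 2 ^ p * max |a| |b| ^ p := Real.mul_rpow (by norm_num) (by positivity)
    _ ≤ 2 ^ p * (|a| ^ p + |b| ^ p) := by
      gcongr
      have h1 : 0 ≤ |a| ^ p := by positivity
      have h2 : 0 ≤ |b| ^ p := by positivity
      rcases max_choice |a| |b| with h | h <;> rw [h] <;> linarith

theorem sum_abs_sub_rpow_le {ι : Type*} {p : ℝ} (hp : 0 ≤ p) (s : Finset ι) (a b w : ι → ℝ)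
    (hw : ∀ i ∈ s, 0 ≤ w i) : ∑ i ∈ s, |a i - b i| ^ p * w i ≤
      2 ^ p * (∑ i ∈ s, |a i| ^ p * w i + ∑ i ∈ s, |b i| ^ p * w i) := by
  rw [← Finset.sum_add_distrib, Finset.mul_sum]
  refine Finset.sum_le_sum fun i hi => ?_
  rw [← add_mul, ← mul_assoc]
  exact mul_le_mul_of_nonneg_right (abs_sub_rpow_le hp _ _) (hw i hi)

/-- The truncated discrete Hilbert transform `ρ - ρᵀ` is bounded on `ℓ^p`. -/
theorem rho_sub_strong_type {p C : ℝ} (hp : 0 ≤ p) {J : ℕ}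
    (hC : ∀ F : ℕ → ℝ, ∑ k ∈ Finset.range J, |∑ l ∈ Finset.range J, rho k l * F l| ^ p ≤
      C * ∑ l ∈ Finset.range J, |F l| ^ p) (F : ℕ → ℝ) :
    ∑ k ∈ Finset.range J, |∑ l ∈ Finset.range J, (rho k l - rho l k) * F l| ^ p ≤
      2 ^ p * (2 * C) * ∑ l ∈ Finset.range J, |F l| ^ p := by
  have h := sum_abs_sub_rpow_le hp (Finset.range J) (fun k => ∑ l ∈ Finset.range J, rho k l * F l)
    (fun k => ∑ l ∈ Finset.range J, rho l k * F l) (fun _ => 1) fun _ _ => zero_le_one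
  simp_rw [mul_one, ← Finset.sum_sub_distrib, ← sub_mul] at h
  refine h.trans ?_
  rw [mul_assoc, two_mul, add_mul]
  gcongr
  · exact hC F
  · exact rho_flip_strong_type hC F

end FlowTree

namespace FlowTree
open ZRiesz

variable {q : ℕ} (S : FlowTree q)

/-- The adjoint kernel of `rk` on `L²(wR)`. -/
noncomputable def rkAdj (x y : S.V) : ℝ := S.rk y x * S.wR y / S.wR x

theorem rkAdj_hasSum (hq : 2 ≤ q) (x y : S.V) :
    HasSum (fun mn : ℕ × ℕ => cof mn.2 mn.1 * (S.E mn.1 mn.2 x y * ((q : ℝ) ^ mn.2)⁻¹))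
      (S.rkAdj x y) := by
  have hw := (S.wR_pos (by omega) x).ne'
  have h := (Equiv.prodComm ℕ ℕ).hasSum_iff.2 ((S.rk_hasSum hq y x).mul_right (S.wR y / S.wR x))
  rw [rkAdj, mul_div_assoc]
  refine h.congr_fun fun mn => ?_
  have := S.E_weight (by omega) mn.1 mn.2 x y
  simp only [comp_apply, Equiv.prodComm_apply, Prod.swap]
  rw [S.E_symm mn.2 mn.1]
  field_simp at this ⊢
  linear_combination (cof mn.2 mn.1) * this

theorem rk_sub_rkAdj (hq : 2 ≤ q) {k l : ℕ} {x y : S.V}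
    (h : S.level x + l = S.level y + k) :
    S.rk x y - S.rkAdj x y =
      (rho k l - rho l k) * (S.E (l - k) (k - l) x y * ((q : ℝ) ^ (k - l))⁻¹) := by
  have h1 := (S.rk_hasSum hq x y).sub (S.rkAdj_hasSum hq x y)
  rw [rho_sub_rho]
  refine h1.unique ((hasSum_single (l - k, k - l) ?_).congr_fun fun mn => (sub_mul _ _ _).symm) |>.trans ?_
  · rintro ⟨m, n⟩ hmn
    by_cases hE : S.E m n x y = 0
    · simp [hE]
    have h2 := S.level_of_E_ne hE
    rcases m with _ | m
    · exact absurd (by ext <;> simp only <;> omega) hmn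
    rcases n with _ | n
    · exact absurd (by ext <;> simp only <;> omega) hmn
    simp [cof_symm_succ]
  · rfl

theorem sum_desc_ite_iterate (hq : 0 < q) (k l : ℕ) (x y : S.V) :
    ((q : ℝ) ^ k)⁻¹ * ∑ ω ∈ S.desc x k, (if S.pred^[l] ω = y then (1 : ℝ) else 0) =
      S.E (l - k) (k - l) x y * ((q : ℝ) ^ (k - l))⁻¹ := by
  have hq' : (q : ℝ) ≠ 0 := by exact_mod_cast hq.ne'
  unfold E
  rcases le_total k l with hkl | hkl
  · have h : ∀ ω ∈ S.desc x k, (if S.pred^[l] ω = y then (1 : ℝ) else 0) =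
        if S.pred^[l - k] x = y then 1 else 0 := by
      intro ω hω
      rw [← S.mem_desc.1 hω, ← iterate_add_apply, Nat.sub_add_cancel hkl]
    rw [Finset.sum_congr rfl h, Finset.sum_const, card_desc, nsmul_eq_mul, Nat.sub_eq_zero_of_le hkl]
    push_cast
    simp only [iterate_zero, id, pow_zero, inv_one, mul_one]
    rw [inv_mul_cancel_left₀ (by positivity)]
    congr
  · rw [Nat.sub_eq_zero_of_le hkl, iterate_zero, id, ← Finset.sum_filter, Finset.sum_const,
      nsmul_one]
    have h : (S.desc x k).filter (fun ω => S.pred^[l] ω = y) =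
        if x = S.pred^[k - l] y then S.desc y l else ∅ := by
      ext ω
      rw [Finset.mem_filter, mem_desc]
      split_ifs with h
      · rw [mem_desc]
        refine ⟨fun h => h.2, fun hω => ⟨?_, hω⟩⟩
        rw [h, ← hω, ← iterate_add_apply, Nat.sub_add_cancel hkl]
      · refine iff_of_false ?_ (Finset.notMem_empty _)
        rintro ⟨h1, h2⟩
        rw [← h1, ← h2, ← iterate_add_apply, Nat.sub_add_cancel hkl] at h
        exact h rfl
    rw [h]
    split_ifs
    · rw [card_desc, one_mul]
      have : (q : ℝ) ^ k = q ^ (k - l) * q ^ l := by rw [← pow_add, Nat.sub_add_cancel hkl]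
      push_cast
      rw [this]
      field_simp
    · simp

theorem sum_layers_rk_sub_rkAdj (hq : 2 ≤ q) {k T : ℕ} (hk : k ≤ T) {x z : S.V}
    (hx : x ∈ S.desc z (T - k)) (f : S.V → ℝ) :
    ∑ y ∈ S.layers z T (T + 1), (S.rk x y - S.rkAdj x y) * f y =
      ∑ ω ∈ S.desc x k, ((q : ℝ) ^ k)⁻¹ *
        ∑ l ∈ Finset.range (T + 1), (rho k l - rho l k) * f (S.pred^[l] ω) := by
  rw [S.sum_layers z le_rfl]
  simp_rw [Finset.mul_sum]
  rw [Finset.sum_comm]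
  refine Finset.sum_congr rfl fun l hl => ?_
  rw [Finset.mem_range] at hl
  have h1 : ∀ y ∈ S.desc z (T - l), (S.rk x y - S.rkAdj x y) * f y =
      ∑ ω ∈ S.desc x k, ((q : ℝ) ^ k)⁻¹ * ((rho k l - rho l k) *
        (if S.pred^[l] ω = y then f y else 0)) := by
    intro y hy
    have h2 := S.level_of_mem_desc hx
    have h3 := S.level_of_mem_desc hy
    rw [S.rk_sub_rkAdj hq (k := k) (l := l) (by omega), ← S.sum_desc_ite_iterate (by omega),
      Finset.mul_sum, Finset.mul_sum, Finset.sum_mul]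
    refine Finset.sum_congr rfl fun ω _ => ?_
    split_ifs <;> ring
  rw [Finset.sum_congr rfl h1, Finset.sum_comm]
  refine Finset.sum_congr rfl fun ω hω => ?_
  rw [← Finset.mul_sum, ← Finset.mul_sum, Finset.sum_ite_eq, if_pos]
  rw [mem_desc] at hω hx ⊢
  rw [← iterate_add_apply, Nat.sub_add_cancel (by omega), ← hx, ← hω, ← iterate_add_apply,
    Nat.sub_add_cancel hk]

theorem sum_desc_lift (hq : 0 < q) {k T : ℕ} (hk : k ≤ T) (z : S.V) (h : S.V → ℝ) :
    ∑ x ∈ S.desc z (T - k), (∑ ω ∈ S.desc x k, ((q : ℝ) ^ k)⁻¹ * h ω) * S.wR x =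
      ∑ ω ∈ S.desc z T, h ω * S.wR ω := by
  have hq' : (q : ℝ) ≠ 0 := by exact_mod_cast hq.ne'
  rw [← Finset.sum_fiberwise_of_maps_to (s := S.desc z T) (t := S.desc z (T - k))
    (g := S.pred^[k]) fun ω hω => by
      rw [mem_desc] at hω ⊢
      rw [← iterate_add_apply, Nat.sub_add_cancel hk, hω]]
  refine Finset.sum_congr rfl fun x hx => ?_
  have : (S.desc z T).filter (fun ω => S.pred^[k] ω = x) = S.desc x k := by
    ext ω
    rw [Finset.mem_filter, mem_desc, mem_desc]
    refine ⟨fun h => h.2, fun hω => ⟨?_, hω⟩⟩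
    rw [mem_desc] at hx
    rw [← hx, ← hω, ← iterate_add_apply, Nat.sub_add_cancel hk]
  rw [this, Finset.sum_mul]
  refine Finset.sum_congr rfl fun ω hω => ?_
  rw [S.wR_of_mem_desc hq hω]
  field_simp

theorem abs_sum_rpow_le {p : ℝ} (hp : 1 ≤ p) {ι : Type*} (s : Finset ι) {c : ℝ} (hc : 0 ≤ c)
    (hs : ∑ _i ∈ s, c = 1) (u : ι → ℝ) : |∑ i ∈ s, c * u i| ^ p ≤ ∑ i ∈ s, c * |u i| ^ p := by
  refine le_trans ?_ (Real.rpow_arith_mean_le_arith_mean_rpow s (fun _ => c) (fun i => |u i|)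
    (fun _ _ => hc) hs (fun _ _ => abs_nonneg _) hp)
  refine Real.rpow_le_rpow (abs_nonneg _) ?_ (by linarith)
  refine (Finset.abs_sum_le_sum_abs _ _).trans_eq (Finset.sum_congr rfl fun i _ => ?_)
  rw [abs_mul, abs_of_nonneg hc]

theorem rk_sub_rkAdj_layers (hq : 2 ≤ q) {p C : ℝ} (hp : 1 ≤ p) (z : S.V) (T : ℕ)
    (hC : ∀ F : ℕ → ℝ, ∑ k ∈ Finset.range (T + 1),
      |∑ l ∈ Finset.range (T + 1), (rho k l - rho l k) * F l| ^ p ≤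
      C * ∑ l ∈ Finset.range (T + 1), |F l| ^ p) (f : S.V → ℝ) :
    ∑ x ∈ S.layers z T (T + 1),
      |∑ y ∈ S.layers z T (T + 1), (S.rk x y - S.rkAdj x y) * f y| ^ p * S.wR x ≤
      C * ∑ x ∈ S.layers z T (T + 1), |f x| ^ p * S.wR x := by
  have hq0 : 0 < q := by omega
  have hq' : (q : ℝ) ≠ 0 := by exact_mod_cast hq0.ne'
  have hcard : ∀ (x : S.V) (k : ℕ), ∑ _ω ∈ S.desc x k, ((q : ℝ) ^ k)⁻¹ = 1 := by
    intro x k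
    rw [Finset.sum_const, card_desc, nsmul_eq_mul]
    push_cast
    field_simp
  set U : ℕ → S.V → ℝ := fun k ω =>
    ∑ l ∈ Finset.range (T + 1), (rho k l - rho l k) * f (S.pred^[l] ω)
  rw [S.sum_layers z le_rfl, S.sum_layers z le_rfl]
  calc _ ≤ ∑ k ∈ Finset.range (T + 1), ∑ ω ∈ S.desc z T, |U k ω| ^ p * S.wR ω := by
        refine Finset.sum_le_sum fun k hk => ?_
        rw [Finset.mem_range] at hk
        rw [← S.sum_desc_lift hq0 (by omega : k ≤ T)]
        refine Finset.sum_le_sum fun x hx => ?_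
        rw [S.sum_layers_rk_sub_rkAdj hq (by omega) hx]
        exact mul_le_mul_of_nonneg_right (abs_sum_rpow_le hp _ (by positivity) (hcard x k) _)
          (S.wR_pos hq0 x).le
    _ = ∑ ω ∈ S.desc z T, (∑ k ∈ Finset.range (T + 1), |U k ω| ^ p) * S.wR ω := by
        rw [Finset.sum_comm]
        simp_rw [Finset.sum_mul]
    _ ≤ ∑ ω ∈ S.desc z T, (C * ∑ l ∈ Finset.range (T + 1), |f (S.pred^[l] ω)| ^ p) * S.wR ω :=
        Finset.sum_le_sum fun ω _ => mul_le_mul_of_nonneg_right (hC _) (S.wR_pos hq0 ω).le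
    _ = C * ∑ l ∈ Finset.range (T + 1), ∑ ω ∈ S.desc z T, |f (S.pred^[l] ω)| ^ p * S.wR ω := by
        rw [Finset.sum_comm, Finset.mul_sum]
        refine Finset.sum_congr rfl fun ω _ => ?_
        rw [← Finset.sum_mul, mul_assoc]
    _ = _ := by
        congr 1
        refine Finset.sum_congr rfl fun l hl => ?_
        rw [Finset.mem_range] at hl
        rw [← S.sum_desc_lift hq0 (by omega : l ≤ T) z fun ω => |f (S.pred^[l] ω)| ^ p]
        refine Finset.sum_congr rfl fun x _ => ?_
        rw [Finset.sum_congr rfl fun ω hω => by rw [S.mem_desc.1 hω], ← Finset.sum_mul, hcard,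
          one_mul]

theorem exists_subset_layers (x₀ : S.V) (A : Finset S.V) :
    ∃ z T, A ⊆ S.layers z T (T + 1) := by
  induction A using Finset.induction_on with
  | empty => exact ⟨x₀, 0, Finset.empty_subset _⟩
  | insert a A _ ih =>
    obtain ⟨z, T, h⟩ := ih
    obtain ⟨n, m, hnm⟩ := S.exists_iterate_eq a z
    refine ⟨S.pred^[n] a, T + m + n, Finset.insert_subset ?_ fun y hy => ?_⟩
    · rw [layers, Finset.mem_biUnion]
      exact ⟨T + m, Finset.mem_range.2 (by omega), by
        rw [mem_desc, Nat.add_sub_cancel_left]⟩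
    · have := h hy
      rw [layers, Finset.mem_biUnion] at this ⊢
      obtain ⟨k, hk, hyk⟩ := this
      rw [Finset.mem_range] at hk
      refine ⟨k + n, Finset.mem_range.2 (by omega), ?_⟩
      rw [mem_desc] at hyk ⊢
      rw [show T + m + n - (k + n) = m + (T - k) by omega, iterate_add_apply, hyk, hnm]

theorem rk_sub_rkAdj_strong_type (hq : 2 ≤ q) {p C : ℝ} (hp : 1 ≤ p)
    (hC : ∀ (J : ℕ) (F : ℕ → ℝ), ∑ k ∈ Finset.range J,
      |∑ l ∈ Finset.range J, (rho k l - rho l k) * F l| ^ p ≤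
      C * ∑ l ∈ Finset.range J, |F l| ^ p) (x₀ : S.V) (F A : Finset S.V) (f : S.V → ℝ) :
    ∑ x ∈ F, |∑ y ∈ A, (S.rk x y - S.rkAdj x y) * f y| ^ p * S.wR x ≤
      C * ∑ x ∈ A, |f x| ^ p * S.wR x := by
  obtain ⟨z, T, hB⟩ := S.exists_subset_layers x₀ (F ∪ A)
  have h := S.rk_sub_rkAdj_layers hq hp z T (hC _) fun y => if y ∈ A then f y else 0
  have hF := Finset.union_subset_left hB
  have hA := Finset.union_subset_right hB
  have h1 : ∑ x ∈ S.layers z T (T + 1), |if x ∈ A then f x else 0| ^ p * S.wR x =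
      ∑ x ∈ A, |f x| ^ p * S.wR x := by
    rw [← Finset.sum_subset hA fun x _ hx => by
      rw [if_neg hx, abs_zero, Real.zero_rpow (by linarith), zero_mul]]
    exact Finset.sum_congr rfl fun x hx => by rw [if_pos hx]
  have h2 : ∀ x, ∑ y ∈ S.layers z T (T + 1),
      (S.rk x y - S.rkAdj x y) * (if y ∈ A then f y else 0) =
      ∑ y ∈ A, (S.rk x y - S.rkAdj x y) * f y := by
    intro x
    rw [← Finset.sum_subset hA fun y _ hy => by rw [if_neg hy, mul_zero]]
    exact Finset.sum_congr rfl fun y hy => by rw [if_pos hy]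
  simp_rw [h2] at h
  rw [h1] at h
  refine le_trans (Finset.sum_le_sum_of_subset_of_nonneg hF fun x _ _ => ?_) h
  exact mul_nonneg (by positivity) (S.wR_pos (by omega) x).le

theorem rkAdj_strong_type (hq : 2 ≤ q) {p : ℝ} (hp1 : 1 < p) (hp2 : p < 2) :
    ∃ C : ℝ, ∀ (F A : Finset S.V) (f : S.V → ℝ),
      ∑ x ∈ F, |∑ y ∈ A, S.rkAdj x y * f y| ^ p * S.wR x ≤
      C * ∑ x ∈ A, |f x| ^ p * S.wR x := by
  obtain ⟨C, hC⟩ := S.rk_strong_type hq hp1 hp2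
  have hp0 : 0 ≤ p := by linarith
  refine ⟨2 ^ p * (C + 2 ^ p * (2 * C)), fun F A f => ?_⟩
  rcases F.eq_empty_or_nonempty with rfl | ⟨x₀, _⟩
  · rcases A.eq_empty_or_nonempty with rfl | ⟨x₀, hx₀⟩
    · simp
    · have := hC {x₀} A f
      have h0 : 0 ≤ C * ∑ x ∈ A, |f x| ^ p * S.wR x := le_trans (Finset.sum_nonneg fun x _ =>
        mul_nonneg (by positivity) (S.wR_pos (by omega) x).le) (hC ∅ A f)
      rw [Finset.sum_empty, mul_assoc, add_mul, mul_assoc, mul_assoc]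
      positivity
  have h := sum_abs_sub_rpow_le hp0 F (fun x => ∑ y ∈ A, S.rk x y * f y)
    (fun x => ∑ y ∈ A, (S.rk x y - S.rkAdj x y) * f y) S.wR fun x _ => (S.wR_pos (by omega) x).le
  have e : ∀ x, ∑ y ∈ A, S.rk x y * f y - ∑ y ∈ A, (S.rk x y - S.rkAdj x y) * f y =
      ∑ y ∈ A, S.rkAdj x y * f y := fun x => by
    rw [← Finset.sum_sub_distrib]
    exact Finset.sum_congr rfl fun y _ => by ring
  simp_rw [e] at h
  refine h.trans ?_
  rw [mul_assoc, add_mul]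
  gcongr
  · exact hC F A f
  · exact S.rk_sub_rkAdj_strong_type hq hp1.le
      (fun J => rho_sub_strong_type hp0 (S.rho_strong_type hq x₀ hp0 hC J)) x₀ F A f

/-- Duality: an `L^s` bound for `rkAdj` gives an `L^p` bound for `rk`. -/
theorem rk_strong_type_of_adj (hq : 0 < q) {p s C : ℝ} (hps : p.HolderConjugate s)
    (hC : ∀ (F A : Finset S.V) (f : S.V → ℝ),
      ∑ x ∈ F, |∑ y ∈ A, S.rkAdj x y * f y| ^ s * S.wR x ≤ C * ∑ x ∈ A, |f x| ^ s * S.wR x)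
    (F A : Finset S.V) (f : S.V → ℝ) :
    ∑ x ∈ F, |∑ y ∈ A, S.rk x y * f y| ^ p * S.wR x ≤
      |C| ^ (p / s) * ∑ x ∈ A, |f x| ^ p * S.wR x := by
  have hw := S.wR_pos hq
  set u : S.V → ℝ := fun x => ∑ y ∈ A, S.rk x y * f y
  set g : S.V → ℝ := fun x => SignType.sign (u x) * |u x| ^ (p - 1)
  set N := ∑ x ∈ F, |u x| ^ p * S.wR x
  set a := ∑ x ∈ A, |f x| ^ p * S.wR x
  have hN0 : 0 ≤ N := Finset.sum_nonneg fun x _ => mul_nonneg (by positivity) (hw x).le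
  have ha0 : 0 ≤ a := Finset.sum_nonneg fun x _ => mul_nonneg (by positivity) (hw x).le
  have hp1 := hps.lt
  have hg : ∀ x, g x * u x = |u x| ^ p := by
    intro x
    simp only [g]
    rw [mul_right_comm, mul_comm (SignType.sign (u x) : ℝ), self_mul_sign, mul_comm,
      ← Real.rpow_add_one' (abs_nonneg _) (by linarith), sub_add_cancel]
  have hgs : ∀ x, |g x| ^ s ≤ |u x| ^ p := by
    intro x
    have h1 : |g x| ≤ |u x| ^ (p - 1) := by
      simp only [g]
      rw [abs_mul, abs_of_nonneg (by positivity : 0 ≤ |u x| ^ (p - 1))]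
      refine mul_le_of_le_one_left (by positivity) ?_
      rcases lt_trichotomy (u x) 0 with h | h | h <;> simp [h]
    calc |g x| ^ s ≤ (|u x| ^ (p - 1)) ^ s :=
          Real.rpow_le_rpow (abs_nonneg _) h1 hps.symm.nonneg
      _ = |u x| ^ p := by rw [← Real.rpow_mul (abs_nonneg _), hps.sub_one_mul_conj]
  have hdual : N = ∑ y ∈ A, (f y * S.wR y ^ (1 / p)) *
      ((∑ x ∈ F, S.rkAdj y x * g x) * S.wR y ^ (1 / s)) := by
    have h1 : N = ∑ x ∈ F, ∑ y ∈ A, g x * S.wR x * (S.rk x y * f y) := by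
      refine Finset.sum_congr rfl fun x _ => ?_
      rw [← hg, ← Finset.mul_sum]
      ring
    rw [h1, Finset.sum_comm]
    refine Finset.sum_congr rfl fun y _ => ?_
    have h2 : S.wR y ^ (1 / p) * S.wR y ^ (1 / s) = S.wR y := by
      rw [← Real.rpow_add (hw y), one_div, one_div, hps.inv_add_inv_eq_one, Real.rpow_one]
    calc _ = f y * (S.wR y * ∑ x ∈ F, S.rkAdj y x * g x) := by
          rw [Finset.mul_sum, Finset.mul_sum]
          refine Finset.sum_congr rfl fun x _ => ?_
          have := (hw y).ne'
          rw [rkAdj]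
          field_simp
      _ = _ := by nth_rw 1 [← h2]; ring
  have hroot : ∀ (r : ℝ) (_ : r ≠ 0) (v : S.V → ℝ) (y : S.V),
      |v y * S.wR y ^ (1 / r)| ^ r = |v y| ^ r * S.wR y := by
    intro r hr v y
    rw [abs_mul, Real.mul_rpow (abs_nonneg _) (abs_nonneg _),
      abs_of_pos (Real.rpow_pos_of_pos (hw y) _), ← Real.rpow_mul (hw y).le,
      one_div_mul_cancel hr, Real.rpow_one]
  have hH : N ≤ a ^ (1 / p) * (|C| * N) ^ (1 / s) := by
    rw [hdual]
    refine (Real.inner_le_Lp_mul_Lq A _ _ hps).trans ?_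
    rw [← hdual]
    simp_rw [hroot p hps.ne_zero f, hroot s hps.symm.ne_zero fun y => ∑ x ∈ F, S.rkAdj y x * g x]
    have h1 : ∑ x ∈ F, |g x| ^ s * S.wR x ≤ N :=
      Finset.sum_le_sum fun x _ => mul_le_mul_of_nonneg_right (hgs x) (hw x).le
    have h2 : 0 ≤ ∑ x ∈ F, |g x| ^ s * S.wR x :=
      Finset.sum_nonneg fun x _ => mul_nonneg (by positivity) (hw x).le
    refine mul_le_mul_of_nonneg_left (Real.rpow_le_rpow ?_ ?_ (one_div_nonneg.2 hps.symm.nonneg))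
      (Real.rpow_nonneg ha0 _)
    · exact Finset.sum_nonneg fun x _ => mul_nonneg (by positivity) (hw x).le
    · exact (hC A F g).trans (mul_le_mul (le_abs_self C) h1 h2 (abs_nonneg C))
  rcases hN0.eq_or_lt with h0 | hpos
  · change N ≤ _
    rw [← h0]
    positivity
  have hN1 : N ^ (1 / p) ≤ a ^ (1 / p) * |C| ^ (1 / s) := by
    have h1 : N = N ^ (1 / p) * N ^ (1 / s) := by
      rw [← Real.rpow_add hpos, one_div, one_div, hps.inv_add_inv_eq_one, Real.rpow_one]
    rw [Real.mul_rpow (abs_nonneg _) hN0, ← mul_assoc] at hH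
    refine le_of_mul_le_mul_right ?_ (Real.rpow_pos_of_pos hpos (1 / s))
    rwa [← h1]
  have h2 := Real.rpow_le_rpow (by positivity) hN1 hps.nonneg
  rw [Real.mul_rpow (by positivity) (by positivity), ← Real.rpow_mul hN0, ← Real.rpow_mul ha0,
    ← Real.rpow_mul (abs_nonneg _), one_div_mul_cancel hps.ne_zero, Real.rpow_one, Real.rpow_one,
    one_div_mul_eq_div] at h2
  change N ≤ _
  linarith

/-- The Riesz kernel is bounded on `L^p` for all `1 < p < ∞`. -/
theorem rk_strong_type_all (hq : 2 ≤ q) {p : ℝ} (hp1 : 1 < p) :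
    ∃ C : ℝ, ∀ (F A : Finset S.V) (f : S.V → ℝ),
      ∑ x ∈ F, |∑ y ∈ A, S.rk x y * f y| ^ p * S.wR x ≤ C * ∑ x ∈ A, |f x| ^ p * S.wR x := by
  rcases lt_trichotomy p 2 with h | rfl | h
  · exact S.rk_strong_type hq hp1 h
  · refine ⟨4, fun F A f => ?_⟩
    simpa using S.rk_l2 hq F A f
  · have hps := Real.HolderConjugate.conjExponent hp1
    have h2 : p.conjExponent < 2 := by
      rw [Real.conjExponent, div_lt_iff₀ (by linarith)]
      linarith
    obtain ⟨C, hC⟩ := S.rkAdj_strong_type hq hps.symm.lt h2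
    exact ⟨_, S.rk_strong_type_of_adj (by omega) hps hC⟩

end FlowTree

namespace FlowTree

variable {q : ℕ} (S : FlowTree q)

theorem w_eq_ofReal (hq : 0 < q) (x : S.V) : S.w x = ENNReal.ofReal (S.wR x) := by
  have hq' : (0 : ℝ) < q := by exact_mod_cast hq
  rw [w, wR, ← Real.rpow_intCast, ← ENNReal.ofReal_rpow_of_pos hq', ENNReal.ofReal_natCast]

theorem nnnorm_rpow_mul_w (hq : 0 < q) {p : ℝ} (hp : 0 ≤ p) (f : S.V → ℂ) (x : S.V) :
    (‖f x‖₊ : ℝ≥0∞) ^ p * S.w x = ENNReal.ofReal (‖f x‖ ^ p * S.wR x) := by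
  rw [S.w_eq_ofReal hq, ENNReal.ofReal_mul (by positivity),
    ← ENNReal.ofReal_rpow_of_nonneg (norm_nonneg _) hp, ofReal_norm]
  rfl

theorem norm_rpow_le_re_im {p : ℝ} (hp : 0 ≤ p) (z : ℂ) :
    ‖z‖ ^ p ≤ 2 ^ p * (|z.re| ^ p + |z.im| ^ p) := by
  have h := abs_sub_rpow_le hp |z.re| (-|z.im|)
  rw [sub_neg_eq_add, abs_neg, abs_abs, abs_abs, abs_of_nonneg (by positivity)] at h
  exact (Real.rpow_le_rpow (norm_nonneg _) (Complex.norm_le_abs_re_add_abs_im z) hp).trans h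

theorem riesz_eq_sum {f : S.V → ℂ} {A : Finset S.V} (hA : ∀ y, y ∉ A → f y = 0) (x : S.V) :
    S.riesz f x = ∑ y ∈ A, (S.rk x y : ℂ) * f y := by
  rw [riesz, tsum_eq_sum (s := A) fun y hy => by rw [hA y hy, mul_zero, zero_mul]]
  refine Finset.sum_congr rfl fun y _ => ?_
  rw [rk]
  push_cast
  ring

theorem sum_norm_riesz_le (hq : 0 < q) {p C : ℝ} (hp : 0 ≤ p) (hC0 : 0 ≤ C)
    (hC : ∀ (F A : Finset S.V) (f : S.V → ℝ),
      ∑ x ∈ F, |∑ y ∈ A, S.rk x y * f y| ^ p * S.wR x ≤ C * ∑ x ∈ A, |f x| ^ p * S.wR x)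
    {f : S.V → ℂ} {A : Finset S.V} (hA : ∀ y, y ∉ A → f y = 0) (F : Finset S.V) :
    ∑ x ∈ F, ‖S.riesz f x‖ ^ p * S.wR x ≤
      2 ^ p * (2 * C) * ∑ x ∈ A, ‖f x‖ ^ p * S.wR x := by
  have hw := fun x => (S.wR_pos hq x).le
  have hre := hC F A fun y => (f y).re
  have him := hC F A fun y => (f y).im
  have h1 : ∑ x ∈ A, |(f x).re| ^ p * S.wR x ≤ ∑ x ∈ A, ‖f x‖ ^ p * S.wR x :=
    Finset.sum_le_sum fun x _ => mul_le_mul_of_nonneg_right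
      (Real.rpow_le_rpow (abs_nonneg _) (Complex.abs_re_le_norm _) hp) (hw x)
  have h2 : ∑ x ∈ A, |(f x).im| ^ p * S.wR x ≤ ∑ x ∈ A, ‖f x‖ ^ p * S.wR x :=
    Finset.sum_le_sum fun x _ => mul_le_mul_of_nonneg_right
      (Real.rpow_le_rpow (abs_nonneg _) (Complex.abs_im_le_norm _) hp) (hw x)
  have h3 : ∑ x ∈ F, ‖S.riesz f x‖ ^ p * S.wR x ≤
      2 ^ p * (∑ x ∈ F, |∑ y ∈ A, S.rk x y * (f y).re| ^ p * S.wR x +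
        ∑ x ∈ F, |∑ y ∈ A, S.rk x y * (f y).im| ^ p * S.wR x) := by
    rw [← Finset.sum_add_distrib, Finset.mul_sum]
    refine Finset.sum_le_sum fun x _ => ?_
    rw [← add_mul, ← mul_assoc]
    refine mul_le_mul_of_nonneg_right ((norm_rpow_le_re_im hp _).trans_eq ?_) (hw x)
    rw [S.riesz_eq_sum hA, Complex.re_sum, Complex.im_sum]
    simp_rw [Complex.re_ofReal_mul, Complex.im_ofReal_mul]
  refine h3.trans ?_
  rw [mul_assoc]
  refine mul_le_mul_of_nonneg_left ?_ (by positivity)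
  have h4 := mul_le_mul_of_nonneg_left h1 hC0
  have h5 := mul_le_mul_of_nonneg_left h2 hC0
  linarith

theorem lpNorm_riesz_le (hq : 0 < q) {p : ℝ≥0∞} {C : ℝ} (hp : p ≠ ∞) (hC0 : 0 ≤ C)
    (hC : ∀ (F A : Finset S.V) (f : S.V → ℝ),
      ∑ x ∈ F, |∑ y ∈ A, S.rk x y * f y| ^ p.toReal * S.wR x ≤
        C * ∑ x ∈ A, |f x| ^ p.toReal * S.wR x)
    (f : S.V → ℂ) (hf : (support f).Finite) :
    S.lpNorm p (S.riesz f) ≤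
      ENNReal.ofReal (2 ^ p.toReal * (2 * C)) ^ (1 / p.toReal) * S.lpNorm p f := by
  have hpr : 0 ≤ p.toReal := ENNReal.toReal_nonneg
  rw [lpNorm, lpNorm, if_neg hp, if_neg hp, ← ENNReal.mul_rpow_of_nonneg _ _ (by positivity)]
  refine ENNReal.rpow_le_rpow ?_ (by positivity)
  simp_rw [S.nnnorm_rpow_mul_w hq hpr]
  rw [ENNReal.tsum_eq_iSup_sum]
  refine iSup_le fun F => ?_
  have hnn : ∀ (g : S.V → ℂ) (x : S.V), 0 ≤ ‖g x‖ ^ p.toReal * S.wR x := fun g x =>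
    mul_nonneg (by positivity) (S.wR_pos hq x).le
  rw [← ENNReal.ofReal_sum_of_nonneg fun x _ => hnn _ x]
  have h := S.sum_norm_riesz_le hq hpr hC0 hC (f := f) (A := hf.toFinset) (fun y hy => by
    simpa using hy) F
  refine (ENNReal.ofReal_le_ofReal h).trans ?_
  rw [ENNReal.ofReal_mul (by positivity), ENNReal.ofReal_sum_of_nonneg fun x _ => hnn _ x]
  gcongr
  exact ENNReal.sum_le_tsum _

end FlowTree

/-- For every `p ∈ (1,∞)` there is `C_p < ∞` such that the Riesz transform
`𝓡 = ∇𝓛^{−1/2}` satisfies `‖𝓡f‖_{L^p(μ)} ≤ C_p ‖f‖_{L^p(μ)}` for all finitely supported `f`. -/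
theorem riesz_transform_lp_bounded {q : ℕ} (hq : 2 ≤ q) (S : FlowTree q)
    (p : ℝ≥0∞) (hp1 : 1 < p) (hptop : p ≠ ∞) :
    ∃ C : ℝ≥0∞, C < ∞ ∧ ∀ f : S.V → ℂ, (Function.support f).Finite →
      S.lpNorm p (S.riesz f) ≤ C * S.lpNorm p f := by
  have hp : 1 < p.toReal := by
    rwa [← ENNReal.toReal_one, ENNReal.toReal_lt_toReal ENNReal.one_ne_top hptop]
  obtain ⟨C, hC⟩ := S.rk_strong_type_all hq hp
  refine ⟨ENNReal.ofReal (2 ^ p.toReal * (2 * |C|)) ^ (1 / p.toReal), ?_, fun f hf => ?_⟩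
  · exact ENNReal.rpow_lt_top_of_nonneg (by positivity) ENNReal.ofReal_ne_top
  · refine S.lpNorm_riesz_le (by omega) hptop (abs_nonneg C) (fun F A g => ?_) f hf
    refine (hC F A g).trans (mul_le_mul_of_nonneg_right (le_abs_self C) ?_)
    exact Finset.sum_nonneg fun x _ => mul_nonneg (by positivity) (S.wR_pos (by omega) x).le
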